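/- arXiv:1712.08984 — 5 statements merged into one kernel-verified Lean document; each statement's English description precedes it below -/
import Mathlib

section
/- Let m be a positive integer such that q = 4m² + 4m + 3 is a prime power, and set n = 4(m² + m + 1). Then there exists an Hadamard matrix H of order n each of whose row sums equals either 2m − 2 or 2m + 2; consequently the excess of H equals n(2m + 1) = 4(m² + m + 1)(2m + 1). -/
def gsP {G : Type*} [CommGroup G] [Fintype G] (X Y : G → ℤ) (u : G) : ℤ := ∑ k, X k * Y (k * u)
def gsQ {G : Type*} [CommGroup G] [Fintype G] (X Y : G → ℤ) (u : G) : ℤ := ∑ k, X k * Y ((k * u)⁻¹)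

section
variable {G : Type*} [CommGroup G] [Fintype G] (X Y : G → ℤ) (i j u : G)

lemma gsP_symm : gsP X Y u⁻¹ = gsP Y X u := by
  unfold gsP
  rw [← Equiv.sum_comp (Equiv.mulRight u)]
  exact Finset.sum_congr rfl fun k _ => by simp [mul_comm]

lemma gsQ_symm : gsQ X Y u = gsQ Y X u := by
  unfold gsQ
  rw [← Equiv.sum_comp ((Equiv.mulRight u).trans (Equiv.inv G))]
  exact Finset.sum_congr rfl fun k _ => by simp [mul_comm]

lemma gs1 : ∑ k, X (k * i⁻¹) * Y (j * k) = gsP X Y (i * j) := by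
  unfold gsP
  rw [← Equiv.sum_comp (Equiv.mulRight i)]
  exact Finset.sum_congr rfl fun k _ => by
    simp only [Equiv.coe_mulRight, mul_inv_cancel_right]; congr 2; simp only [mul_comm, mul_left_comm]

lemma gs2 : ∑ k, X (i * k) * Y (k * j⁻¹) = gsP Y X (i * j) := by
  rw [mul_comm i j, ← gs1]; exact Finset.sum_congr rfl fun k _ => mul_comm _ _

lemma gs3 : ∑ k, X (k * i⁻¹) * Y (k * j⁻¹) = gsP X Y (i * j⁻¹) := by
  rw [← gs1]; exact Finset.sum_congr rfl fun k _ => by rw [mul_comm k j⁻¹]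

lemma gs4 : ∑ k, X (i * k) * Y (j * k) = gsP Y X (i * j⁻¹) := by
  rw [← gs2]; exact Finset.sum_congr rfl fun k _ => by rw [inv_inv, mul_comm k j]

lemma gs5 : ∑ k, X ((i * k)⁻¹) * Y ((j * k)⁻¹) = gsP X Y (i * j⁻¹) := by
  unfold gsP
  rw [← Equiv.sum_comp ((Equiv.mulLeft i).trans (Equiv.inv G)) (fun k => X k * Y (k * (i * j⁻¹)))]
  exact Finset.sum_congr rfl fun k _ => by
    have : (i * k)⁻¹ * (i * j⁻¹) = (i⁻¹ * i) * (j * k)⁻¹ := by simp only [mul_inv]; ac_rfl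
    simp only [Equiv.trans_apply, Equiv.coe_mulLeft, Equiv.inv_apply, this, inv_mul_cancel, one_mul]

lemma gs6 : ∑ k, X (k * i⁻¹) * Y ((j * k)⁻¹) = gsQ X Y (i * j) := by
  exact gs1 X (fun k => Y k⁻¹) i j

lemma gs7 : ∑ k, X ((i * k)⁻¹) * Y (k * j⁻¹) = gsQ Y X (i * j) := by
  exact gs2 (fun k => X k⁻¹) Y i j

lemma gs8 : ∑ k, X (i * k) * Y ((j * k)⁻¹) = gsQ X Y (i⁻¹ * j) := by
  rw [← gs6]; exact Finset.sum_congr rfl fun k _ => by simp [mul_comm]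

lemma gs9 : ∑ k, X ((i * k)⁻¹) * Y (j * k) = gsQ X Y (i * j⁻¹) := by
  rw [gsQ_symm, ← gs7]; simp [mul_comm]

end

def gsM {G : Type*} [CommGroup G] (A B C D : G → ℤ) : Matrix (Fin 4 × G) (Fin 4 × G) ℤ :=
  fun x y => (![![A (y.2 * x.2⁻¹), B (x.2 * y.2), C (x.2 * y.2), D (x.2 * y.2)],
    ![-B (x.2 * y.2), A (y.2 * x.2⁻¹), D ((x.2 * y.2)⁻¹), -C ((x.2 * y.2)⁻¹)],
    ![-C (x.2 * y.2), -D ((x.2 * y.2)⁻¹), A (y.2 * x.2⁻¹), B ((x.2 * y.2)⁻¹)],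
    ![-D (x.2 * y.2), C ((x.2 * y.2)⁻¹), -B ((x.2 * y.2)⁻¹), A (y.2 * x.2⁻¹)]] :
      Fin 4 → Fin 4 → ℤ) x.1 y.1

lemma gsM_mul {G : Type*} [CommGroup G] [Fintype G] [DecidableEq G] (A B C D : G → ℤ) (N : ℤ)
    (h : ∀ u, gsP A A u + gsP B B u + gsP C C u + gsP D D u = if u = 1 then N else 0) :
    gsM A B C D * (gsM A B C D).transpose = N • (1 : Matrix _ _ ℤ) := by
  ext ⟨a, i⟩ ⟨b, j⟩
  have hd := h (i * j⁻¹)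
  have e : (a, i) = (b, j) ↔ a = b ∧ i * j⁻¹ = 1 := by
    rw [Prod.mk.injEq, mul_inv_eq_one]
  simp only [Matrix.mul_apply, Matrix.transpose_apply, Matrix.smul_apply, Matrix.one_apply, e,
    Fintype.sum_prod_type, Fin.sum_univ_four]
  have s1 := gsP_symm A A (i * j⁻¹)
  have e2 : i⁻¹ * j = (i * j⁻¹)⁻¹ := by simp [mul_comm]
  fin_cases a <;> fin_cases b <;>
  simp [gsM, gs1, gs2, gs3, gs4, gs5, gs6, gs7, gs8, gs9, -mul_inv_rev] <;>
  first
  | (split_ifs at hd ⊢ <;> linarith)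
  | (simp only [gsQ_symm C B, gsQ_symm D B, gsQ_symm D C]; try ring)

lemma gsP_sum {G : Type*} [CommGroup G] [Fintype G] (X : G → ℤ) :
    ∑ u, gsP X X u = (∑ k, X k) ^ 2 := by
  unfold gsP
  rw [Finset.sum_comm, sq, Finset.sum_mul]
  refine Finset.sum_congr rfl fun k _ => ?_
  rw [← Finset.mul_sum]
  exact congrArg _ (Equiv.sum_comp (Equiv.mulLeft k) X)

lemma gsP_neg {G : Type*} [CommGroup G] [Fintype G] (X : G → ℤ) (e : ℤ) (he : e ^ 2 = 1) (u : G) :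
    gsP (fun k => e * X k) (fun k => e * X k) u = gsP X X u := by
  unfold gsP
  exact Finset.sum_congr rfl fun k _ => by linear_combination (X k * X (k * u)) * he

lemma gs_main {G : Type*} [CommGroup G] [Fintype G] [DecidableEq G] (t n : ℕ)
    (ht : Fintype.card G = t) (hn : n = 4 * t) (s : ℤ) (A B C D : G → ℤ)
    (hA : ∀ k, A k = 1 ∨ A k = -1) (hB : ∀ k, B k = 1 ∨ B k = -1)
    (hC : ∀ k, C k = 1 ∨ C k = -1) (hD : ∀ k, D k = 1 ∨ D k = -1)
    (h : ∀ u, gsP A A u + gsP B B u + gsP C C u + gsP D D u = if u = 1 then (n : ℤ) else 0)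
    (sA : ∑ k, A k = s) (sB : ∑ k, B k = -1) (sC : ∑ k, C k = -1) (sD : ∑ k, D k = -1) :
    ∃ H : Matrix (Fin n) (Fin n) ℤ, (∀ i j, H i j = 1 ∨ H i j = -1) ∧
      H * H.transpose = (n : ℤ) • (1 : Matrix _ _ ℤ) ∧
      (∀ i, (∑ j, H i j) = s - 3 ∨ (∑ j, H i j) = s + 1) ∧
      (∑ i, ∑ j, H i j) = n * s := by
  have e : Fin 4 × G ≃ Fin n := Fintype.equivFinOfCardEq (by simp [ht, hn])
  have r1 (X : G → ℤ) (i : G) : ∑ k, X (k * i⁻¹) = ∑ k, X k := Equiv.sum_comp (Equiv.mulRight i⁻¹) X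
  have r2 (X : G → ℤ) (i : G) : ∑ k, X (i * k) = ∑ k, X k := Equiv.sum_comp (Equiv.mulLeft i) X
  have r3 (X : G → ℤ) (i : G) : ∑ k, X ((i * k)⁻¹) = ∑ k, X k :=
    Equiv.sum_comp ((Equiv.mulLeft i).trans (Equiv.inv G)) X
  have rs : ∀ a i, ∑ y, gsM A B C D (a, i) y = if a = 0 then s - 3 else s + 1 := by
    intro a i
    rw [Fintype.sum_prod_type, Fin.sum_univ_four]
    fin_cases a <;>
      simp [gsM, r1, r2, r3, sA, sB, sC, sD, -mul_inv_rev] <;> ring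
  have hs : ∀ i, ∑ j, Matrix.reindex e e (gsM A B C D) i j = ∑ y, gsM A B C D (e.symm i) y := by
    intro i
    exact Equiv.sum_comp e.symm (fun y => gsM A B C D (e.symm i) y)
  refine ⟨Matrix.reindex e e (gsM A B C D), ?_, ?_, ?_, ?_⟩
  · intro i j
    simp only [Matrix.reindex_apply, Matrix.submatrix_apply]
    generalize e.symm i = x
    generalize e.symm j = y
    obtain ⟨a, i⟩ := x
    obtain ⟨b, j⟩ := y
    have hA' := hA (j * i⁻¹)
    have hB' := hB (i * j)
    have hC' := hC (i * j)
    have hD' := hD (i * j)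
    have hB'' := hB (i * j)⁻¹
    have hC'' := hC (i * j)⁻¹
    have hD'' := hD (i * j)⁻¹
    fin_cases a <;> fin_cases b <;> simp [gsM, -mul_inv_rev] <;> omega
  · have := gsM_mul A B C D n h
    rw [Matrix.reindex_apply, Matrix.transpose_submatrix, Matrix.submatrix_mul_equiv, this]
    ext i j
    simp only [Matrix.submatrix_apply, Matrix.smul_apply, Matrix.one_apply, e.symm.injective.eq_iff]
  · intro i
    rw [hs, ← Prod.mk.eta (p := e.symm i), rs]
    split_ifs <;> simp
  · simp_rw [hs]
    rw [Equiv.sum_comp e.symm (fun x => ∑ y, gsM A B C D x y), Fintype.sum_prod_type]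
    simp_rw [rs]
    simp [Fin.sum_univ_four, ht, hn]
    ring

lemma lucas_aux (a c : ℕ) (hp : (8 * a + 3).Prime) (h : ¬ (8 * a + 3) ∣ (4 * c + 1).choose c) :
    ¬ (8 * a + 3) ∣ ((8 * a + 3) * ((8 * a + 3) * (4 * c + 1) + (4 * a + 1)) + (4 * a + 1)).choose
      ((8 * a + 3) * ((8 * a + 3) * c + (3 * a + 1)) + a) := by
  have : Fact (8 * a + 3).Prime := ⟨hp⟩
  have st : ∀ N k x y, x < 8 * a + 3 → y ≤ x → ¬ (8 * a + 3) ∣ N.choose k →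
      ¬ (8 * a + 3) ∣ ((8 * a + 3) * N + x).choose ((8 * a + 3) * k + y) := by
    intro N k x y hx hy hN hd
    have := Choose.choose_modEq_choose_mod_mul_choose_div_nat (p := 8 * a + 3)
      (n := (8 * a + 3) * N + x) (k := (8 * a + 3) * k + y)
    rw [Nat.mul_add_mod, Nat.mul_add_mod, Nat.mod_eq_of_lt hx, Nat.mod_eq_of_lt (hy.trans_lt hx),
      Nat.mul_add_div (by omega), Nat.mul_add_div (by omega), Nat.div_eq_of_lt hx,
      Nat.div_eq_of_lt (hy.trans_lt hx), add_zero, add_zero] at this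
    have h2 := (this.dvd_iff dvd_rfl).1 hd
    rcases hp.dvd_mul.1 h2 with h3 | h3
    · have h4 := Nat.choose_mul_factorial_mul_factorial hy
      have : 8 * a + 3 ∣ x.factorial := by
        rw [← h4, mul_assoc]; exact h3.mul_right _
      rw [hp.dvd_factorial] at this
      omega
    · exact hN h3
  exact st _ _ _ _ (by omega) (by omega) (st _ _ _ _ (by omega) (by omega) h)

lemma lucas_main (a j : ℕ) (hp : (8 * a + 3).Prime) :
    ∃ c, (8 * a + 3) ^ (2 * j + 1) = 8 * c + 3 ∧ ¬ (8 * a + 3) ∣ (4 * c + 1).choose c := by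
  induction j with
  | zero =>
    refine ⟨a, by simp, ?_⟩
    intro h3
    have h4 := Nat.choose_mul_factorial_mul_factorial (show a ≤ 4 * a + 1 by omega)
    have : 8 * a + 3 ∣ (4 * a + 1).factorial := by
      rw [← h4, mul_assoc]; exact h3.mul_right _
    rw [hp.dvd_factorial] at this
    omega
  | succ j ih =>
    obtain ⟨c, h1, h2⟩ := ih
    refine ⟨(8 * a + 3) * ((8 * a + 3) * c + (3 * a + 1)) + a, ?_, ?_⟩
    · rw [show 2 * (j + 1) + 1 = 2 * j + 1 + 2 by ring, pow_add, h1]; ring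
    · convert lucas_aux a c hp h2 using 2
      ring_nf

lemma lucas_fin (p k c : ℕ) (hp : p.Prime) (h : p ^ k = 8 * c + 3) :
    ¬ p ∣ (4 * c + 1).choose c := by
  have hk : p ^ k % 8 = 3 := by omega
  rcases Nat.even_or_odd' k with ⟨j, rfl | rfl⟩
  · rw [pow_mul', ] at hk
    generalize p ^ j = y at hk
    have : y % 8 < 8 := Nat.mod_lt _ (by norm_num)
    rw [Nat.pow_mod] at hk
    interval_cases y % 8 <;> simp at hk
  · have : p % 8 = 3 := by
      rw [pow_succ, pow_mul', Nat.mul_mod, Nat.pow_mod (p ^ j)] at hk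
      generalize p ^ j = y at hk
      have h1 : y % 8 < 8 := Nat.mod_lt _ (by norm_num)
      have h2 : p % 8 < 8 := Nat.mod_lt _ (by norm_num)
      interval_cases y % 8 <;> simp at hk <;> omega
    obtain ⟨a, rfl⟩ : ∃ a, p = 8 * a + 3 := ⟨p / 8, by omega⟩
    obtain ⟨c', h1, h2⟩ := lucas_main a j hp
    have : c' = c := by omega
    exact this ▸ h2

lemma uniq_rep (p k : ℕ) (q s b c : ℤ) (hp : p.Prime) (hp2 : p ≠ 2) (hq : q = (p : ℤ) ^ k)
    (hq0 : 0 < k)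
    (hs : q = s ^ 2 + 2) (hbc : c ^ 2 + 2 * b ^ 2 = q) (hb : ¬ (p : ℤ) ∣ b) :
    b ^ 2 = 1 ∧ c ^ 2 = s ^ 2 := by
  have hpI : Prime (p : ℤ) := Nat.prime_iff_prime_int.1 hp
  have hqpos : 0 < q := by nlinarith [sq_nonneg s]
  have hpq : (p : ℤ) ∣ q := hq ▸ dvd_pow_self _ hq0.ne'
  have hp2' : ¬ (p : ℤ) ∣ 2 := by
    intro h
    have : p ∣ 2 := by exact_mod_cast h
    exact hp2 ((Nat.prime_dvd_prime_iff_eq hp Nat.prime_two).1 this)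
  have key : ∀ c : ℤ, c ^ 2 + 2 * b ^ 2 = q → q ∣ c - s * b → b ^ 2 = 1 ∧ c ^ 2 = s ^ 2 := by
    rintro c hc ⟨w, hw⟩
    have h1 : q ^ 2 = (c * s + 2 * b) ^ 2 + 2 * (q * w) ^ 2 := by
      rw [← hw]
      calc q ^ 2 = q * q := by ring
        _ = (c ^ 2 + 2 * b ^ 2) * (s ^ 2 + 2) := by rw [hc, ← hs]
        _ = _ := by ring
    have hw0 : w = 0 := by
      by_contra hne
      have : 1 ≤ w ^ 2 := by have := sq_pos_of_ne_zero (a := w) hne; omega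
      nlinarith [sq_nonneg (c * s + 2 * b), sq_pos_of_pos hqpos, mul_le_mul_of_nonneg_left this (sq_nonneg q)]
    have hcs : c = s * b := by rw [hw0] at hw; linarith
    have : q * (b ^ 2 - 1) = 0 := by
      have : q * b ^ 2 = q := by
        conv_lhs => rw [hs]
        rw [← hc, hcs]; ring
      linarith
    have hb1 : b ^ 2 = 1 := by
      rcases mul_eq_zero.1 this with h | h
      · omega
      · linarith
    exact ⟨hb1, by rw [hcs, mul_pow, hb1, mul_one]⟩
  have hprod : (p : ℤ) ^ k ∣ (c - s * b) * (c + s * b) := by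
    refine ⟨1 - b ^ 2, ?_⟩
    rw [← hq]
    linear_combination hbc + b ^ 2 * hs
  have hnb : ¬ ((p : ℤ) ∣ c - s * b ∧ (p : ℤ) ∣ c + s * b) := by
    rintro ⟨h1, h2⟩
    have h3 : (p : ℤ) ∣ 2 * c := by have := dvd_add h1 h2; ring_nf at this; rwa [mul_comm] 
    have h4 : (p : ℤ) ∣ c := (hpI.dvd_or_dvd h3).resolve_left hp2'
    have h5 : (p : ℤ) ∣ 2 * b ^ 2 := by
      have : 2 * b ^ 2 = q - c * c := by linarith [sq c]
      rw [this]; exact dvd_sub hpq (h4.mul_left _)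
    exact hb (hpI.dvd_of_dvd_pow ((hpI.dvd_or_dvd h5).resolve_left hp2'))
  by_cases h1 : (p : ℤ) ∣ c - s * b
  · have h2 : ¬ (p : ℤ) ∣ c + s * b := fun h => hnb ⟨h1, h⟩
    have cop : IsCoprime ((p : ℤ) ^ k) (c + s * b) :=
      ((hpI.coprime_iff_not_dvd).2 h2).pow_left
    exact key c hbc (hq ▸ cop.dvd_of_dvd_mul_right hprod)
  · have cop : IsCoprime ((p : ℤ) ^ k) (c - s * b) :=
      ((hpI.coprime_iff_not_dvd).2 h1).pow_left
    have := cop.dvd_of_dvd_mul_left hprod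
    have := key (-c) (by rw [neg_sq]; exact hbc) (by
      rw [hq]; have := dvd_neg.2 this; rwa [neg_add, ← sub_eq_add_neg] at this)
    rwa [neg_sq] at this

section
set_option linter.unusedSectionVars false
variable {F : Type*} [Field F] [Fintype F] [DecidableEq F]

abbrev QK (F : Type*) [Field F] := QuadraticAlgebra F (-1) 0

noncomputable instance : Fintype (QK F) := Fintype.ofEquiv _ (QuadraticAlgebra.equivProd (-1 : F) 0).symm

lemma QK_card : Fintype.card (QK F) = Fintype.card F ^ 2 := by
  rw [Fintype.card_congr (QuadraticAlgebra.equivProd (-1 : F) 0), Fintype.card_prod, sq]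

def qphi (x : QK F) : ℤ := quadraticChar F x.im

lemma QK_fact (c : ℕ) (hc : Fintype.card F = 8 * c + 3) :
    Fact (∀ r : F, r ^ 2 ≠ (-1) + 0 * r) := ⟨fun r h => by
  have : IsSquare (-1 : F) := ⟨r, by rw [zero_mul, add_zero] at h; rw [← h, sq]⟩
  rw [FiniteField.isSquare_neg_one_iff] at this
  omega⟩

lemma F_char (c : ℕ) (hc : Fintype.card F = 8 * c + 3) : ringChar F ≠ 2 := by
  intro h
  have := FiniteField.even_card_of_char_two h
  omega

lemma chi_neg (c : ℕ) (hc : Fintype.card F = 8 * c + 3) (x : F) :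
    quadraticChar F (-x) = - quadraticChar F x := by
  have : quadraticChar F (-1) = -1 := by
    rw [quadraticChar_neg_one_iff_not_isSquare, FiniteField.isSquare_neg_one_iff]
    omega
  rw [← neg_one_mul, map_mul, this, neg_one_mul]

lemma QK_frob (c : ℕ) (hc : Fintype.card F = 8 * c + 3) (x : QK F) :
    x ^ (8 * c + 3) = ⟨x.re, -x.im⟩ := by
  have hx : x = algebraMap F (QK F) x.re + algebraMap F (QK F) x.im * ⟨0, 1⟩ := by
    ext <;> simp [QuadraticAlgebra.algebraMap_eq]
  have hi : (⟨0, 1⟩ : QK F) ^ 2 = -1 := by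
    ext <;> simp [sq, QuadraticAlgebra.re_one, QuadraticAlgebra.im_one]
  have hi2 : (⟨0, 1⟩ : QK F) ^ (8 * c + 3) = -⟨0, 1⟩ := by
    rw [show 8 * c + 3 = 2 * (4 * c + 1) + 1 by ring, pow_succ, pow_mul, hi, Odd.neg_one_pow ⟨2 * c, by ring⟩]
    simp
  have hf : ∀ y : QK F, FiniteField.frobeniusAlgHom F (QK F) y = y ^ (8 * c + 3) := by
    intro y; rw [FiniteField.coe_frobeniusAlgHom, hc]
  rw [← hf]
  conv_lhs => rw [hx]
  rw [map_add, map_mul, AlgHom.commutes, AlgHom.commutes, hf, hi2]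
  ext <;> simp [QuadraticAlgebra.algebraMap_eq]

lemma qphi_frob (c : ℕ) (hc : Fintype.card F = 8 * c + 3) (x : QK F) :
    qphi (x ^ (8 * c + 3)) = - qphi x := by
  rw [QK_frob c hc, qphi, qphi]
  exact chi_neg c hc _

lemma qphi_sum (c : ℕ) (hc : Fintype.card F = 8 * c + 3) (z : QK F) (hz : z.im ≠ 0) :
    ∑ x : QK F, qphi x * qphi (x * z) = 0 := by
  let L : QK F → QK F := fun x => ⟨x.re + 2 * x.im * z.re / z.im, -x.im⟩
  have hL : Function.Involutive L := by
    intro x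
    ext
    · simp only [L]; ring
    · simp only [L]; ring
  have h := Equiv.sum_comp hL.toPerm (fun x : QK F => qphi x * qphi (x * z))
  have h2 : ∀ x, qphi (L x) * qphi (L x * z) = - (qphi x * qphi (x * z)) := by
    intro x
    have e1 : qphi (L x) = - qphi x := chi_neg c hc _
    have e2 : (L x * z).im = (x * z).im := by
      simp only [L, QuadraticAlgebra.im_mul]
      field_simp
      ring
    have e3 : qphi (L x * z) = qphi (x * z) := by rw [qphi, qphi, e2]
    rw [e1, e3]; ring
  have h3 : ∑ x : QK F, qphi (L x) * qphi (L x * z) = ∑ x : QK F, qphi x * qphi (x * z) := h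
  simp_rw [h2] at h3
  rw [Finset.sum_neg_distrib] at h3
  omega

lemma qphi_smul (l : F) (x : QK F) : qphi (algebraMap F (QK F) l * x) = quadraticChar F l * qphi x := by
  rw [qphi, qphi, ← map_mul]
  simp

lemma qphi_cast (c : ℕ) (hc : Fintype.card F = 8 * c + 3) (x : QK F) :
    (⟨0, 2⟩ : QK F) ^ (4 * c + 1) * ((qphi x : ℤ) : QK F) = (x - x ^ (8 * c + 3)) ^ (4 * c + 1) := by
  have h1 : ((qphi x : ℤ) : QK F) = algebraMap F (QK F) (x.im) ^ (4 * c + 1) := by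
    have := quadraticChar_eq_pow_of_char_ne_two' (F_char c hc) x.im
    rw [hc, show (8 * c + 3) / 2 = 4 * c + 1 by omega] at this
    rw [← map_pow, ← this, map_intCast]
    rfl
  rw [h1, ← mul_pow, QK_frob c hc]
  congr 1
  ext <;> simp [QuadraticAlgebra.algebraMap_eq]
  ring

end

lemma seq_core {F : Type*} [Field F] [Fintype F] [DecidableEq F] (p c : ℕ)
    [CharP F p] (hc : Fintype.card F = 8 * c + 3)
    [Fact (∀ r : F, r ^ 2 ≠ (-1) + 0 * r)] (hch : ¬ p ∣ (4 * c + 1).choose c)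
    (G : Subgroup (QK F)ˣ) [Fintype G] (g : (QK F)ˣ) (hgG : g ∈ G) (hgen : ∀ h : G, (h : (QK F)ˣ) ∈ Subgroup.zpowers g)
    (hg : orderOf g = 2 * c + 1) (hG : Fintype.card G = 2 * c + 1)
    (ζ : (QK F)ˣ) (hζ : orderOf ζ = 8) (hinv : ∀ h : G, (h : (QK F)ˣ) ^ (8 * c + 3) = (h : (QK F)ˣ)⁻¹)
    (hζq : ζ ^ (8 * c + 3) = ζ ^ 3) :
    ¬ (p : ℤ) ∣ ∑ h : G, qphi ((ζ * (h : (QK F)ˣ) : (QK F)ˣ) : QK F) := by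
  intro hdvd
  have hcharK : CharP (QK F) p := charP_of_injective_algebraMap (algebraMap F (QK F)).injective p
  have h0 : ((∑ h : G, qphi ((ζ * (h : (QK F)ˣ) : (QK F)ˣ) : QK F) : ℤ) : QK F) = 0 :=
    (CharP.intCast_eq_zero_iff (QK F) p _).2 hdvd
  have h1 : ∑ h : G, (((ζ * (h : (QK F)ˣ) : (QK F)ˣ) : QK F) - ((ζ * (h : (QK F)ˣ) : (QK F)ˣ) : QK F) ^ (8 * c + 3)) ^ (4 * c + 1)
      = 0 := by
    simp_rw [← qphi_cast c hc]
    rw [← Finset.mul_sum, ← Int.cast_sum, h0, mul_zero]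
  let f : ℕ → G →* QK F := fun m => (Units.coeHom (QK F)).comp
    ((zpowGroupHom (2 * (m : ℤ) - (4 * c + 1))).comp G.subtype)
  have hf : ∀ m (h : G), f m h = (((h : (QK F)ˣ) ^ (2 * (m : ℤ) - (4 * c + 1)) : (QK F)ˣ) : QK F) := fun m h => rfl
  have hf1 : ∀ m, m ≤ 4 * c + 1 → (f m = 1 ↔ m = c ∨ m = 3 * c + 1) := by
    intro m hm
    have : f m = 1 ↔ ((2 * c + 1 : ℕ) : ℤ) ∣ 2 * (m : ℤ) - (4 * c + 1) := by
      rw [← hg, orderOf_dvd_iff_zpow_eq_one]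
      constructor
      · intro h
        have := DFunLike.congr_fun h ⟨g, hgG⟩
        rw [hf] at this
        exact Units.ext this
      · intro h
        refine MonoidHom.ext fun x => ?_
        rw [hf]
        obtain ⟨k, hk⟩ := Subgroup.mem_zpowers_iff.1 (hgen x)
        rw [← hk, ← zpow_mul, mul_comm, zpow_mul, h, one_zpow]
        rfl
    rw [this]
    constructor
    · rintro ⟨k, hk⟩
      push_cast at hk
      have hk1 : -1 ≤ k := by
        by_contra h
        have : k ≤ -2 := by omega
        nlinarith
      have hk2 : k ≤ 1 := by
        by_contra h
        have : 2 ≤ k := by omega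
        nlinarith
      interval_cases k <;> omega
    · rintro (rfl | rfl)
      · exact ⟨-1, by push_cast; ring⟩
      · exact ⟨1, by push_cast; ring⟩
  have h2 : ∀ h : G, (((ζ * (h : (QK F)ˣ) : (QK F)ˣ) : QK F) - ((ζ * (h : (QK F)ˣ) : (QK F)ˣ) : QK F) ^ (8 * c + 3)) ^ (4 * c + 1)
      = ∑ m ∈ Finset.range (4 * c + 1 + 1), ((ζ : QK F) ^ m * (-(ζ : QK F) ^ 3) ^ (4 * c + 1 - m) *
        ((4 * c + 1).choose m : QK F)) * f m h := by
    intro h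
    rw [← Units.val_pow_eq_pow_val, mul_pow, hinv, hζq, sub_eq_add_neg, add_pow]
    refine Finset.sum_congr rfl fun m hm => ?_
    have hm' : m ≤ 4 * c + 1 := by have := Finset.mem_range.1 hm; omega
    have e : f m h = ((h : (QK F)ˣ) : QK F) ^ m * (((h : (QK F)ˣ)⁻¹ : (QK F)ˣ) : QK F) ^ (4 * c + 1 - m) := by
      rw [hf, ← Units.val_pow_eq_pow_val, ← Units.val_pow_eq_pow_val, ← Units.val_mul]
      congr 1
      rw [inv_pow, ← zpow_natCast, ← zpow_natCast, ← zpow_neg, ← zpow_add]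
      congr 1
      push_cast [hm']
      ring
    rw [e, Units.val_mul, Units.val_mul, Units.val_pow_eq_pow_val, ← neg_mul, mul_pow, mul_pow]
    ring
  simp_rw [h2] at h1
  rw [Finset.sum_comm] at h1
  classical
  have h3 : ∀ m ∈ Finset.range (4 * c + 1 + 1), ∑ h : G, ((ζ : QK F) ^ m * (-(ζ : QK F) ^ 3) ^ (4 * c + 1 - m) *
        ((4 * c + 1).choose m : QK F)) * f m h =
        (if m = c then ((ζ : QK F) ^ m * (-(ζ : QK F) ^ 3) ^ (4 * c + 1 - m) *
        ((4 * c + 1).choose m : QK F)) * (2 * c + 1 : ℕ) else 0) +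
        (if m = 3 * c + 1 then ((ζ : QK F) ^ m * (-(ζ : QK F) ^ 3) ^ (4 * c + 1 - m) *
        ((4 * c + 1).choose m : QK F)) * (2 * c + 1 : ℕ) else 0) := by
    intro m hm
    have hm' : m ≤ 4 * c + 1 := by have := Finset.mem_range.1 hm; omega
    rw [← Finset.mul_sum, sum_hom_units, hG]
    simp only [hf1 m hm']
    by_cases a1 : m = c
    · have : m ≠ 3 * c + 1 := by omega
      simp only [a1, true_or, if_true]
      rw [if_neg (by omega), add_zero]
    · by_cases a2 : m = 3 * c + 1
      · simp only [a2, or_true, if_true]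
        rw [if_neg (by omega), zero_add]
      · simp [a1, a2]
  rw [Finset.sum_congr rfl h3, Finset.sum_add_distrib, Finset.sum_ite_eq', Finset.sum_ite_eq',
    if_pos (Finset.mem_range.2 (by omega)), if_pos (Finset.mem_range.2 (by omega)),
    show 4 * c + 1 - c = c + (2 * c + 1) by omega, show 4 * c + 1 - (3 * c + 1) = c by omega,
    Nat.choose_symm_of_eq_add (show 4 * c + 1 = (3 * c + 1) + c by omega),
    show 3 * c + 1 = c + (2 * c + 1) by omega, pow_add _ c, pow_add _ c, Odd.neg_pow ⟨c, rfl⟩] at h1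
  have hz0 : (ζ : QK F) ≠ 0 := ζ.ne_zero
  have hchK : ((4 * c + 1).choose c : QK F) ≠ 0 := fun h => hch ((CharP.cast_eq_zero_iff (QK F) p _).1 h)
  have hp1 : p ∣ 8 * c + 3 := by
    rw [← CharP.cast_eq_zero_iff F p, ← hc, FiniteField.cast_card_eq_zero]
  have htK : ((2 * c + 1 : ℕ) : QK F) ≠ 0 := by
    intro h
    have h5 := (CharP.cast_eq_zero_iff (QK F) p _).1 h
    have h6 : p ∣ 1 := by
      have := Nat.dvd_sub (h5.mul_left 4) hp1
      rwa [show 4 * (2 * c + 1) - (8 * c + 3) = 1 by omega] at this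
    exact CharP.char_ne_one F p (Nat.dvd_one.1 h6)
  have h4 : (ζ : QK F) ^ c * (-(ζ : QK F) ^ 3) ^ c * ((4 * c + 1).choose c : QK F) * ((2 * c + 1 : ℕ) : QK F)
      * (ζ : QK F) ^ (2 * c + 1) * (1 - (ζ : QK F) ^ (2 * (2 * c + 1))) = 0 := by
    rw [← h1]
    generalize ((4 * c + 1).choose c : QK F) = y
    generalize ((2 * c + 1 : ℕ) : QK F) = w
    generalize (-(ζ : QK F) ^ 3) ^ c = v
    ring
  have h5 : (1 - (ζ : QK F) ^ (2 * (2 * c + 1))) = 0 := by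
    simpa [hz0, hchK, htK, -Nat.cast_add, -Nat.cast_mul] using h4
  have h6 : ζ ^ (2 * (2 * c + 1)) = 1 := by
    ext1
    rw [Units.val_pow_eq_pow_val, Units.val_one]
    exact (sub_eq_zero.1 h5).symm
  have h7 := orderOf_dvd_of_pow_eq_one h6
  rw [hζ] at h7
  omega

lemma seq_main {F : Type} [Field F] [Fintype F] [DecidableEq F] (p c : ℕ)
    [CharP F p] (hc : Fintype.card F = 8 * c + 3) (hch : ¬ p ∣ (4 * c + 1).choose c) :
    ∃ (G : Type) (_ : CommGroup G) (_ : Fintype G) (_ : DecidableEq G) (a0 a1 a2 a3 : G → ℤ),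
      Fintype.card G = 2 * c + 1 ∧
      (∀ k, a0 k = 1 ∨ a0 k = -1) ∧ (∀ k, a1 k = 1 ∨ a1 k = -1) ∧
      (∀ k, a2 k = 1 ∨ a2 k = -1) ∧ (∀ k, a3 k = 1 ∨ a3 k = -1) ∧
      (∀ u, gsP a0 a0 u + gsP a1 a1 u + gsP a2 a2 u + gsP a3 a3 u =
        if u = 1 then ((8 * c + 4 : ℕ) : ℤ) else 0) ∧
      ∑ k, a0 k = 1 ∧ ∑ k, a3 k = - ∑ k, a1 k ∧ ¬ (p : ℤ) ∣ ∑ k, a1 k := by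
  classical
  have hfact := QK_fact c hc
  have cardK : Nat.card (QK F)ˣ = 8 * (2 * c + 1) * (4 * c + 1) := by
    rw [Nat.card_eq_fintype_card, Fintype.card_units, QK_card, hc]
    have : (8 * c + 3) ^ 2 = 8 * (2 * c + 1) * (4 * c + 1) + 1 := by ring
    omega
  obtain ⟨w, hw⟩ := IsCyclic.exists_ofOrder_eq_natCard (α := (QK F)ˣ)
  rw [cardK] at hw
  obtain ⟨ζ, hζ⟩ : ∃ ζ : (QK F)ˣ, orderOf ζ = 8 := ⟨w ^ ((2 * c + 1) * (4 * c + 1)), by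
    rw [orderOf_pow_of_dvd (by positivity) (by rw [hw, mul_assoc]; exact dvd_mul_left _ _), hw, mul_assoc]
    exact Nat.mul_div_cancel _ (by positivity)⟩
  obtain ⟨g, hg⟩ : ∃ g : (QK F)ˣ, orderOf g = 2 * c + 1 := ⟨w ^ (8 * (4 * c + 1)), by
    have e : 8 * (2 * c + 1) * (4 * c + 1) = (2 * c + 1) * (8 * (4 * c + 1)) := by ring
    rw [orderOf_pow_of_dvd (by positivity) (by rw [hw, e]; exact dvd_mul_left _ _), hw, e]
    exact Nat.mul_div_cancel _ (by positivity)⟩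
  let G := Subgroup.zpowers g
  have hG : Fintype.card G = 2 * c + 1 := by rw [← hg]; exact Fintype.card_zpowers
  have hGt : ∀ h : G, (h : (QK F)ˣ) ^ (2 * c + 1) = 1 := by
    intro h
    have := pow_card_eq_one (x := h)
    rw [hG] at this
    simpa using congrArg Subtype.val this
  have hinv : ∀ h : G, (h : (QK F)ˣ) ^ (8 * c + 3) = (h : (QK F)ˣ)⁻¹ := by
    intro h
    rw [eq_inv_iff_mul_eq_one, ← pow_succ, show 8 * c + 3 + 1 = (2 * c + 1) * 4 by ring, pow_mul,
      hGt, one_pow]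
  have hζ8 : ζ ^ 8 = 1 := by rw [← hζ]; exact pow_orderOf_eq_one ζ
  have hζq : ζ ^ (8 * c + 3) = ζ ^ 3 := by rw [pow_add, pow_mul, hζ8, one_pow, one_mul]
  -- key uniqueness
  have hq1 : ∀ (r : ℕ) (h : G), (ζ ^ r * (h : (QK F)ˣ)) ^ (8 * c + 3) = ζ ^ (3 * r) * (h : (QK F)ˣ)⁻¹ := by
    intro r h
    rw [mul_pow, hinv, ← pow_mul, mul_comm r, pow_mul, hζq, ← pow_mul]
  have hsq : ∀ h : G, ∀ r : ℕ, (h : (QK F)ˣ) ^ 2 = ζ ^ r → (h : (QK F)ˣ) = 1 ∧ 8 ∣ r := by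
    intro h r hr
    have h1 : ((h : (QK F)ˣ) ^ 2) ^ 8 = 1 := by rw [hr, ← pow_mul, mul_comm, pow_mul, hζ8, one_pow]
    have h2 : orderOf (h : (QK F)ˣ) ∣ 16 := orderOf_dvd_of_pow_eq_one (by rw [← pow_mul] at h1; exact h1)
    have h3 : orderOf (h : (QK F)ˣ) ∣ 2 * c + 1 := orderOf_dvd_of_pow_eq_one (hGt h)
    have h4 : Nat.Coprime (2 * c + 1) 16 := by
      have : Nat.Coprime (2 * c + 1) 2 := by simp
      exact this.pow_right 4
    have h5 := Nat.dvd_gcd h3 h2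
    rw [h4] at h5
    have h6 : (h : (QK F)ˣ) = 1 := orderOf_eq_one_iff.1 (Nat.dvd_one.1 h5)
    refine ⟨h6, ?_⟩
    rw [h6, one_pow] at hr
    rw [← hζ]; exact orderOf_dvd_of_pow_eq_one hr.symm
  have him : ∀ x : (QK F)ˣ, (x : QK F).im = 0 → x ^ (8 * c + 3) = x := by
    intro x hx
    ext1
    rw [Units.val_pow_eq_pow_val, QK_frob c hc, hx, neg_zero]
    ext <;> simp [hx]
  have him2 : ∀ (r : ℕ) (h : G), ((ζ ^ r * (h : (QK F)ˣ) : (QK F)ˣ) : QK F).im = 0 →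
      (h : (QK F)ˣ) = 1 ∧ 8 ∣ 2 * r := by
    intro r h hh
    have h1 := him _ hh
    rw [hq1] at h1
    apply hsq
    have h2 : ζ ^ r * (ζ ^ (2 * r)) = ζ ^ r * ((h : (QK F)ˣ) ^ 2) := by
      rw [← pow_add, show r + 2 * r = 3 * r by ring, mul_inv_eq_iff_eq_mul.1 h1, sq, mul_assoc]
    exact (mul_left_cancel h2).symm
  let a : ℕ → G → ℤ := fun r h => qphi ((ζ ^ r * (h : (QK F)ˣ) : (QK F)ˣ) : QK F)
  have ha : ∀ r h, a r h = qphi ((ζ ^ r * (h : (QK F)ˣ) : (QK F)ˣ) : QK F) := fun _ _ => rfl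
  have hpm : ∀ (r : ℕ) (h : G), ¬ ((h : (QK F)ˣ) = 1 ∧ 8 ∣ 2 * r) → a r h = 1 ∨ a r h = -1 := by
    intro r h hh
    exact quadraticChar_dichotomy (fun h0 => hh (him2 r h h0))
  have hconj : ∀ r h, a (3 * r) h = - a r h⁻¹ := by
    intro r h
    rw [ha, ha, ← qphi_frob c hc, ← Units.val_pow_eq_pow_val, hq1]
    simp
  have a01 : a 0 1 = 0 := by
    have : a 0 1 = - a 0 1 := by simpa using hconj 0 1
    omega
  have hodd : ∀ h, a 0 h⁻¹ = - a 0 h := by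
    intro h
    have := hconj 0 h
    rw [mul_zero] at this
    omega
  -- autocorrelation
  let e : Fˣ × Fin 4 × G → (QK F)ˣ := fun x =>
    Units.map (algebraMap F (QK F)).toMonoidHom x.1 * (ζ ^ (x.2.1 : ℕ) * (x.2.2 : (QK F)ˣ))
  have hFq : ∀ l : Fˣ, (Units.map (algebraMap F (QK F)).toMonoidHom l) ^ (8 * c + 3) =
      Units.map (algebraMap F (QK F)).toMonoidHom l := by
    intro l
    apply him
    simp
  have einj : Function.Injective e := by
    have aux : ∀ (l l' : Fˣ) (r r' : ℕ) (h h' : G), r' ≤ r → r < 4 → 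
        Units.map (algebraMap F (QK F)).toMonoidHom l * (ζ ^ r * (h : (QK F)ˣ)) =
        Units.map (algebraMap F (QK F)).toMonoidHom l' * (ζ ^ r' * (h' : (QK F)ˣ)) →
        l = l' ∧ r = r' ∧ h = h' := by
      intro l l' r r' h h' hr hr4 hh
      obtain ⟨d, rfl⟩ := Nat.exists_eq_add_of_le hr
      have k1 : Units.map (algebraMap F (QK F)).toMonoidHom (l⁻¹ * l') =
          ζ ^ d * ((h * h'⁻¹ : G) : (QK F)ˣ) := by
        rw [map_mul, map_inv, inv_mul_eq_iff_eq_mul, ← mul_left_inj (ζ ^ r' * (h' : (QK F)ˣ)), ← hh]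
        rw [pow_add]
        simp only [Subgroup.coe_mul, Subgroup.coe_inv]
        have : ∀ L zr zd x y : (QK F)ˣ, L * (zr * zd * x) = L * (zd * (x * y⁻¹)) * (zr * y) := by
          intro L zr zd x y
          calc L * (zr * zd * x) = L * (zr * zd * x) * (y⁻¹ * y) := by simp
            _ = _ := by ac_rfl
        exact this _ _ _ _ _
      have k2 : (((ζ ^ d * ((h * h'⁻¹ : G) : (QK F)ˣ) : (QK F)ˣ)) : QK F).im = 0 := by
        rw [← k1]; simp
      obtain ⟨k3, k4⟩ := him2 _ _ k2
      have hd : d = 0 := by omega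
      subst hd
      rw [k3] at k1
      have k5 : l⁻¹ * l' = 1 := by
        have := congrArg Units.val k1
        simp only [pow_zero, mul_one, Units.val_one, Units.coe_map] at this
        ext1
        exact (algebraMap F (QK F)).injective (by rw [Units.val_one, map_one]; exact this)
      refine ⟨inv_mul_eq_one.1 k5, by omega, ?_⟩
      exact mul_inv_eq_one.1 (Subtype.ext k3)
    rintro ⟨l, r, h⟩ ⟨l', r', h'⟩ hh
    rcases le_total (r' : ℕ) r with hr | hr
    · obtain ⟨h1, h2, h3⟩ := aux l l' r r' h h' hr r.2 hh
      rw [h1, Fin.ext h2, h3]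
    · obtain ⟨h1, h2, h3⟩ := aux l' l r' r h' h hr r'.2 hh.symm
      rw [h1, Fin.ext h2, h3]
  have ebij : Function.Bijective e := by
    rw [Fintype.bijective_iff_injective_and_card]
    refine ⟨einj, ?_⟩
    rw [← Nat.card_eq_fintype_card (α := (QK F)ˣ), cardK, Fintype.card_prod, Fintype.card_prod, hG,
      Fintype.card_units, hc, Fintype.card_fin]
    have : 8 * c + 3 - 1 = 2 * (4 * c + 1) := by omega
    rw [this]; ring
  have hcor : ∀ u : G, u ≠ 1 → ∑ r : Fin 4, ∑ h : G, a r h * a r (h * u) = 0 := by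
    intro u hu
    have hz : ((u : (QK F)ˣ) : QK F).im ≠ 0 := by
      intro h0
      have := him2 0 u (by simpa using h0)
      exact hu (Subtype.ext this.1)
    have h1 := qphi_sum c hc _ hz
    rw [← Fintype.sum_subtype_add_sum_subtype (fun x : QK F => x ≠ 0)] at h1
    have h2 : ∑ x : {x : QK F // ¬ x ≠ 0}, qphi (x : QK F) * qphi ((x : QK F) * ((u : (QK F)ˣ) : QK F)) = 0 := by
      apply Finset.sum_eq_zero
      rintro ⟨x, hx⟩ -
      have : x = 0 := not_not.1 hx
      subst this
      simp [qphi]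
    rw [h2, add_zero] at h1
    rw [← Equiv.sum_comp (unitsEquivNeZero (G₀ := QK F)), ← Equiv.sum_comp (Equiv.ofBijective e ebij),
      Fintype.sum_prod_type] at h1
    have h3 : ∀ (l : Fˣ) (y : Fin 4 × G), qphi ((e (l, y) : (QK F)ˣ) : QK F) *
        qphi (((e (l, y) : (QK F)ˣ) : QK F) * ((u : (QK F)ˣ) : QK F)) = a y.1 y.2 * a y.1 (y.2 * u) := by
      intro l y
      simp only [e, ha, Units.val_mul, Units.coe_map, Subgroup.coe_mul]
      have e1 : ∀ x : QK F, ((algebraMap F (QK F)).toMonoidHom (l : F)) * x = algebraMap F (QK F) (l : F) * x :=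
        fun _ => rfl
      rw [e1, mul_assoc (algebraMap F (QK F) (l : F)), qphi_smul, qphi_smul, mul_assoc _ _ ((u : (QK F)ˣ) : QK F)]
      have := quadraticChar_sq_one l.ne_zero
      linear_combination (qphi (((ζ ^ (y.1 : ℕ) : (QK F)ˣ) : QK F) * ((y.2 : (QK F)ˣ) : QK F)) *
        qphi (((ζ ^ (y.1 : ℕ) : (QK F)ˣ) : QK F) * (((y.2 : (QK F)ˣ) : QK F) * ((u : (QK F)ˣ) : QK F)))) * this
    have h4 : ∑ l : Fˣ, ∑ y : Fin 4 × G, a y.1 y.2 * a y.1 (y.2 * u) = 0 := by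
      rw [← h1]
      exact Finset.sum_congr rfl fun l _ => Finset.sum_congr rfl fun y _ => (h3 l y).symm
    rw [Finset.sum_const, smul_eq_zero] at h4
    rcases h4 with h4 | h4
    · simp at h4
    · rwa [Fintype.sum_prod_type] at h4
  let a0 : G → ℤ := fun h => a 0 h + if h = 1 then 1 else 0
  have p0 : ∀ k, a0 k = 1 ∨ a0 k = -1 := by
    intro k
    by_cases hk : k = 1
    · left; simp [a0, hk, a01]
    · simp only [a0, hk, if_false, add_zero]
      exact hpm 0 k (fun h => hk (Subtype.ext h.1))
  have p1 : ∀ k, a 1 k = 1 ∨ a 1 k = -1 := fun k => hpm 1 k (by omega)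
  have p2 : ∀ k, a 2 k = 1 ∨ a 2 k = -1 := fun k => hpm 2 k (by omega)
  have p3 : ∀ k, a 3 k = 1 ∨ a 3 k = -1 := fun k => hpm 3 k (by omega)
  refine ⟨G, inferInstance, inferInstance, inferInstance, a0, a 1, a 2, a 3, hG, p0, p1, p2, p3,
    ?_, ?_, ?_, ?_⟩
  · intro u
    by_cases hu : u = 1
    · have one : ∀ X : G → ℤ, (∀ k, X k = 1 ∨ X k = -1) → gsP X X u = 2 * c + 1 := by
        intro X hX
        have : ∀ k, X k * X (k * u) = 1 := by
          intro k
          rw [hu, mul_one]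
          rcases hX k with h | h <;> rw [h] <;> norm_num
        unfold gsP
        simp_rw [this]
        rw [Finset.sum_const, Finset.card_univ, hG]
        simp
      rw [one _ p0, one _ p1, one _ p2, one _ p3, if_pos hu]
      push_cast; ring
    · rw [if_neg hu]
      have h1 := hcor u hu
      rw [Fin.sum_univ_four] at h1
      have h2 : gsP a0 a0 u = gsP (a 0) (a 0) u := by
        have : ∀ k : G, a0 k * a0 (k * u) = a 0 k * a 0 (k * u) + ((if k = u⁻¹ then a 0 k else 0) +
            (if k = 1 then a 0 (k * u) else 0)) := by
          intro k
          by_cases k1 : k = 1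
          · have k2 : k ≠ u⁻¹ := by rintro rfl; exact hu (inv_eq_one.1 k1)
            have k3 : k * u ≠ 1 := by rw [k1, one_mul]; exact hu
            simp only [a0, if_neg k2, if_neg k3, if_pos k1]; ring
          · by_cases k2 : k = u⁻¹
            · have k3 : k * u = 1 := by rw [k2]; simp
              simp only [a0, if_neg k1, if_pos k2, if_pos k3]; ring
            · have k3 : k * u ≠ 1 := fun h => k2 (eq_inv_of_mul_eq_one_left h)
              simp only [a0, if_neg k1, if_neg k2, if_neg k3]; ring
        unfold gsP
        simp_rw [this]
        rw [Finset.sum_add_distrib, Finset.sum_add_distrib, Finset.sum_ite_eq', Finset.sum_ite_eq']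
        simp only [Finset.mem_univ, if_true, hodd, one_mul]
        ring
      rw [h2]
      exact h1
  · have : ∑ k, a 0 k = - ∑ k, a 0 k := by
      conv_lhs => rw [← Equiv.sum_comp (Equiv.inv G)]
      rw [← Finset.sum_neg_distrib]
      exact Finset.sum_congr rfl fun k _ => hodd k
    simp only [a0]
    rw [Finset.sum_add_distrib, Finset.sum_ite_eq', if_pos (Finset.mem_univ _)]
    omega
  · rw [← Equiv.sum_comp (Equiv.inv G) (a 1), ← Finset.sum_neg_distrib]
    exact Finset.sum_congr rfl fun k _ => hconj 1 k
  · have := seq_core p c hc hch G g (Subgroup.mem_zpowers g) (fun h => h.2) hg hG ζ hζ hinv hζq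
    simpa [a] using this

theorem stmt_0 (m : ℕ) (hm : 0 < m) (hq : IsPrimePow (4 * m ^ 2 + 4 * m + 3)) :
    ∃ H : Matrix (Fin (4 * (m ^ 2 + m + 1))) (Fin (4 * (m ^ 2 + m + 1))) ℤ,
      (∀ i j, H i j = 1 ∨ H i j = -1) ∧
      H * H.transpose = ((4 * (m ^ 2 + m + 1) : ℕ) : ℤ) • (1 : Matrix _ _ ℤ) ∧
      (∀ i, (∑ j, H i j) = 2 * (m : ℤ) - 2 ∨ (∑ j, H i j) = 2 * (m : ℤ) + 2) ∧
      (∑ i, ∑ j, H i j) = ((4 * (m ^ 2 + m + 1) : ℕ) : ℤ) * (2 * (m : ℤ) + 1) := by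
  classical
  obtain ⟨p, k, hp, hk, hpk⟩ := (isPrimePow_nat_iff _).1 hq
  obtain ⟨c, hc⟩ : ∃ c, m ^ 2 + m = 2 * c := by
    obtain ⟨c, hc⟩ := Nat.even_mul_succ_self m
    exact ⟨c, by rw [← two_mul] at hc; rw [← hc]; ring⟩
  have hqc : p ^ k = 8 * c + 3 := by rw [hpk]; omega
  have : Fact p.Prime := ⟨hp⟩
  have : Fintype (GaloisField p k) := Fintype.ofFinite _
  have hcard : Fintype.card (GaloisField p k) = 8 * c + 3 := by
    rw [← Nat.card_eq_fintype_card, GaloisField.card p k hk.ne', hqc]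
  obtain ⟨G, _, _, _, a0, a1, a2, a3, hG, p0, p1, p2, p3, hP, s0, s3, hnd⟩ :=
    seq_main (F := GaloisField p k) p c hcard (lucas_fin p k c hp hqc)
  have hp2 : p ≠ 2 := by
    rintro rfl
    obtain ⟨k, rfl⟩ := Nat.exists_eq_succ_of_ne_zero hk.ne'
    rw [pow_succ] at hqc
    omega
  have hsum : (1 : ℤ) + (∑ k, a1 k) ^ 2 + (∑ k, a2 k) ^ 2 + (∑ k, a1 k) ^ 2 = 8 * c + 4 := by
    have h1 : ∑ u, (gsP a0 a0 u + gsP a1 a1 u + gsP a2 a2 u + gsP a3 a3 u) =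
        ((8 * c + 4 : ℕ) : ℤ) := by
      simp_rw [hP]
      simp
    rw [Finset.sum_add_distrib, Finset.sum_add_distrib, Finset.sum_add_distrib, gsP_sum, gsP_sum,
      gsP_sum, gsP_sum, s0, s3, neg_sq] at h1
    push_cast at h1
    linarith
  have hcZ : (m : ℤ) ^ 2 + m = 2 * c := by exact_mod_cast hc
  obtain ⟨hb, hcs⟩ := uniq_rep p k (8 * c + 3) (2 * m + 1) (∑ k, a1 k) (∑ k, a2 k) hp hp2
    (by exact_mod_cast hqc.symm) hk (by linear_combination (-4) * hcZ) (by linarith) hnd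
  obtain ⟨e2, he2, hs2⟩ : ∃ e : ℤ, e ^ 2 = 1 ∧ e * ∑ k, a2 k = 2 * m + 1 := by
    rcases sq_eq_sq_iff_eq_or_eq_neg.1 hcs with h | h
    · exact ⟨1, by norm_num, by rw [h]; ring⟩
    · exact ⟨-1, by norm_num, by rw [h]; ring⟩
  have hpm : ∀ (e : ℤ) (X : G → ℤ), e ^ 2 = 1 → (∀ k, X k = 1 ∨ X k = -1) →
      ∀ k, e * X k = 1 ∨ e * X k = -1 := by
    intro e X he hX k
    rcases sq_eq_one_iff.1 he with rfl | rfl <;> have := hX k <;> omega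
  have hb' : (-∑ k, a1 k) ^ 2 = 1 := by rw [neg_sq]; exact hb
  have hn : 8 * c + 4 = 4 * (m ^ 2 + m + 1) := by omega
  obtain ⟨H, h1, h2, h3, h4⟩ := gs_main (2 * c + 1) (4 * (m ^ 2 + m + 1)) hG (by omega) (2 * m + 1)
    (fun k => e2 * a2 k) (fun k => (-1) * a0 k) (fun k => (-∑ k, a1 k) * a1 k)
    (fun k => (∑ k, a1 k) * a3 k) (hpm _ _ he2 p2) (hpm _ _ (by norm_num) p0) (hpm _ _ hb' p1)
    (hpm _ _ hb p3)
    (by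
      intro u
      rw [gsP_neg _ _ he2, gsP_neg _ _ (by norm_num), gsP_neg _ _ hb', gsP_neg _ _ hb, ← hn, ← hP u]
      ring)
    (by rw [← Finset.mul_sum, hs2]) (by rw [← Finset.mul_sum, s0]; norm_num)
    (by rw [← Finset.mul_sum]; linear_combination -hb)
    (by rw [← Finset.mul_sum, s3]; linear_combination -hb)
  refine ⟨H, h1, h2, fun i => ?_, h4⟩
  rcases h3 i with h | h
  · left; rw [h]; ring
  · right; rw [h]; ring
end

section
/- Let m be a positive integer such that q = 2m² + 2m + 1 is a prime power, and set n = 4(m² + m + 1). Then there exists an Hadamard matrix H of order n such that every row sum of H lies in {2m − 2, 2m + 2} if m is odd, and every row sum of H lies in {2m, 2m + 4} if m is even; in either case the excess of H equals n(2m + 1). -/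
theorem aux_choose {p : ℕ} (hp : p.Prime) (hp4 : p % 4 = 1) :
    ∀ (k N : ℕ), 4 * N + 1 = p ^ k → ¬ p ∣ Nat.choose (3 * N) (2 * N) := by
  intro k
  induction k with
  | zero =>
    intro N hN
    have : N = 0 := by simp at hN; exact hN
    subst this
    simpa using hp.one_lt.ne'
  | succ k ih =>
    intro N hN
    have : Fact p.Prime := ⟨hp⟩
    obtain ⟨r, hr⟩ : ∃ r, p = 4 * r + 1 := ⟨p / 4, by omega⟩
    have hk : p ^ k % 4 = 1 := by rw [Nat.pow_mod, hp4]; simp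
    obtain ⟨M, hM⟩ : ∃ M, p ^ k = 4 * M + 1 := ⟨p ^ k / 4, by omega⟩
    have hNM : N = p * M + r := by
      rw [pow_succ, hM] at hN
      have : 4 * N + 1 = 4 * (p * M + r) + 1 := by
        rw [hN]; nlinarith
      omega
    have h1 : 3 * N = 3 * r + p * (3 * M) := by rw [hNM]; ring
    have h2 : 2 * N = 2 * r + p * (2 * M) := by rw [hNM]; ring
    have key := Choose.choose_modEq_choose_mod_mul_choose_div_nat (p := p) (n := 3 * N) (k := 2 * N)
    have d1 : (3 * N) % p = 3 * r := by
      rw [h1, Nat.add_mul_mod_self_left]; exact Nat.mod_eq_of_lt (by omega)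
    have d2 : (2 * N) % p = 2 * r := by
      rw [h2, Nat.add_mul_mod_self_left]; exact Nat.mod_eq_of_lt (by omega)
    have d3 : (3 * N) / p = 3 * M := by
      rw [h1, Nat.add_mul_div_left _ _ hp.pos, Nat.div_eq_of_lt (by omega)]; simp
    have d4 : (2 * N) / p = 2 * M := by
      rw [h2, Nat.add_mul_div_left _ _ hp.pos, Nat.div_eq_of_lt (by omega)]; simp
    rw [d1, d2, d3, d4] at key
    rw [key.dvd_iff dvd_rfl, hp.dvd_mul]
    rintro (h | h)
    · have := (Nat.choose_pos (show 2 * r ≤ 3 * r by omega))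
      have h3 : p ∣ (3 * r).factorial := by
        rw [← Nat.choose_mul_factorial_mul_factorial (show 2 * r ≤ 3 * r by omega)]
        exact (h.mul_right _).mul_right _
      rw [hp.dvd_factorial] at h3
      omega
    · exact ih M hM.symm h

theorem aux_sum {F : Type*} [Field F] [Fintype F] {p k N : ℕ} (hp : p.Prime) (hp4 : p % 4 = 1)
    [CharP F p] (hc : Fintype.card F = 4 * N + 1) (hk : 4 * N + 1 = p ^ k) (hN : 0 < N)
    (d : F) (hd : d ≠ 0) : ∑ t : F, (t ^ 2 - d) ^ (3 * N) ≠ 0 := by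
  classical
  have hps : ∀ i, 0 < i → ∑ x : F, x ^ i = if 4 * N ∣ i then -1 else 0 := by
    intro i hi
    have := FiniteField.sum_pow_units F i
    rw [hc] at this
    simp only [Nat.add_sub_cancel] at this
    rw [← this]
    let φ : Fˣ ↪ F := ⟨fun x ↦ x, Units.val_injective⟩
    have hφ : Finset.univ.map φ = Finset.univ \ {0} := by
      ext x
      simpa only [Finset.mem_map, Finset.mem_univ, Function.Embedding.coeFn_mk, true_and,
        Finset.mem_sdiff, Finset.mem_singleton, φ] using! isUnit_iff_ne_zero
    calc
      ∑ x : F, x ^ i = ∑ x ∈ Finset.univ \ {(0 : F)}, x ^ i := by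
        rw [← Finset.sum_sdiff ({0} : Finset F).subset_univ, Finset.sum_singleton,
          zero_pow hi.ne', add_zero]
      _ = ∑ x : Fˣ, (x ^ i : F) := by simp [φ, ← hφ, Finset.univ.sum_map φ]
  have h1 : ∑ t : F, (t ^ 2 - d) ^ (3 * N) =
      ∑ j ∈ Finset.range (3 * N + 1), (-d) ^ (3 * N - j) * (Nat.choose (3 * N) j : F) * ∑ t : F, t ^ (2 * j) := by
    simp_rw [sub_eq_add_neg, add_pow, Finset.mul_sum]
    rw [Finset.sum_comm]
    refine Finset.sum_congr rfl fun j _ => Finset.sum_congr rfl fun t _ => ?_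
    rw [pow_mul]; ring
  rw [h1, Finset.sum_eq_single (2 * N)]
  · rw [hps _ (by omega), if_pos ⟨1, by ring⟩]
    refine mul_ne_zero (mul_ne_zero (pow_ne_zero _ (neg_ne_zero.2 hd)) ?_) (by simp)
    rw [Ne, CharP.cast_eq_zero_iff F p]
    exact aux_choose hp hp4 k N hk
  · intro j hj hj2
    rcases Nat.eq_zero_or_pos j with rfl | hj0
    · simp
    · rw [hps _ (by omega), if_neg]
      · simp
      · rintro ⟨c, hcc⟩
        have hj3 := Finset.mem_range.1 hj
        have : c < 2 := by
          by_contra h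
          have : 4 * N * 2 ≤ 4 * N * c := Nat.mul_le_mul_left _ (by omega)
          omega
        interval_cases c <;> omega
  · intro h; exact absurd (Finset.mem_range.2 (by omega)) h

theorem aux_rep {m : ℕ} (hm : 0 < m) {p k : ℕ} (hp : p.Prime) (hk : 2 * m ^ 2 + 2 * m + 1 = p ^ k)
    (a b : ℤ) (hab : a ^ 2 + b ^ 2 = 2 * (m:ℤ) ^ 2 + 2 * m + 1) (hnd : ¬ ((p:ℤ) ∣ a ∧ (p:ℤ) ∣ b)) :
    (a ^ 2 = (m:ℤ) ^ 2 ∧ b ^ 2 = ((m:ℤ) + 1) ^ 2) ∨ (a ^ 2 = ((m:ℤ) + 1) ^ 2 ∧ b ^ 2 = (m:ℤ) ^ 2) := by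
  have hpz : Prime (p : ℤ) := Nat.prime_iff_prime_int.1 hp
  obtain ⟨M, hM⟩ : ∃ M : ℤ, M = (m : ℤ) := ⟨_, rfl⟩
  rw [← hM] at hab ⊢
  have hM0 : 0 < M := by omega
  set q : ℤ := 2 * M ^ 2 + 2 * M + 1 with hq
  have hqp : q = (p:ℤ) ^ k := by rw [hq, hM]; exact_mod_cast hk
  have hq0 : 0 < q := by positivity
  have hk0 : k ≠ 0 := by rintro rfl; simp at hk; omega
  have hpq : (p:ℤ) ∣ q := hqp ▸ dvd_pow_self _ hk0
  have hpm : ¬ (p:ℤ) ∣ M := fun h => hpz.not_isUnit (isUnit_of_dvd_one (by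
    have : (1:ℤ) = q - M * (2 * M + 2) := by rw [hq]; ring
    rw [this]; exact dvd_sub hpq (h.mul_right _)))
  have hpm' : ¬ (p:ℤ) ∣ M + 1 := fun h => hpz.not_isUnit (isUnit_of_dvd_one (by
    have : (1:ℤ) = q - (M + 1) * (2 * M) := by rw [hq]; ring
    rw [this]; exact dvd_sub hpq (h.mul_right _)))
  have hp2 : ¬ (p:ℤ) ∣ 2 := fun h => hpz.not_isUnit (isUnit_of_dvd_one (by
    have : (1:ℤ) = q - 2 * (M ^ 2 + M) := by rw [hq]; ring
    rw [this]; exact dvd_sub hpq (h.mul_right _)))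
  have hprod : (a * (M + 1) - b * M) * (a * (M + 1) + b * M) = q * (a ^ 2 - M ^ 2) := by
    have : b ^ 2 = q - a ^ 2 := by rw [← hab]; ring
    have e : (a * (M + 1) - b * M) * (a * (M + 1) + b * M) = a ^ 2 * (M + 1) ^ 2 - b ^ 2 * M ^ 2 := by ring
    rw [e, this, hq]; ring
  -- final step
  have fin : ∀ b' : ℤ, a ^ 2 + b' ^ 2 = q → q ∣ a * (M + 1) - b' * M →
     (a ^ 2 = M ^ 2 ∧ b' ^ 2 = (M + 1) ^ 2) ∨ (a ^ 2 = (M + 1) ^ 2 ∧ b' ^ 2 = M ^ 2) := by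
    intro b' hb ⟨t, ht⟩
    have hs : (a * (M + 1) - b' * M) ^ 2 + (a * M + b' * (M + 1)) ^ 2 = q ^ 2 := by
      have : (a * (M + 1) - b' * M) ^ 2 + (a * M + b' * (M + 1)) ^ 2
        = (a ^ 2 + b' ^ 2) * (2 * M ^ 2 + 2 * M + 1) := by ring
      rw [this, hb, ← hq]; ring
    have ht2 : t ^ 2 ≤ 1 := by
      rw [ht] at hs
      have : q ^ 2 * t ^ 2 ≤ q ^ 2 * 1 := by nlinarith [sq_nonneg (a * M + b' * (M + 1))]
      exact le_of_mul_le_mul_left this (by positivity)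
    have ht3 : t ^ 2 = 0 ∨ t ^ 2 = 1 := by
      have := sq_nonneg t; omega
    rcases ht3 with h0 | h1
    · left
      have : t = 0 := by simpa using h0
      rw [this, mul_zero] at ht
      have h3 : a * (M + 1) = b' * M := by linarith
      have h4 : q * (a ^ 2 - M ^ 2) = 0 := by
        have : a ^ 2 * (M + 1) ^ 2 = b' ^ 2 * M ^ 2 := by rw [← mul_pow, h3]; ring
        have e : b' ^ 2 = q - a ^ 2 := by rw [← hb]; ring
        rw [e] at this
        linear_combination this + a ^ 2 * hq
      have h5 : a ^ 2 = M ^ 2 := by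
        rcases mul_eq_zero.1 h4 with h | h
        · omega
        · linarith
      refine ⟨h5, ?_⟩
      linear_combination hb - h5 + hq
    · right
      rw [ht, mul_pow, h1, mul_one] at hs
      have h3 : a * M + b' * (M + 1) = 0 := by
        have : (a * M + b' * (M + 1)) ^ 2 = 0 := by linarith
        simpa using this
      have h4 : q * (b' ^ 2 - M ^ 2) = 0 := by
        have h6 : a * M = - (b' * (M + 1)) := by linarith
        have : a ^ 2 * M ^ 2 = b' ^ 2 * (M + 1) ^ 2 := by rw [← mul_pow, h6]; ring
        have e : a ^ 2 = q - b' ^ 2 := by rw [← hb]; ring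
        rw [e] at this
        linear_combination -this + b' ^ 2 * hq
      have h5 : b' ^ 2 = M ^ 2 := by
        rcases mul_eq_zero.1 h4 with h | h
        · omega
        · linarith
      refine ⟨?_, h5⟩
      linear_combination hb - h5 + hq
  have hnot : ¬ ((p:ℤ) ∣ a * (M + 1) - b * M ∧ (p:ℤ) ∣ a * (M + 1) + b * M) := by
    rintro ⟨h1, h2⟩
    apply hnd
    constructor
    · have := dvd_add h1 h2
      have e : a * (M + 1) - b * M + (a * (M + 1) + b * M) = 2 * (a * (M + 1)) := by ring
      rw [e] at this
      rcases hpz.dvd_or_dvd this with h | h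
      · exact absurd h hp2
      · rcases hpz.dvd_or_dvd h with h | h
        · exact h
        · exact absurd h hpm'
    · have := dvd_sub h2 h1
      have e : (a * (M + 1) + b * M) - (a * (M + 1) - b * M) = 2 * (b * M) := by ring
      rw [e] at this
      rcases hpz.dvd_or_dvd this with h | h
      · exact absurd h hp2
      · rcases hpz.dvd_or_dvd h with h | h
        · exact h
        · exact absurd h hpm
  have hdv : q ∣ (a * (M + 1) - b * M) * (a * (M + 1) + b * M) := hprod ▸ dvd_mul_right _ _
  by_cases h1 : (p:ℤ) ∣ a * (M + 1) - b * M
  · have h2 : ¬ (p:ℤ) ∣ a * (M + 1) + b * M := fun h => hnot ⟨h1, h⟩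
    have hcop : IsCoprime q (a * (M + 1) + b * M) := by
      rw [hqp]; exact IsCoprime.pow_left ((Prime.coprime_iff_not_dvd hpz).2 h2)
    exact fin b hab (hcop.dvd_of_dvd_mul_right hdv)
  · have hcop : IsCoprime q (a * (M + 1) - b * M) := by
      rw [hqp]; exact IsCoprime.pow_left ((Prime.coprime_iff_not_dvd hpz).2 h1)
    have := fin (-b) (by rw [← hab]; ring) (by
      have := hcop.dvd_of_dvd_mul_left hdv
      have e : a * (M + 1) - -b * M = a * (M + 1) + b * M := by ring
      rwa [e])
    simpa using this


def giUnit : GaussianIntˣ := ⟨⟨0, 1⟩, ⟨0, -1⟩, by decide, by decide⟩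

theorem giUnit_sq : ((giUnit : GaussianIntˣ) : GaussianInt) ^ 2 = -1 := by decide

theorem aux_char {F : Type*} [Field F] [Fintype F] [DecidableEq F] {N : ℕ}
    (hc : Fintype.card F = 4 * N + 1) (hN : 0 < N) (h2 : ringChar F ≠ 2) :
    ∃ (ψ : MulChar F GaussianInt) (φ : GaussianInt →+* F),
      (∀ x, φ (ψ x) = x ^ (3 * N)) ∧
      (∀ x, x ≠ 0 → ψ x = 1 ∨ ψ x = -1 ∨ ψ x = ⟨0, 1⟩ ∨ ψ x = ⟨0, -1⟩) ∧
      (∀ x, ψ x ^ 2 = ((quadraticChar F x : ℤ) : GaussianInt)) := by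
  have hcu : Fintype.card Fˣ = 4 * N := by rw [Fintype.card_units, hc]; simp
  obtain ⟨g, hg⟩ := IsCyclic.exists_generator (α := Fˣ)
  have ho : orderOf g = 4 * N := by
    rw [orderOf_eq_card_of_forall_mem_zpowers hg, Nat.card_eq_fintype_card, hcu]
  have hi4 : giUnit ^ 4 = 1 := by
    ext1
    rw [Units.val_pow_eq_pow_val, show 4 = 2 * 2 from rfl, pow_mul, giUnit_sq]; simp
  have hroot : giUnit ∈ rootsOfUnity (Fintype.card Fˣ) GaussianInt := by
    rw [mem_rootsOfUnity, hcu, pow_mul, hi4, one_pow]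
  have hg2 : (g : F) ^ (2 * N) = -1 := by
    have h1 : ((g : F) ^ (2 * N)) ^ 2 = 1 := by
      rw [← pow_mul, show 2 * N * 2 = orderOf g by rw [ho]; ring]
      rw [← Units.val_pow_eq_pow_val, pow_orderOf_eq_one, Units.val_one]
    rcases sq_eq_one_iff.1 h1 with h | h
    · exfalso
      have h' : g ^ (2 * N) = 1 := by
        ext1; rw [Units.val_pow_eq_pow_val, h, Units.val_one]
      have := Nat.le_of_dvd (by omega) (orderOf_dvd_of_pow_eq_one h')
      omega
    · exact h
  have hg6 : (g : F) ^ (3 * N) * (g : F) ^ (3 * N) = ((-1 : ℤ) : F) := by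
    rw [← pow_add, show 3 * N + 3 * N = 2 * N * 3 by ring, pow_mul, hg2]; norm_num
  let ψ : MulChar F GaussianInt := MulChar.ofRootOfUnity hroot hg
  have hψg : ψ g = giUnit := MulChar.ofRootOfUnity_spec hroot hg
  let φ : GaussianInt →+* F := Zsqrtd.lift ⟨(g : F) ^ (3 * N), hg6⟩
  have hφi : φ (giUnit : GaussianInt) = (g : F) ^ (3 * N) := by
    simp [φ, Zsqrtd.lift, giUnit]
  have hpow : ∀ x : F, x ≠ 0 → ∃ j : ℕ, x = (g : F) ^ j := by
    intro x hx
    obtain ⟨j, hj⟩ := (mem_powers_iff_mem_zpowers (x := g) (y := Units.mk0 x hx)).2 (hg _)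
    exact ⟨j, by simpa using (congrArg Units.val hj).symm⟩
  have hA : ∀ x, φ (ψ x) = x ^ (3 * N) := by
    intro x
    by_cases hx : x = 0
    · subst hx
      rw [MulChar.map_zero, map_zero, zero_pow (by omega)]
    · obtain ⟨j, rfl⟩ := hpow x hx
      rw [map_pow, map_pow, hψg, hφi, ← pow_mul, ← pow_mul, mul_comm]
  have hB : ∀ x, x ≠ 0 → ψ x = 1 ∨ ψ x = -1 ∨ ψ x = ⟨0, 1⟩ ∨ ψ x = ⟨0, -1⟩ := by
    intro x hx
    obtain ⟨j, rfl⟩ := hpow x hx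
    rw [map_pow, hψg]
    induction j with
    | zero => simp
    | succ j ih =>
      rw [pow_succ]
      rcases ih (by simp) with h | h | h | h <;> rw [h] <;> simp only [giUnit] <;> decide
  refine ⟨ψ, φ, hA, hB, ?_⟩
  intro x
  by_cases hx : x = 0
  · subst hx; simp [MulChar.map_zero]
  have hq := quadraticChar_eq_pow_of_char_ne_two' h2 x
  have hhalf : Fintype.card F / 2 = 2 * N := by omega
  have h4 : x ^ (4 * N) = 1 := by
    have := FiniteField.pow_card_sub_one_eq_one x hx
    rwa [hc, Nat.add_sub_cancel] at this
  have hφ2 : φ (ψ x ^ 2) = x ^ (2 * N) := by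
    rw [map_pow, hA, ← pow_mul, show 3 * N * 2 = 4 * N + 2 * N by ring, pow_add, h4, one_mul]
  rw [hhalf] at hq
  have h11 : (-1 : F) ≠ 1 := Ring.neg_one_ne_one_of_char_ne_two h2
  have hz : ψ x ^ 2 = 1 ∨ ψ x ^ 2 = -1 := by
    rcases hB x hx with h | h | h | h <;> rw [h] <;> decide
  rcases hz with h | h <;> rcases quadraticChar_dichotomy hx with h' | h' <;>
    rw [h, ← hq, h'] at hφ2 <;> rw [h, h'] <;> simp at hφ2 ⊢
  · exact absurd hφ2.symm h11
  · exact absurd hφ2 h11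


def confMat (F : Type*) [Field F] [Fintype F] [DecidableEq F] : Matrix (Option F) (Option F) ℤ
  | none, none => 0
  | none, some _ => 1
  | some _, none => 1
  | some t, some s => quadraticChar F (t - s)

section
variable {F : Type*} [Field F] [Fintype F] [DecidableEq F]

theorem confMat_symm (hneg : quadraticChar F (-1) = 1) (i j : Option F) :
    confMat F i j = confMat F j i := by
  rcases i with _ | t <;> rcases j with _ | s <;> simp only [confMat]
  rw [show s - t = (-1) * (t - s) by ring, map_mul, hneg, one_mul]

theorem confMat_diag (i : Option F) : confMat F i i = 0 := by
  rcases i with _ | t <;> simp [confMat]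

theorem confMat_off (i j : Option F) (h : i ≠ j) : confMat F i j = 1 ∨ confMat F i j = -1 := by
  rcases i with _ | t <;> rcases j with _ | s
  · simp at h
  · simp [confMat]
  · simp [confMat]
  · simp only [confMat]
    exact quadraticChar_dichotomy (sub_ne_zero.2 (by simpa using h))

theorem qc_conv (h2 : ringChar F ≠ 2) (hneg : quadraticChar F (-1) = 1) (t r : F) (h : t ≠ r) :
    ∑ s, quadraticChar F (t - s) * quadraticChar F (s - r) = -1 := by
  have hJ := jacobiSum_nontrivial_inv (quadraticChar_ne_one h2)
  rw [(quadraticChar_isQuadratic F).inv, hneg, jacobiSum] at hJ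
  rw [← hJ]
  have htr : t - r ≠ 0 := sub_ne_zero.2 h
  symm
  refine Fintype.sum_equiv ((Equiv.mulLeft₀ (t - r) htr).trans (Equiv.addRight r)) _ _ fun u => ?_
  change _ = quadraticChar F (t - ((t - r) * u + r)) * quadraticChar F ((t - r) * u + r - r)
  rw [show t - ((t - r) * u + r) = (t - r) * (1 - u) by ring, add_sub_cancel_right, map_mul, map_mul]
  have := quadraticChar_sq_one htr
  linear_combination (- quadraticChar F u * quadraticChar F (1 - u)) * this

theorem confMat_sq (h2 : ringChar F ≠ 2) (hneg : quadraticChar F (-1) = 1) :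
    confMat F * confMat F = (Fintype.card F : ℤ) • (1 : Matrix _ _ ℤ) := by
  have hsum : ∀ r : F, ∑ s, quadraticChar F (s - r) = 0 := by
    intro r
    rw [← quadraticChar_sum_zero h2]
    exact Fintype.sum_equiv (Equiv.subRight r) _ _ fun u => by simp
  have hsum' : ∀ r : F, ∑ s, quadraticChar F (r - s) = 0 := by
    intro r
    rw [← quadraticChar_sum_zero h2]
    exact Fintype.sum_equiv (Equiv.subLeft r) _ _ fun u => by simp
  ext i j
  rw [Matrix.mul_apply, Fintype.sum_option, Matrix.smul_apply, Matrix.one_apply]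
  rcases i with _ | t <;> rcases j with _ | s <;> simp only [confMat]
  · simp
  · simpa using hsum s
  · simpa using hsum' t
  · by_cases h : t = s
    · subst h
      have : ∀ x, quadraticChar F (t - x) * quadraticChar F (x - t) = if x = t then 0 else 1 := by
        intro x
        split_ifs with hx
        · subst hx; simp
        · rw [show x - t = (-1) * (t - x) by ring, map_mul, hneg, one_mul, ← sq]
          exact quadraticChar_sq_one (sub_ne_zero.2 (Ne.symm hx))
      simp only [this]
      have h3 : ∑ x : F, (if x = t then (0:ℤ) else 1) = ∑ x : F, ((1:ℤ) - if x = t then 1 else 0) :=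
        Finset.sum_congr rfl fun x _ => by split_ifs <;> simp
      rw [h3, Finset.sum_sub_distrib]; simp
    · rw [qc_conv h2 hneg t s h]; simp [h]

/-- The extended quartic vector. -/
def vecQ (ψ : MulChar F GaussianInt) (d : F) : Option F → GaussianInt
  | none => 1
  | some t => ψ (t ^ 2 - d)

theorem confMat_vecQ (ψ : MulChar F GaussianInt) (hneg : quadraticChar F (-1) = 1)
    (h4 : ∀ x, x ≠ 0 → ψ x = 1 ∨ ψ x = -1 ∨ ψ x = ⟨0, 1⟩ ∨ ψ x = ⟨0, -1⟩)
    (hsq : ∀ x, ψ x ^ 2 = ((quadraticChar F x : ℤ) : GaussianInt))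
    (d : F) (hd : ¬ IsSquare d) (i : Option F) :
    ∑ j, (confMat F i j : GaussianInt) * vecQ ψ d j =
      (∑ t : F, ψ (t ^ 2 - d)) * star (vecQ ψ d i) := by
  have hne : ∀ t : F, t ^ 2 - d ≠ 0 := fun t h => hd ⟨t, by linear_combination -h⟩
  rw [Fintype.sum_option]
  rcases i with _ | t
  · simp [confMat, vecQ]
  · simp only [confMat, vecQ]
    set n := t ^ 2 - d with hn
    have hn0 : n ≠ 0 := hne t
    have hstar : ∀ x, x ≠ 0 → star (ψ x) * ψ x = 1 := by
      intro x hx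
      rcases h4 x hx with h | h | h | h <;> rw [h] <;> decide
    have h1 : ∑ t : F, ψ (t ^ 2 - d) = ψ n * ∑ u : F, ψ (n * u ^ 2 + 2 * t * u + 1) := by
      rw [Finset.mul_sum]
      symm
      refine Fintype.sum_equiv ((Equiv.mulLeft₀ n hn0).trans (Equiv.addRight t)) _ _ fun u => ?_
      change _ = ψ ((n * u + t) ^ 2 - d)
      rw [← map_mul]
      congr 1
      rw [hn]; ring
    rw [h1]
    have h2 : ψ n * (∑ u : F, ψ (n * u ^ 2 + 2 * t * u + 1)) * star (ψ n) =
        ∑ u : F, ψ (n * u ^ 2 + 2 * t * u + 1) := by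
      linear_combination (∑ u : F, ψ (n * u ^ 2 + 2 * t * u + 1)) * hstar n hn0
    rw [h2]
    let e : F ≃ F := (Equiv.subRight t).trans (Equiv.inv F)
    have h3 : ∑ u : F, ψ (n * u ^ 2 + 2 * t * u + 1) =
      ∑ s : F, (((quadraticChar F (t - s) : ℤ) : GaussianInt) * ψ (s ^ 2 - d) + if s = t then 1 else 0) := by
      symm
      refine Fintype.sum_equiv e _ _ fun s => ?_
      have he : e s = (s - t)⁻¹ := rfl
      rw [he]
      by_cases hs : s = t
      · subst hs; simp
      · have hst : s - t ≠ 0 := sub_ne_zero.2 hs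
        rw [if_neg hs, add_zero]
        have e1 : n * (s - t)⁻¹ ^ 2 + 2 * t * (s - t)⁻¹ + 1 = (s - t)⁻¹ ^ 2 * (s ^ 2 - d) := by
          rw [hn]; field_simp; ring
        rw [e1, map_mul, map_pow, hsq, show t - s = (-1) * (s - t) by ring, map_mul, hneg, one_mul]
        congr 2
        have q1 : quadraticChar F (s - t) * quadraticChar F (s - t)⁻¹ = 1 := by
          rw [← map_mul, mul_inv_cancel₀ hst, map_one]
        rcases quadraticChar_dichotomy hst with h | h <;> rw [h] at q1 ⊢ <;> linarith
    rw [h3, Finset.sum_add_distrib]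
    simp [add_comm]
end

open Matrix in
theorem aux_G {ι : Type*} [Fintype ι] [DecidableEq ι] (n : ℕ) (hn : Fintype.card ι = n)
    (K : Matrix ι ι ℤ) (hs : Kᵀ = K) (hK : K * K = (n : ℤ) • (1 : Matrix ι ι ℤ))
    (h1 : ∀ i j, K i j = 1 ∨ K i j = -1) (x y : ι → ℤ) (hx : ∀ i, x i = 1 ∨ x i = -1)
    (A : ℤ) (hy : K *ᵥ x = y)
    (hA : ∀ i, y i = A ∨ y i = -A ∨ y i = A + 4 ∨ y i = -(A + 4)) :
    ∃ H : Matrix (Fin n) (Fin n) ℤ,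
      (∀ i j, H i j = 1 ∨ H i j = -1) ∧
      H * Hᵀ = (n : ℤ) • (1 : Matrix _ _ ℤ) ∧
      (∀ i, (∑ j, H i j) = A ∨ (∑ j, H i j) = A + 4) ∧
      (2 * A + 4) * (∑ i, ∑ j, H i j) = n * (n + A ^ 2 + 4 * A) := by
  have hr : ∀ i, ∃ r : ℤ, (r = 1 ∨ r = -1) ∧ (r * y i = A ∨ r * y i = A + 4) := by
    intro i
    rcases hA i with h | h | h | h
    · exact ⟨1, by simp, by simp [h]⟩
    · exact ⟨-1, by simp, by simp [h]⟩
    · exact ⟨1, by simp, by simp [h]⟩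
    · exact ⟨-1, by simp, by right; rw [h]; ring⟩
  choose r hr1 hr2 using hr
  let e : Fin n ≃ ι := (Fintype.equivFinOfCardEq hn).symm
  have hrsq : ∀ i, r i * r i = 1 := fun i => by rcases hr1 i with h | h <;> rw [h] <;> norm_num
  have hxsq : ∀ i, x i * x i = 1 := fun i => by rcases hx i with h | h <;> rw [h] <;> norm_num
  have hsum : ∀ i : Fin n, ∑ j : Fin n, r (e i) * K (e i) (e j) * x (e j) = r (e i) * y (e i) := by
    intro i
    rw [e.sum_comp (fun j => r (e i) * K (e i) j * x j), ← hy, mulVec, dotProduct, Finset.mul_sum]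
    exact Finset.sum_congr rfl fun j _ => by ring
  refine ⟨Matrix.of fun i j => r (e i) * K (e i) (e j) * x (e j), ?_, ?_, ?_, ?_⟩
  · intro i j
    simp only [of_apply]
    rcases hr1 (e i) with h | h <;> rcases h1 (e i) (e j) with h' | h' <;>
      rcases hx (e j) with h'' | h'' <;> rw [h, h', h''] <;> norm_num
  · ext i j
    simp only [mul_apply, transpose_apply, of_apply]
    have h3 := congrFun (congrFun hK (e i)) (e j)
    rw [mul_apply] at h3
    rw [e.sum_comp (fun k => r (e i) * K (e i) k * x k * (r (e j) * K (e j) k * x k))]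
    have h4 : ∀ k, r (e i) * K (e i) k * x k * (r (e j) * K (e j) k * x k) =
        (r (e i) * r (e j)) * (K (e i) k * K k (e j)) := by
      intro k
      have : K k (e j) = K (e j) k := by exact congrFun (congrFun hs (e j)) k
      rw [this]
      linear_combination (r (e i) * K (e i) k * r (e j) * K (e j) k) * hxsq k
    simp only [h4]
    rw [← Finset.mul_sum, h3]
    simp only [Matrix.smul_apply, one_apply, e.injective.eq_iff]
    by_cases hij : i = j
    · subst hij; simp [hrsq]
    · simp [hij]
  · intro i
    simp only [of_apply]
    rw [hsum]; exact hr2 _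
  · simp only [of_apply, hsum]
    rw [e.sum_comp (fun i => r i * y i)]
    have hyy : ∑ i, y i * y i = (n:ℤ) * n := by
      have : y ⬝ᵥ y = (n:ℤ) * (x ⬝ᵥ x) := by
        conv_lhs => rw [← hy]
        rw [dotProduct_mulVec, vecMul_mulVec, hs, hK]
        simp [smul_dotProduct, mul_comm]
      have hxx : x ⬝ᵥ x = n := by simp [dotProduct, hxsq, hn]
      rw [hxx] at this
      exact this
    have hz : ∑ i, (r i * y i - A) * (r i * y i - (A + 4)) = 0 :=
      Finset.sum_eq_zero fun i _ => by rcases hr2 i with h | h <;> rw [h] <;> ring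
    have h5 : ∀ i, (r i * y i - A) * (r i * y i - (A + 4)) =
       y i * y i - (2 * A + 4) * (r i * y i) + A * (A + 4) := fun i => by
      linear_combination (y i * y i) * hrsq i
    simp only [h5] at hz
    rw [Finset.sum_add_distrib, Finset.sum_sub_distrib, hyy, ← Finset.mul_sum] at hz
    simp only [Finset.sum_const, Finset.card_univ, hn, nsmul_eq_mul] at hz
    linear_combination -hz

open Matrix in
theorem aux_L {ι : Type*} [Fintype ι] [DecidableEq ι] (m : ℕ) (hm : 0 < m)
    (hc : Fintype.card ι = 2 * m ^ 2 + 2 * m + 2)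
    (C : Matrix ι ι ℤ) (hs : ∀ i j, C i j = C j i)
    (hC : C * C = (2 * (m:ℤ) ^ 2 + 2 * m + 1) • (1 : Matrix ι ι ℤ))
    (hd : ∀ i, C i i = 0) (ho : ∀ i j, i ≠ j → C i j = 1 ∨ C i j = -1)
    (e f : ι → ℤ)
    (hef : ∀ i, ((e i = 1 ∨ e i = -1) ∧ f i = 0) ∨ (e i = 0 ∧ (f i = 1 ∨ f i = -1)))
    (i₀ : ι) (hi₀ : e i₀ = 1) (a b : ℤ)
    (hCe : C *ᵥ e = a • e + b • f) (hCf : C *ᵥ f = b • e - a • f)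
    (hab : (a ^ 2 = (m:ℤ) ^ 2 ∧ b ^ 2 = ((m:ℤ) + 1) ^ 2) ∨
      (a ^ 2 = ((m:ℤ) + 1) ^ 2 ∧ b ^ 2 = (m:ℤ) ^ 2)) :
    ∃ H : Matrix (Fin (4 * (m ^ 2 + m + 1))) (Fin (4 * (m ^ 2 + m + 1))) ℤ,
      (∀ i j, H i j = 1 ∨ H i j = -1) ∧
      H * H.transpose = ((4 * (m ^ 2 + m + 1) : ℕ) : ℤ) • (1 : Matrix _ _ ℤ) ∧
      (Odd m → ∀ i, (∑ j, H i j) = 2 * (m : ℤ) - 2 ∨ (∑ j, H i j) = 2 * (m : ℤ) + 2) ∧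
      (Even m → ∀ i, (∑ j, H i j) = 2 * (m : ℤ) ∨ (∑ j, H i j) = 2 * (m : ℤ) + 4) ∧
      (∑ i, ∑ j, H i j) = ((4 * (m ^ 2 + m + 1) : ℕ) : ℤ) * (2 * (m : ℤ) + 1) := by
  have hCt : Cᵀ = C := by ext i j; exact hs j i
  have hf0 : f i₀ = 0 := by rcases hef i₀ with h | h; exact h.2; omega
  have hb0 : b ≠ 0 := by
    rintro rfl
    rcases hab with h | h
    · have := h.2; nlinarith
    · have := h.2; have : (0:ℤ) < (m:ℤ) ^ 2 := by positivity
      simp at h; omega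
  -- parity
  have hfe : f ⬝ᵥ e = 0 := Finset.sum_eq_zero fun i _ => by
    rcases hef i with h | h
    · rw [h.2]; ring
    · rw [h.1]; ring
  have hE12 : e ⬝ᵥ e = f ⬝ᵥ f := by
    have h1 : f ⬝ᵥ (C *ᵥ e) = e ⬝ᵥ (C *ᵥ f) := by
      rw [dotProduct_mulVec, ← mulVec_transpose, hCt, dotProduct_comm]
    rw [hCe, hCf, dotProduct_add, dotProduct_sub] at h1
    simp only [dotProduct_smul, hfe, dotProduct_comm e f, smul_eq_mul] at h1
    apply mul_left_cancel₀ hb0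
    linarith
  have hE : e ⬝ᵥ e = (m:ℤ) ^ 2 + m + 1 := by
    have : e ⬝ᵥ e + f ⬝ᵥ f = 2 * (m:ℤ) ^ 2 + 2 * m + 2 := by
      simp only [dotProduct]
      rw [← Finset.sum_add_distrib]
      have : ∀ i, e i * e i + f i * f i = 1 := by
        intro i
        rcases hef i with ⟨h | h, h'⟩ | ⟨h', h | h⟩ <;> rw [h, h'] <;> norm_num
      simp only [this]
      simp [hc]
    linarith
  have ha : a % 2 = 0 := by
    have h1 := congrFun hCe i₀
    simp only [Pi.add_apply, Pi.smul_apply, hi₀, hf0, smul_eq_mul] at h1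
    have h2 : (e ⬝ᵥ e - 1 - a) % 2 = 0 := by
      have h3 : e ⬝ᵥ e - 1 - a = ∑ j, (e j * e j - (if j = i₀ then 1 else 0) - C i₀ j * e j) := by
        rw [Finset.sum_sub_distrib, Finset.sum_sub_distrib]
        have : a = ∑ j, C i₀ j * e j := by
          rw [mulVec, dotProduct] at h1; rw [h1]; ring
        rw [← this]; simp [dotProduct]
      rw [h3]
      apply Int.emod_eq_zero_of_dvd
      apply Finset.dvd_sum
      intro j _
      by_cases hj : j = i₀
      · subst hj; simp [hi₀, hd]
      · simp only [if_neg hj]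
        rcases ho i₀ j (Ne.symm hj) with h | h <;> rw [h] <;>
          rcases hef j with ⟨h | h, h'⟩ | ⟨h, h'⟩ <;> rw [h] <;> norm_num
    rw [hE] at h2
    have h4 : ((m:ℤ) ^ 2 + m) % 2 = 0 := by
      have := Int.even_mul_succ_self (m:ℤ)
      have := Int.even_iff.1 this
      rwa [show (m:ℤ) * (m + 1) = (m:ℤ) ^ 2 + m by ring] at this
    omega
  -- the matrix
  let K : Matrix (ι ⊕ ι) (ι ⊕ ι) ℤ := fromBlocks (C + 1) (C - 1) (C - 1) (-C - 1)
  let x : ι ⊕ ι → ℤ := Sum.elim (e + f) (e - f)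
  let y : ι ⊕ ι → ℤ := Sum.elim ((2 * a) • e + (2 * (b + 1)) • f) ((2 * (b - 1)) • e - (2 * a) • f)
  have hcard : Fintype.card (ι ⊕ ι) = 4 * (m ^ 2 + m + 1) := by
    rw [Fintype.card_sum, hc]; ring
  have hKs : Kᵀ = K := by
    simp [K, fromBlocks_transpose, hCt]
  have hKK : K * K = ((4 * (m ^ 2 + m + 1) : ℕ) : ℤ) • (1 : Matrix _ _ ℤ) := by
    have e1 : (C + 1) * (C + 1) + (C - 1) * (C - 1) = (4 * ((m:ℤ) ^ 2 + m + 1)) • (1 : Matrix ι ι ℤ) := by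
      have : (C + 1) * (C + 1) + (C - 1) * (C - 1) = 2 • (C * C) + 2 • (1 : Matrix ι ι ℤ) := by noncomm_ring
      rw [this, hC]; module
    have e2 : (C + 1) * (C - 1) + (C - 1) * (-C - 1) = 0 := by noncomm_ring
    have e3 : (C - 1) * (C + 1) + (-C - 1) * (C - 1) = 0 := by noncomm_ring
    have e4 : (C - 1) * (C - 1) + (-C - 1) * (-C - 1) = (4 * ((m:ℤ) ^ 2 + m + 1)) • (1 : Matrix ι ι ℤ) := by
      rw [← e1]; noncomm_ring
    simp only [K]
    rw [fromBlocks_multiply, e1, e2, e3, e4, ← fromBlocks_one, fromBlocks_smul]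
    simp
  have hK1 : ∀ i j, K i j = 1 ∨ K i j = -1 := by
    rintro (i | i) (j | j) <;> simp only [K, fromBlocks_apply₁₁, fromBlocks_apply₁₂,
      fromBlocks_apply₂₁, fromBlocks_apply₂₂, Matrix.add_apply, Matrix.sub_apply, Matrix.neg_apply] <;>
    by_cases hij : i = j
    all_goals first
      | (subst hij; simp [hd])
      | (rcases ho i j hij with h | h <;> simp [h, one_apply, hij])
  have hx : ∀ i, x i = 1 ∨ x i = -1 := by
    rintro (i | i) <;> simp only [x, Sum.elim_inl, Sum.elim_inr, Pi.add_apply, Pi.sub_apply] <;>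
      rcases hef i with ⟨h | h, h'⟩ | ⟨h', h | h⟩ <;> rw [h, h'] <;> norm_num
  have hy : K *ᵥ x = y := by
    simp only [K, x, y]
    rw [fromBlocks_mulVec]
    congr 1
    · simp only [Sum.elim_comp_inl, Sum.elim_comp_inr, add_mulVec, sub_mulVec, mulVec_add,
        mulVec_sub, one_mulVec, hCe, hCf]
      ext i; simp; ring
    · simp only [Sum.elim_comp_inl, Sum.elim_comp_inr, sub_mulVec, mulVec_add,
        mulVec_sub, one_mulVec, neg_mulVec, hCe, hCf]
      ext i; simp; ring
  have hab' : ((a = m ∨ a = -m) ∧ (b = m + 1 ∨ b = -(m + 1))) ∨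
      ((a = m + 1 ∨ a = -(m + 1)) ∧ (b = m ∨ b = -m)) := by
    simpa only [sq_eq_sq_iff_eq_or_eq_neg] using hab
  rcases Nat.even_or_odd m with hme | hmo
  · have hme2 := Nat.even_iff.1 hme
    have hno : ¬ Odd m := Nat.not_odd_iff_even.2 hme
    obtain ⟨H, hH1, hH2, hH3, hH4⟩ := aux_G _ hcard K hKs hKK hK1 x y hx (2 * m) hy (by
      rintro (i | i) <;> simp only [y, Sum.elim_inl, Sum.elim_inr, Pi.add_apply, Pi.sub_apply,
        Pi.smul_apply, smul_eq_mul] <;>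
        rcases hef i with ⟨h | h, h'⟩ | ⟨h', h | h⟩ <;> rw [h, h'] <;> omega)
    refine ⟨H, hH1, hH2, fun h => absurd h hno, fun _ => hH3, ?_⟩
    have : (4 * (m:ℤ) + 4) ≠ 0 := by positivity
    apply mul_left_cancel₀ this
    push_cast at hH4 ⊢
    linear_combination hH4
  · have hmo2 := Nat.odd_iff.1 hmo
    have hno : ¬ Even m := Nat.not_even_iff_odd.2 hmo
    obtain ⟨H, hH1, hH2, hH3, hH4⟩ := aux_G _ hcard K hKs hKK hK1 x y hx (2 * m - 2) hy (by
      rintro (i | i) <;> simp only [y, Sum.elim_inl, Sum.elim_inr, Pi.add_apply, Pi.sub_apply,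
        Pi.smul_apply, smul_eq_mul] <;>
        rcases hef i with ⟨h | h, h'⟩ | ⟨h', h | h⟩ <;> rw [h, h'] <;> omega)
    refine ⟨H, hH1, hH2, fun _ i => ?_, fun h => absurd h hno, ?_⟩
    · rcases hH3 i with h | h
      · left; exact h
      · right; rw [h]; ring
    have : (4 * (m:ℤ)) ≠ 0 := by positivity
    apply mul_left_cancel₀ this
    push_cast at hH4 ⊢
    linear_combination hH4


theorem re_sum' {ι : Type*} (s : Finset ι) (g : ι → GaussianInt) :
    (∑ i ∈ s, g i).re = ∑ i ∈ s, (g i).re :=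
  map_sum (AddMonoidHom.mk' (fun z : GaussianInt => z.re) fun _ _ => rfl) g s

theorem im_sum' {ι : Type*} (s : Finset ι) (g : ι → GaussianInt) :
    (∑ i ∈ s, g i).im = ∑ i ∈ s, (g i).im :=
  map_sum (AddMonoidHom.mk' (fun z : GaussianInt => z.im) fun _ _ => rfl) g s



/-- If `q = 2m² + 2m + 1` is a prime power and `n = 4(m² + m + 1)`, then
there exists a Hadamard matrix of order `n` whose row sums lie in `{2m−2, 2m+2}` if `m`
is odd and in `{2m, 2m+4}` if `m` is even; its excess equals `n(2m+1)`. -/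
theorem stmt_1 (m : ℕ) (hm : 0 < m) (hq : IsPrimePow (2 * m ^ 2 + 2 * m + 1)) :
    ∃ H : Matrix (Fin (4 * (m ^ 2 + m + 1))) (Fin (4 * (m ^ 2 + m + 1))) ℤ,
      (∀ i j, H i j = 1 ∨ H i j = -1) ∧
      H * H.transpose = ((4 * (m ^ 2 + m + 1) : ℕ) : ℤ) • (1 : Matrix _ _ ℤ) ∧
      (Odd m → ∀ i, (∑ j, H i j) = 2 * (m : ℤ) - 2 ∨ (∑ j, H i j) = 2 * (m : ℤ) + 2) ∧
      (Even m → ∀ i, (∑ j, H i j) = 2 * (m : ℤ) ∨ (∑ j, H i j) = 2 * (m : ℤ) + 4) ∧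
      (∑ i, ∑ j, H i j) = ((4 * (m ^ 2 + m + 1) : ℕ) : ℤ) * (2 * (m : ℤ) + 1) := by
  
  classical
  obtain ⟨p, k, hp', hk, hpk⟩ := hq
  have hp : p.Prime := Nat.prime_iff.2 hp'
  have : Fact p.Prime := ⟨hp⟩
  obtain ⟨N, hN⟩ : ∃ N, m ^ 2 + m = 2 * N := by
    have := Nat.even_mul_succ_self m
    obtain ⟨r, hr⟩ := this
    exact ⟨r, by rw [← two_mul] at hr; rw [← hr]; ring⟩
  have hN0 : 0 < N := by have : 0 < m ^ 2 := by positivity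
                         omega
  have hqN : 4 * N + 1 = p ^ k := by rw [hpk]; omega
  have hp4 : p % 4 = 1 := by
    have h1 : IsSquare (-1 : ZMod (p ^ k)) := by
      have := ZMod.isSquare_neg_one_of_eq_sq_add_sq_of_isCoprime
        (n := ((p ^ k : ℕ) : ℤ)) (x := (m : ℤ)) (y := (m : ℤ) + 1) (by rw [hpk]; push_cast; ring)
        ⟨-1, 1, by ring⟩
      simpa only [Int.natAbs_natCast] using this
    have h2 := ZMod.isSquare_neg_one_of_dvd (dvd_pow_self p hk.ne') h1
    have h3 := ZMod.exists_sq_eq_neg_one_iff.1 h2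
    have h4 : p % 2 = 1 := by
      rcases hp.eq_two_or_odd with h | h
      · exfalso
        have : 2 ∣ p ^ k := h ▸ dvd_pow_self p hk.ne'
        omega
      · exact h
    omega
  let F := GaloisField p k
  let _ : Fintype F := Fintype.ofFinite F
  have hcard : Fintype.card F = 4 * N + 1 := by
    rw [hqN, ← Nat.card_eq_fintype_card]; exact GaloisField.card p k hk.ne'
  have h2 : ringChar F ≠ 2 := by
    rw [ringChar.eq F p]; omega
  have hneg : quadraticChar F (-1) = 1 := by
    rw [quadraticChar_one_iff_isSquare (by simp), FiniteField.isSquare_neg_one_iff, hcard]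
    omega
  obtain ⟨d, hd⟩ := FiniteField.exists_nonsquare h2
  have hd0 : d ≠ 0 := by rintro rfl; exact hd IsSquare.zero
  obtain ⟨ψ, φ, hφ, h4, hsq⟩ := aux_char hcard hN0 h2
  obtain ⟨c, hc⟩ : ∃ c, c = ∑ t : F, ψ (t ^ 2 - d) := ⟨_, rfl⟩
  have hφc : φ c ≠ 0 := by
    rw [hc, map_sum]
    simp only [hφ]
    exact aux_sum hp hp4 hcard hqN hN0 d hd0
  have hmain := confMat_vecQ ψ hneg h4 hsq d hd
  rw [← hc] at hmain
  have hCC := confMat_sq h2 hneg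
  have hcq : (Fintype.card F : ℤ) = 2 * (m : ℤ) ^ 2 + 2 * m + 1 := by
    rw [hcard, hqN, hpk]; push_cast; ring
  rw [hcq] at hCC
  let e : Option F → ℤ := fun i => (vecQ ψ d i).re
  let f : Option F → ℤ := fun i => (vecQ ψ d i).im
  have hCe : (confMat F).mulVec e = c.re • e + c.im • f := by
    ext i
    have := congrArg Zsqrtd.re (hmain i)
    rw [re_sum'] at this
    simp [Zsqrtd.re_mul] at this
    simp only [Matrix.mulVec, dotProduct, Pi.add_apply, Pi.smul_apply, smul_eq_mul, e, f]
    rw [Fintype.sum_option, this]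
  have hCf : (confMat F).mulVec f = c.im • e - c.re • f := by
    ext i
    have := congrArg Zsqrtd.im (hmain i)
    rw [im_sum'] at this
    simp [Zsqrtd.im_mul] at this
    simp only [Matrix.mulVec, dotProduct, Pi.sub_apply, Pi.smul_apply, smul_eq_mul, e, f]
    rw [Fintype.sum_option, this]; ring
  have he0 : e none = 1 := rfl
  have hf0 : f none = 0 := rfl
  have hab : c.re ^ 2 + c.im ^ 2 = 2 * (m : ℤ) ^ 2 + 2 * m + 1 := by
    have h5 : (confMat F).mulVec ((confMat F).mulVec e) = (2 * (m : ℤ) ^ 2 + 2 * m + 1) • e := by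
      rw [Matrix.mulVec_mulVec, hCC, Matrix.smul_mulVec, Matrix.one_mulVec]
    rw [hCe, Matrix.mulVec_add, Matrix.mulVec_smul, Matrix.mulVec_smul, hCe, hCf] at h5
    have := congrFun h5 none
    simp only [Pi.add_apply, Pi.sub_apply, Pi.smul_apply, smul_eq_mul, he0, hf0] at this
    linear_combination this
  have hnd : ¬ ((p : ℤ) ∣ c.re ∧ (p : ℤ) ∣ c.im) := by
    rintro ⟨⟨u, hu⟩, ⟨v, hv⟩⟩
    apply hφc
    have : c = ((p : ℕ) : GaussianInt) * ⟨u, v⟩ := by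
      ext
      · simp [hu]
      · simp [hv]
    rw [this, map_mul, map_natCast, CharP.cast_eq_zero, zero_mul]
  have hrep := aux_rep hm hp hpk.symm c.re c.im hab hnd
  refine aux_L m hm ?_ (confMat F) (confMat_symm hneg) hCC confMat_diag confMat_off e f ?_ none he0
    c.re c.im hCe hCf hrep
  · rw [Fintype.card_option, hcard, hqN, hpk]
  · rintro (_ | t)
    · left; exact ⟨Or.inl rfl, rfl⟩
    · have hne : t ^ 2 - d ≠ 0 := fun h => hd ⟨t, by linear_combination -h⟩
      simp only [e, f, vecQ]
      rcases h4 _ hne with h | h | h | h <;> rw [h] <;> decide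
end

section
/- Let m be an odd positive integer such that q = 2m² − 1 is a prime power. Let X₁, X₂, X₃, X₄ be subsets of F_{q²} partitioning F_{q²}∖{0}, let τ ∈ {1, −1}, set Yᵢ := ω^{−τm²}·{x^q : x ∈ Xᵢ} for i = 1,2,3,4, and write G := G_q(η). Assume: (1) X₁ = ω^{2m²}·X₃ and X₂ = ω^{2m²}·X₄; (2) each Xᵢ is a union of cosets of the subgroup ⟨ω^{4m²}⟩ of F_{q²}^×; (3) |X₁| = |X₃| = m(m²−1)(m−1) and |X₂| = |X₄| = m(m²−1)(m+1); (4) for every a ∈ F_{q²}∖{0}: if a ∈ Y₁ then (ψ'(aX₁), ψ'(aX₂), ψ'(aX₃), ψ'(aX₄)) = ((m²+m−1)/2 − (m/2)G, −(m²+m)/2 − ((m+1)/2)G, (m²+m−1)/2 + (m/2)G, −(m²+m)/2 + ((m+1)/2)G); if a ∈ Y₂ then it equals ((−m²+m)/2 − ((m−1)/2)G, (m²−m−1)/2 + (m/2)G, (−m²+m)/2 + ((m−1)/2)G, (m²−m−1)/2 − (m/2)G); if a ∈ Y₃ then it equals ((m²+m−1)/2 + (m/2)G, −(m²+m)/2 +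 ((m+1)/2)G, (m²+m−1)/2 − (m/2)G, −(m²+m)/2 − ((m+1)/2)G); and if a ∈ Y₄ then it equals ((−m²+m)/2 + ((m−1)/2)G, (m²−m−1)/2 − (m/2)G, (−m²+m)/2 − ((m−1)/2)G, (m²−m−1)/2 + (m/2)G). Then there exists an Hadamard matrix of order 4m² all of whose row sums equal 2m (a regular Hadamard matrix). -/
noncomputable section

open Complex

open scoped Classical

open Classical in
/-- The quadratic character of a finite field, with values in `ℂ`. -/
noncomputable def quadChar (F : Type*) [Field F] : F → ℂ :=
  fun x => if x = 0 then 0 else if IsSquare x then 1 else -1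

theorem aux_mat {ι : Type} [Fintype ι] [DecidableEq ι] (m : ℕ) (hι : Fintype.card ι = 2 * m ^ 2)
    (C : Matrix ι ι ℤ) (T : ι → Prop)
    (hsym : ∀ i j, C i j = C j i) (hdiag : ∀ i, C i i = 0)
    (hoff : ∀ i j, i ≠ j → C i j = 1 ∨ C i j = -1)
    (horth : ∀ i j, i ≠ j → ∑ k, C i k * C j k = 0)
    (h11 : ∀ i, T i → ∑ j, (if T j then C i j else 0) = -(m : ℤ))
    (h12 : ∀ i, T i → ∑ j, (if T j then 0 else C i j) = -((m : ℤ) + 1))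
    (h21 : ∀ i, ¬ T i → ∑ j, (if T j then C i j else 0) = -((m : ℤ) - 1))
    (h22 : ∀ i, ¬ T i → ∑ j, (if T j then 0 else C i j) = (m : ℤ)) :
    ∃ H : Matrix (Fin (4 * m ^ 2)) (Fin (4 * m ^ 2)) ℤ,
      (∀ i j, H i j = 1 ∨ H i j = -1) ∧
      H * H.transpose = ((4 * m ^ 2 : ℕ) : ℤ) • (1 : Matrix _ _ ℤ) ∧
      (∀ i, (∑ j, H i j) = 2 * (m : ℤ)) := by
  have hcard : Fintype.card (ι ⊕ ι) = Fintype.card (Fin (4 * m ^ 2)) := by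
    simp [hι]; ring
  let e : ι ⊕ ι ≃ Fin (4 * m ^ 2) := Fintype.equivOfCardEq hcard
  suffices h : ∃ H : Matrix (ι ⊕ ι) (ι ⊕ ι) ℤ,
      (∀ i j, H i j = 1 ∨ H i j = -1) ∧
      H * H.transpose = ((4 * m ^ 2 : ℕ) : ℤ) • (1 : Matrix _ _ ℤ) ∧
      (∀ i, (∑ j, H i j) = 2 * (m : ℤ)) by
    obtain ⟨H, ha, hb, hc⟩ := h
    refine ⟨Matrix.reindex e e H, fun i j => ha _ _, ?_, fun i => ?_⟩
    · rw [Matrix.transpose_reindex, Matrix.reindex_apply, Matrix.reindex_apply,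
        Matrix.submatrix_mul_equiv, hb]
      ext i j
      simp only [Matrix.submatrix_apply, Matrix.smul_apply, Matrix.one_apply,
        EmbeddingLike.apply_eq_iff_eq]
    · rw [← hc (e.symm i)]
      exact Equiv.sum_comp e.symm (fun j => H (e.symm i) j)
  have hCt : C.transpose = C := by ext i j; exact hsym j i
  have hCC : C * C = (2 * (m : ℤ) ^ 2 - 1) • (1 : Matrix ι ι ℤ) := by
    ext i j
    rw [Matrix.mul_apply]
    by_cases hij : i = j
    · subst hij
      have : ∀ k, C i k * C k i = 1 - if k = i then 1 else 0 := by
        intro k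
        by_cases hk : k = i
        · subst hk; simp [hdiag]
        · rw [hsym i k]
          rcases hoff k i hk with h | h <;> simp [h, hk]
      simp only [this, Finset.sum_sub_distrib]
      simp [hι]
    · have : ∀ k, C i k * C k j = C i k * C j k := fun k => by rw [hsym k j]
      simp only [this]
      rw [horth i j hij]
      simp [hij]
  let r : ι ⊕ ι → ℤ := Sum.elim (fun i => if T i then 1 else -1) (fun _ => 1)
  let d : ι ⊕ ι → ℤ := Sum.elim (fun _ => -1) (fun i => if T i then 1 else -1)
  have hr : ∀ i, r i = 1 ∨ r i = -1 := by
    rintro (i | i) <;> simp only [r, Sum.elim_inl, Sum.elim_inr] <;> (try split_ifs) <;> simp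
  have hd : ∀ i, d i = 1 ∨ d i = -1 := by
    rintro (i | i) <;> simp only [d, Sum.elim_inl, Sum.elim_inr] <;> (try split_ifs) <;> simp
  let H0 : Matrix (ι ⊕ ι) (ι ⊕ ι) ℤ := Matrix.fromBlocks (C + 1) (C - 1) (C - 1) (-C - 1)
  have hH0 : H0 * H0.transpose = ((4 * m ^ 2 : ℕ) : ℤ) • (1 : Matrix _ _ ℤ) := by
    simp only [H0, Matrix.fromBlocks_transpose, Matrix.fromBlocks_multiply,
      Matrix.transpose_add, Matrix.transpose_sub, Matrix.transpose_neg, Matrix.transpose_one, hCt]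
    rw [← Matrix.fromBlocks_one, Matrix.fromBlocks_smul]
    congr 1
    · have : (C + 1) * (C + 1) + (C - 1) * (C - 1) = C * C + C * C + 1 + 1 := by noncomm_ring
      rw [this, hCC]
      ext i j
      simp only [Matrix.add_apply, Matrix.smul_apply, Matrix.one_apply, smul_eq_mul]
      push_cast
      split_ifs <;> ring
    · rw [smul_zero]; noncomm_ring
    · rw [smul_zero]; noncomm_ring
    · have : (C - 1) * (C - 1) + (-C - 1) * (-C - 1) = C * C + C * C + 1 + 1 := by noncomm_ring
      rw [this, hCC]
      ext i j
      simp only [Matrix.add_apply, Matrix.smul_apply, Matrix.one_apply, smul_eq_mul]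
      push_cast
      split_ifs <;> ring
  have hH0e : ∀ i j, H0 i j = 1 ∨ H0 i j = -1 := by
    rintro (i | i) (j | j) <;> by_cases hij : i = j
    any_goals subst hij; simp [H0, hdiag]
    all_goals
      rcases hoff i j hij with h | h <;> simp [H0, Matrix.one_apply, hij, h]
  refine ⟨Matrix.of fun i j => r i * H0 i j * d j, fun i j => ?_, ?_, ?_⟩
  · rcases hr i with h | h <;> rcases hH0e i j with h' | h' <;> rcases hd j with h'' | h'' <;>
      simp [h, h', h'']
  · ext i j
    have := congrFun (congrFun hH0 i) j
    rw [Matrix.mul_apply] at this ⊢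
    simp only [Matrix.transpose_apply, Matrix.of_apply] at this ⊢
    have h2 : ∀ k, r i * H0 i k * d k * (r j * H0 j k * d k) = (r i * r j) * (H0 i k * H0 j k) := by
      intro k
      rcases hd k with h | h <;> rw [h] <;> ring
    simp only [h2]
    rw [← Finset.mul_sum, this]
    by_cases hij : i = j
    · subst hij
      rcases hr i with h | h <;> rw [h] <;> simp
    · simp [hij]
  · have hsum : ∀ (i : ι) (a b : ℤ), ∑ j, C i j * (if T j then a else b) =
        a * ∑ j, (if T j then C i j else 0) + b * ∑ j, (if T j then 0 else C i j) := by
      intro i a b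
      rw [Finset.mul_sum, Finset.mul_sum, ← Finset.sum_add_distrib]
      refine Finset.sum_congr rfl fun j _ => ?_
      split_ifs <;> ring
    have hone : ∀ (i : ι) (f : ι → ℤ), ∑ j, (1 : Matrix ι ι ℤ) i j * f j = f i := by
      intro i f; simp [Matrix.one_apply]
    have hneg : ∀ (i : ι), ∑ j, C i j * (-1) = 
        - (∑ j, (if T j then C i j else 0) + ∑ j, (if T j then 0 else C i j)) := by
      intro i
      have := hsum i (-1) (-1)
      simp only [ite_self] at this
      rw [this]; ring
    rintro (i | i) <;> simp only [Matrix.of_apply, r, d, H0, Fintype.sum_sum_type, Sum.elim_inl, Sum.elim_inr,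
      mul_assoc, ← Finset.mul_sum, Matrix.fromBlocks_apply₁₁, Matrix.fromBlocks_apply₁₂,
      Matrix.fromBlocks_apply₂₁, Matrix.fromBlocks_apply₂₂, Matrix.add_apply, Matrix.sub_apply,
      Matrix.neg_apply, add_mul, sub_mul, neg_mul, Finset.sum_add_distrib, Finset.sum_sub_distrib,
      Finset.sum_neg_distrib, hsum, hone, hneg]
    all_goals
      by_cases hT : T i
      · rw [h11 i hT, h12 i hT]; simp [hT]; ring
      · rw [h21 i hT, h22 i hT]; simp [hT]; ring

theorem aux_quad (F : Type) [Field F] [Fintype F] (x : F) :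
    quadChar F x = ((quadraticChar F x : ℤ) : ℂ) := by
  unfold quadChar
  by_cases h : x = 0
  · simp [h]
  · rw [if_neg h]
    by_cases h2 : IsSquare x
    · rw [if_pos h2, (quadraticChar_one_iff_isSquare h).2 h2]; simp
    · rw [if_neg h2, quadraticChar_neg_one_iff_not_isSquare.2 h2]; simp

theorem aux_units_sum {F : Type} [Field F] [Fintype F] {M : Type} [AddCommMonoid M]
    (f : F → M) (h0 : f 0 = 0) : ∑ x, f x = ∑ u : Fˣ, f u := by
  rw [← Finset.sum_subset (Finset.subset_univ (Finset.univ.map ⟨fun u : Fˣ => (u : F), Units.val_injective⟩))]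
  · simp
  · intro x _ hx
    by_cases hx0 : x = 0
    · rw [hx0, h0]
    · exact absurd (Finset.mem_map.2 ⟨Units.mk0 x hx0, Finset.mem_univ _, rfl⟩) hx

theorem aux_gauss_ne (F : Type) [Field F] [Fintype F] (hF : ringChar F ≠ 2)
    (ψ : AddChar F ℂ) (hψ : ∃ a, ψ a ≠ 1) :
    (∑ x : F, quadChar F x * ψ x) ≠ 0 := by
  let χ : MulChar F ℂ := (quadraticChar F).ringHomComp (Int.castRingHom ℂ)
  have hχ1 : χ ≠ 1 := by
    rw [Ne, MulChar.ringHomComp_eq_one_iff (RingHom.injective_int _)]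
    exact quadraticChar_ne_one hF
  have hχ2 : χ.IsQuadratic := (quadraticChar_isQuadratic F).comp _
  have hψ' : ψ ≠ 1 := by
    rintro rfl
    obtain ⟨a, ha⟩ := hψ
    exact ha rfl
  have h := gaussSum_sq hχ1 hχ2 (AddChar.IsPrimitive.of_ne_one hψ')
  have hG : gaussSum χ ψ = ∑ x : F, quadChar F x * ψ x := by
    unfold gaussSum
    refine Finset.sum_congr rfl fun x _ => ?_
    rw [aux_quad]; rfl
  rw [← hG]
  intro h0
  rw [h0] at h
  have h1 : χ (-1) ≠ 0 := by
    have : χ (-1) * χ (-1) = 1 := by rw [← map_mul]; simp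
    intro h; rw [h] at this; simp at this
  have h2 : (Fintype.card F : ℂ) ≠ 0 := by
    exact_mod_cast Fintype.card_ne_zero
  exact mul_ne_zero h1 h2 (by rw [← h]; simp)

theorem aux_gauss_shift (F : Type) [Field F] [Fintype F] (hF : ringChar F ≠ 2)
    (ψ : AddChar F ℂ) (t : F) :
    ∑ c : Fˣ, ((quadraticChar F (c : F) : ℤ) : ℂ) * ψ (c * t) =
      ((quadraticChar F t : ℤ) : ℂ) * ∑ x : F, quadChar F x * ψ x := by
  by_cases ht : t = 0
  · subst ht
    simp only [mul_zero, AddChar.map_zero_eq_one, mul_one, quadraticChar_zero, Int.cast_zero,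
      zero_mul]
    rw [← aux_units_sum (fun x : F => ((quadraticChar F x : ℤ) : ℂ)) (by simp)]
    have := quadraticChar_sum_zero hF
    exact_mod_cast this
  · rw [aux_units_sum (fun x : F => quadChar F x * ψ x) (by simp [quadChar]), Finset.mul_sum]
    let u := Units.mk0 t ht
    refine Fintype.sum_equiv (Equiv.mulRight u) _ _ fun c => ?_
    simp only [Equiv.coe_mulRight, Units.val_mul, u, Units.val_mk0, aux_quad, map_mul]
    have h : quadraticChar F t * quadraticChar F t = 1 := by
      rw [← sq]; exact quadraticChar_sq_one ht
    have h' : ((quadraticChar F t : ℤ) : ℂ) * ((quadraticChar F t : ℤ) : ℂ) = 1 := by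
      exact_mod_cast h
    push_cast
    linear_combination (-((quadraticChar F (c:F) : ℤ) : ℂ) * ψ (c * t)) * h'

/-- splitting of character sums over projective representatives -/
theorem aux_split {F F2 ι : Type} [Field F] [Fintype F] [Field F2] [Fintype F2] [Algebra F F2]
    [Fintype ι] (hF : ringChar F ≠ 2)
    (ψ : AddChar F ℂ) (v : ι → F2ˣ)
    (hv : Function.Bijective fun p : ι × Fˣ => Units.map (algebraMap F F2).toMonoidHom p.2 * v p.1)
    (U V : Finset F2) (hU0 : (0 : F2) ∉ U) (hV0 : (0 : F2) ∉ V) (hUV : Disjoint U V)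
    (hVv : ∀ i, (v i : F2) ∉ V)
    (hsq : ∀ c : Fˣ, IsSquare (c : F) → ∀ y,
      (algebraMap F F2 c * y ∈ U ↔ y ∈ U) ∧ (algebraMap F F2 c * y ∈ V ↔ y ∈ V))
    (hns : ∀ c : Fˣ, ¬ IsSquare (c : F) → ∀ y,
      (algebraMap F F2 c * y ∈ U ↔ y ∈ V) ∧ (algebraMap F F2 c * y ∈ V ↔ y ∈ U))
    (B : F2 → F) (hB : ∀ (c : F) y, B (algebraMap F F2 c * y) = c * B y) :
    ∑ y ∈ U, ψ (B y) - ∑ y ∈ V, ψ (B y) =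
      ((∑ i, (if (v i : F2) ∈ U then quadraticChar F (B (v i)) else 0) : ℤ) : ℂ) *
        ∑ x : F, quadChar F x * ψ x := by
  have h1 : ∑ y ∈ U, ψ (B y) - ∑ y ∈ V, ψ (B y) =
      ∑ y : F2, ((if y ∈ U then ψ (B y) else 0) - (if y ∈ V then ψ (B y) else 0)) := by
    rw [Finset.sum_sub_distrib]
    simp [Finset.sum_ite_mem]
  rw [h1, aux_units_sum _ (by simp [hU0, hV0]), ← hv.sum_comp, Fintype.sum_prod_type]
  push_cast
  rw [Finset.sum_mul]
  refine Finset.sum_congr rfl fun i _ => ?_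
  have key : ∀ c : Fˣ,
      ((if ((Units.map (algebraMap F F2).toMonoidHom c * v i : F2ˣ) : F2) ∈ U then
        ψ (B ((Units.map (algebraMap F F2).toMonoidHom c * v i : F2ˣ) : F2)) else 0) -
      (if ((Units.map (algebraMap F F2).toMonoidHom c * v i : F2ˣ) : F2) ∈ V then
        ψ (B ((Units.map (algebraMap F F2).toMonoidHom c * v i : F2ˣ) : F2)) else 0)) =
      (if (v i : F2) ∈ U then ((quadraticChar F (c : F) : ℤ) : ℂ) * ψ (c * B (v i)) else 0) := by
    intro c
    have e : ((Units.map (algebraMap F F2).toMonoidHom c * v i : F2ˣ) : F2) =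
      algebraMap F F2 c * v i := rfl
    rw [e, hB]
    by_cases hc : IsSquare (c : F)
    · simp only [(hsq c hc _).1, (hsq c hc _).2, hVv, if_false,
        (quadraticChar_one_iff_isSquare c.ne_zero).2 hc]
      simp
    · simp only [(hns c hc _).1, (hns c hc _).2, hVv, if_false,
        quadraticChar_neg_one_iff_not_isSquare.2 hc]
      split_ifs <;> simp
  refine (Finset.sum_congr rfl fun c _ => key c).trans ?_
  by_cases hi : (v i : F2) ∈ U
  · simp only [hi, if_true]
    exact aux_gauss_shift F hF ψ _
  · simp [hi]

/-- orthogonality -/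
theorem aux_orth {F F2 ι : Type} [Field F] [Fintype F] [Field F2] [Fintype F2] [Algebra F F2]
    [Fintype ι] (hF : ringChar F ≠ 2) (hcard : Fintype.card F2 = Fintype.card F ^ 2)
    (v : ι → F2ˣ)
    (hv : Function.Bijective fun p : ι × Fˣ => Units.map (algebraMap F F2).toMonoidHom p.2 * v p.1)
    (B B' : F2 →+ F) (hB : ∀ (c : F) y, B (algebraMap F F2 c * y) = c * B y)
    (hB' : ∀ (c : F) y, B' (algebraMap F F2 c * y) = c * B' y)
    (hinj : ∀ y, B y = 0 → B' y = 0 → y = 0) :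
    ∑ i, quadraticChar F (B (v i)) * quadraticChar F (B' (v i)) = 0 := by
  have hbij : Function.Bijective (B.prod B') := by
    rw [Fintype.bijective_iff_injective_and_card]
    constructor
    · rw [injective_iff_map_eq_zero]
      intro a ha
      rw [AddMonoidHom.prod_apply, Prod.mk_eq_zero] at ha
      exact hinj a ha.1 ha.2
    · rw [hcard, Fintype.card_prod, sq]
  have h0 : ∑ y : F2, quadraticChar F (B y) * quadraticChar F (B' y) = 0 := by
    have := hbij.sum_comp (fun p : F × F => quadraticChar F p.1 * quadraticChar F p.2)
    simp only [AddMonoidHom.prod_apply] at this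
    rw [this, Fintype.sum_prod_type]
    simp only [← Finset.mul_sum, quadraticChar_sum_zero hF, mul_zero, Finset.sum_const_zero]
  rw [aux_units_sum _ (by simp), ← hv.sum_comp, Fintype.sum_prod_type, Finset.sum_comm] at h0
  have key : ∀ c : Fˣ, ∑ i, quadraticChar F (B ((Units.map (algebraMap F F2).toMonoidHom c * v i : F2ˣ) : F2)) *
      quadraticChar F (B' ((Units.map (algebraMap F F2).toMonoidHom c * v i : F2ˣ) : F2)) =
      ∑ i, quadraticChar F (B (v i)) * quadraticChar F (B' (v i)) := by
    intro c
    refine Finset.sum_congr rfl fun i _ => ?_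
    have e : ((Units.map (algebraMap F F2).toMonoidHom c * v i : F2ˣ) : F2) =
      algebraMap F F2 c * v i := rfl
    have h : quadraticChar F (c : F) * quadraticChar F (c : F) = 1 := by
      rw [← sq]; exact quadraticChar_sq_one c.ne_zero
    rw [e, hB, hB', map_mul, map_mul]
    linear_combination (quadraticChar F (B (v i)) * quadraticChar F (B' (v i))) * h
  simp only [key] at h0
  rw [Finset.sum_const, smul_eq_zero] at h0
  rcases h0 with h0 | h0
  · simp at h0
  · exact h0

theorem aux_act {F2 : Type} [Field F2] (m : ℕ) (ω : F2ˣ) (U V : Finset F2)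
    (h1 : U = V.image fun x => ((ω ^ (2 * m ^ 2) : F2ˣ) : F2) * x)
    (h2U : ∀ x ∈ U, ∀ k : ℤ, ((ω ^ (4 * (m : ℤ) ^ 2 * k) : F2ˣ) : F2) * x ∈ U)
    (h2V : ∀ x ∈ V, ∀ k : ℤ, ((ω ^ (4 * (m : ℤ) ^ 2 * k) : F2ˣ) : F2) * x ∈ V) (k : ℤ) (y : F2) :
    ((((ω ^ (4 * (m : ℤ) ^ 2 * k) : F2ˣ) : F2) * y ∈ U ↔ y ∈ U) ∧
      (((ω ^ (4 * (m : ℤ) ^ 2 * k) : F2ˣ) : F2) * y ∈ V ↔ y ∈ V)) ∧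
    ((((ω ^ (2 * m ^ 2) : F2ˣ) : F2) * (((ω ^ (4 * (m : ℤ) ^ 2 * k) : F2ˣ) : F2) * y) ∈ U ↔ y ∈ V) ∧
      (((ω ^ (2 * m ^ 2) : F2ˣ) : F2) * (((ω ^ (4 * (m : ℤ) ^ 2 * k) : F2ˣ) : F2) * y) ∈ V ↔ y ∈ U)) := by
  have gen : ∀ W : Finset F2,
      (∀ x ∈ W, ∀ k : ℤ, ((ω ^ (4 * (m : ℤ) ^ 2 * k) : F2ˣ) : F2) * x ∈ W) → ∀ (k : ℤ) (y : F2),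
      (((ω ^ (4 * (m : ℤ) ^ 2 * k) : F2ˣ) : F2) * y ∈ W ↔ y ∈ W) := by
    intro W hW k y
    refine ⟨fun h => ?_, fun h => hW y h k⟩
    have := hW _ h (-k)
    rw [← mul_assoc, ← Units.val_mul, ← zpow_add] at this
    simpa using this
  have hww : ∀ z : F2, ((ω ^ (2 * m ^ 2) : F2ˣ) : F2) * (((ω ^ (2 * m ^ 2) : F2ˣ) : F2) * z) =
      ((ω ^ (4 * (m : ℤ) ^ 2 * 1) : F2ˣ) : F2) * z := by
    intro z
    rw [← mul_assoc, ← Units.val_mul, ← pow_add, ← zpow_natCast]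
    congr 3
    push_cast; ring
  have hU : ∀ z, ((ω ^ (2 * m ^ 2) : F2ˣ) : F2) * z ∈ U ↔ z ∈ V := by
    intro z
    rw [h1, Finset.mem_image]
    constructor
    · rintro ⟨x, hx, hxz⟩
      rwa [← mul_left_cancel₀ (Units.ne_zero _) hxz]
    · exact fun h => ⟨z, h, rfl⟩
  have hV : ∀ z, ((ω ^ (2 * m ^ 2) : F2ˣ) : F2) * z ∈ V ↔ z ∈ U := by
    intro z
    rw [← hU, hww, gen U h2U]
  exact ⟨⟨gen U h2U k y, gen V h2V k y⟩, by rw [hU, gen V h2V], by rw [hV, gen U h2U]⟩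

/-- a four-class translation association scheme on `F_{q²}` with the
prescribed first eigenmatrix, `q = 2m² − 1` a prime power with `m` odd, yields a regular
Hadamard matrix of order `4m²` (Theorem 1.4/6.1 of the paper). -/
theorem stmt_2 (m q : ℕ) (hm : 0 < m) (hmodd : Odd m)
    (hq : q = 2 * m ^ 2 - 1) (hqpp : IsPrimePow q)
    (F F2 : Type) [Field F] [Fintype F] [Field F2] [Fintype F2] [Algebra F F2]
    (hF : Fintype.card F = q) (hF2 : Fintype.card F2 = q ^ 2)
    (ω : F2ˣ) (hω : ∀ x : F2ˣ, x ∈ Subgroup.zpowers ω)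
    (ψ : AddChar F ℂ) (hψ : ∃ a, ψ a ≠ 1)
    (tr : F2 → F) (htr : ∀ x : F2, algebraMap F F2 (tr x) = x + x ^ q)
    (G : ℂ) (hG : G = ∑ x : F, quadChar F x * ψ x)
    (τ : ℤ) (hτ : τ = 1 ∨ τ = -1)
    (X₁ X₂ X₃ X₄ : Finset F2)
    (hd12 : Disjoint X₁ X₂) (hd13 : Disjoint X₁ X₃) (hd14 : Disjoint X₁ X₄)
    (hd23 : Disjoint X₂ X₃) (hd24 : Disjoint X₂ X₄) (hd34 : Disjoint X₃ X₄)
    (hpart : X₁ ∪ X₂ ∪ X₃ ∪ X₄ = Finset.univ.erase (0 : F2))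
    (Y₁ Y₂ Y₃ Y₄ : Finset F2)
    (hY1 : Y₁ = (X₁.image fun x => x ^ q).image
      fun x => ((ω ^ (-(τ * (m : ℤ) ^ 2)) : F2ˣ) : F2) * x)
    (hY2 : Y₂ = (X₂.image fun x => x ^ q).image
      fun x => ((ω ^ (-(τ * (m : ℤ) ^ 2)) : F2ˣ) : F2) * x)
    (hY3 : Y₃ = (X₃.image fun x => x ^ q).image
      fun x => ((ω ^ (-(τ * (m : ℤ) ^ 2)) : F2ˣ) : F2) * x)
    (hY4 : Y₄ = (X₄.image fun x => x ^ q).image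
      fun x => ((ω ^ (-(τ * (m : ℤ) ^ 2)) : F2ˣ) : F2) * x)
    -- condition (1)
    (h1a : X₁ = X₃.image fun x => ((ω ^ (2 * m ^ 2) : F2ˣ) : F2) * x)
    (h1b : X₂ = X₄.image fun x => ((ω ^ (2 * m ^ 2) : F2ˣ) : F2) * x)
    -- condition (2): each Xᵢ is a union of cosets of ⟨ω^{4m²}⟩
    (h2a : ∀ x ∈ X₁, ∀ k : ℤ, ((ω ^ (4 * (m : ℤ) ^ 2 * k) : F2ˣ) : F2) * x ∈ X₁)
    (h2b : ∀ x ∈ X₂, ∀ k : ℤ, ((ω ^ (4 * (m : ℤ) ^ 2 * k) : F2ˣ) : F2) * x ∈ X₂)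
    (h2c : ∀ x ∈ X₃, ∀ k : ℤ, ((ω ^ (4 * (m : ℤ) ^ 2 * k) : F2ˣ) : F2) * x ∈ X₃)
    (h2d : ∀ x ∈ X₄, ∀ k : ℤ, ((ω ^ (4 * (m : ℤ) ^ 2 * k) : F2ˣ) : F2) * x ∈ X₄)
    -- condition (3): sizes
    (h3a : X₁.card = m * (m ^ 2 - 1) * (m - 1)) (h3b : X₃.card = m * (m ^ 2 - 1) * (m - 1))
    (h3c : X₂.card = m * (m ^ 2 - 1) * (m + 1)) (h3d : X₄.card = m * (m ^ 2 - 1) * (m + 1))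
    -- condition (4): the prescribed character values (first eigenmatrix)
    (h4 : ∀ a : F2, a ≠ 0 →
      (a ∈ Y₁ →
        (∑ y ∈ X₁, ψ (tr (a * y))) = ((m : ℂ) ^ 2 + m - 1) / 2 - ((m : ℂ) / 2) * G ∧
        (∑ y ∈ X₂, ψ (tr (a * y))) = -((m : ℂ) ^ 2 + m) / 2 - (((m : ℂ) + 1) / 2) * G ∧
        (∑ y ∈ X₃, ψ (tr (a * y))) = ((m : ℂ) ^ 2 + m - 1) / 2 + ((m : ℂ) / 2) * G ∧
        (∑ y ∈ X₄, ψ (tr (a * y))) = -((m : ℂ) ^ 2 + m) / 2 + (((m : ℂ) + 1) / 2) * G) ∧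
      (a ∈ Y₂ →
        (∑ y ∈ X₁, ψ (tr (a * y))) = (-(m : ℂ) ^ 2 + m) / 2 - (((m : ℂ) - 1) / 2) * G ∧
        (∑ y ∈ X₂, ψ (tr (a * y))) = ((m : ℂ) ^ 2 - m - 1) / 2 + ((m : ℂ) / 2) * G ∧
        (∑ y ∈ X₃, ψ (tr (a * y))) = (-(m : ℂ) ^ 2 + m) / 2 + (((m : ℂ) - 1) / 2) * G ∧
        (∑ y ∈ X₄, ψ (tr (a * y))) = ((m : ℂ) ^ 2 - m - 1) / 2 - ((m : ℂ) / 2) * G) ∧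
      (a ∈ Y₃ →
        (∑ y ∈ X₁, ψ (tr (a * y))) = ((m : ℂ) ^ 2 + m - 1) / 2 + ((m : ℂ) / 2) * G ∧
        (∑ y ∈ X₂, ψ (tr (a * y))) = -((m : ℂ) ^ 2 + m) / 2 + (((m : ℂ) + 1) / 2) * G ∧
        (∑ y ∈ X₃, ψ (tr (a * y))) = ((m : ℂ) ^ 2 + m - 1) / 2 - ((m : ℂ) / 2) * G ∧
        (∑ y ∈ X₄, ψ (tr (a * y))) = -((m : ℂ) ^ 2 + m) / 2 - (((m : ℂ) + 1) / 2) * G) ∧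
      (a ∈ Y₄ →
        (∑ y ∈ X₁, ψ (tr (a * y))) = (-(m : ℂ) ^ 2 + m) / 2 + (((m : ℂ) - 1) / 2) * G ∧
        (∑ y ∈ X₂, ψ (tr (a * y))) = ((m : ℂ) ^ 2 - m - 1) / 2 - ((m : ℂ) / 2) * G ∧
        (∑ y ∈ X₃, ψ (tr (a * y))) = (-(m : ℂ) ^ 2 + m) / 2 - (((m : ℂ) - 1) / 2) * G ∧
        (∑ y ∈ X₄, ψ (tr (a * y))) = ((m : ℂ) ^ 2 - m - 1) / 2 + ((m : ℂ) / 2) * G)) :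
    ∃ H : Matrix (Fin (4 * m ^ 2)) (Fin (4 * m ^ 2)) ℤ,
      (∀ i j, H i j = 1 ∨ H i j = -1) ∧
      H * H.transpose = ((4 * m ^ 2 : ℕ) : ℤ) • (1 : Matrix _ _ ℤ) ∧
      (∀ i, (∑ j, H i j) = 2 * (m : ℤ)) := by

  have hm2 : m ^ 2 % 8 = 1 := by
    obtain ⟨k, rfl⟩ := hmodd
    have : (2 * k + 1) ^ 2 = 4 * (k * (k + 1)) + 1 := by ring
    obtain ⟨j, hj⟩ := Nat.even_mul_succ_self k
    omega
  have hq2 : 2 ≤ q := hqpp.two_le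
  have hq1 : q + 1 = 2 * m ^ 2 := by omega
  have hqq : q ^ 2 - 1 = 2 * m ^ 2 * (q - 1) := by
    obtain ⟨r, rfl⟩ : ∃ r, q = r + 1 := ⟨q - 1, by omega⟩
    rw [← hq1]
    simp only [Nat.add_sub_cancel]
    have : (r + 1) ^ 2 = (r + 1 + 1) * r + 1 := by ring
    omega
  have hchar : ringChar F ≠ 2 := by
    intro h
    have := FiniteField.even_card_iff_char_two.1 h
    omega
  have hneg1 : IsSquare (-1 : F) := by
    rw [FiniteField.isSquare_neg_one_iff]; omega
  have h2F : (2 : F) ≠ 0 := Ring.two_ne_zero hchar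
  have h2F2 : (2 : F2) ≠ 0 := by
    have := (map_ne_zero (algebraMap F F2)).2 h2F
    rwa [map_ofNat] at this
  have hinj : Function.Injective (algebraMap F F2) := (algebraMap F F2).injective
  have hord : orderOf ω = q ^ 2 - 1 := by
    rw [orderOf_eq_card_of_forall_mem_zpowers hω, Nat.card_eq_fintype_card, Fintype.card_units, hF2]
  have hadd : ∀ x y : F2, (x + y) ^ q = x ^ q + y ^ q := by
    intro x y
    have := map_add (FiniteField.frobeniusAlgHom F F2) x y
    simpa [FiniteField.coe_frobeniusAlgHom, hF] using this
  have hfixF : ∀ c : F, (algebraMap F F2 c) ^ q = algebraMap F F2 c := by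
    intro c
    rw [← map_pow, ← hF, FiniteField.pow_card]
  have hqq2 : ∀ x : F2, (x ^ q) ^ q = x := by
    intro x
    rw [← pow_mul, ← sq, ← hF2, FiniteField.pow_card]
  have hfix : ∀ x : F2, x ^ q = x → ∃ c : F, algebraMap F F2 c = x := by
    intro x hx
    refine ⟨tr x / 2, ?_⟩
    rw [map_div₀, htr, hx, map_ofNat]
    field_simp
    ring
  -- tr is linear
  have htr_add : ∀ x y, tr (x + y) = tr x + tr y := by
    intro x y
    apply hinj
    rw [map_add, htr, htr, htr, hadd]; ring
  have htr_mul : ∀ (c : F) y, tr (algebraMap F F2 c * y) = c * tr y := by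
    intro c y
    apply hinj
    rw [map_mul, htr, htr, mul_pow, hfixF]; ring
  -- the element δ
  have hd : ((ω : F2) ^ (m ^ 2)) ^ q = - (ω : F2) ^ (m ^ 2) := by
    have hsq : ((ω : F2) ^ (m ^ 2 * (q - 1))) ^ 2 = 1 := by
      have : ω ^ (q ^ 2 - 1) = 1 := by rw [← hord]; exact pow_orderOf_eq_one ω
      have h' := congrArg (Units.val) this
      rw [Units.val_pow_eq_pow_val, Units.val_one] at h'
      rw [← pow_mul, ← h', hqq]
      congr 1; ring
    have hne : (ω : F2) ^ (m ^ 2 * (q - 1)) ≠ 1 := by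
      intro h
      have h' : ω ^ (m ^ 2 * (q - 1)) = 1 := by
        ext; simpa using h
      have h3 := orderOf_dvd_of_pow_eq_one h'
      rw [hord, hqq] at h3
      have hpos : 0 < m ^ 2 * (q - 1) := Nat.mul_pos (by positivity) (by omega)
      have := Nat.le_of_dvd hpos h3
      nlinarith
    have hm1 := (mul_self_eq_one_iff.1 (by rw [← sq]; exact hsq)).resolve_left hne
    have : ((ω : F2) ^ (m ^ 2)) ^ q = (ω : F2) ^ (m ^ 2 * (q - 1)) * (ω : F2) ^ (m ^ 2) := by
      rw [← pow_mul, ← pow_add]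
      congr 1
      obtain ⟨r, rfl⟩ : ∃ r, q = r + 1 := ⟨q - 1, by omega⟩
      simp only [Nat.add_sub_cancel]; ring
    rw [this, hm1]; ring
  obtain ⟨δ, hδdef⟩ : ∃ δ : F2ˣ, δ = ω ^ (-(τ * (m : ℤ) ^ 2)) := ⟨_, rfl⟩
  have hqodd : Odd q := by rw [Nat.odd_iff]; omega
  have hδ : (δ : F2) ^ q = - δ := by
    rcases hτ with h | h
    · have : (δ : F2) = ((ω : F2) ^ (m ^ 2))⁻¹ := by
        rw [hδdef, h, one_mul, zpow_neg]
        have : ω ^ ((m : ℤ) ^ 2) = ω ^ (m ^ 2) := by rw [← zpow_natCast]; norm_cast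
        rw [this]; simp
      rw [this, inv_pow, hd, inv_neg]
    · have : (δ : F2) = ((ω : F2) ^ (m ^ 2)) := by
        rw [hδdef, h]
        have : ω ^ (-(-1 * (m : ℤ) ^ 2)) = ω ^ (m ^ 2) := by
          rw [← zpow_natCast]; push_cast; congr 1; ring
        rw [this]; simp
      rw [this, hd]
  rw [← hδdef] at hY1 hY2 hY3 hY4
  -- the bilinear form
  let B : F2 → F2 →+ F := fun x => AddMonoidHom.mk' (fun y => tr (δ * x ^ q * y))
    (fun y z => by rw [mul_add, htr_add])
  have hBdef : ∀ x y, B x y = tr (δ * x ^ q * y) := fun _ _ => rfl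
  have hBval : ∀ x y, algebraMap F F2 (B x y) = δ * (x ^ q * y - x * y ^ q) := by
    intro x y
    rw [hBdef, htr, mul_pow, mul_pow, hδ, hqq2]; ring
  have hBmul : ∀ x (c : F) y, B x (algebraMap F F2 c * y) = c * B x y := by
    intro x c y
    rw [hBdef, hBdef, ← htr_mul]; congr 1; ring
  have hBanti : ∀ x y, B x y = -1 * B y x := by
    intro x y
    apply hinj
    rw [map_mul, hBval, hBval, map_neg, map_one]; ring
  have hBker : ∀ x y, x ≠ 0 → B x y = 0 → ∃ c : F, y = algebraMap F F2 c * x := by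
    intro x y hx h
    have h1 := hBval x y
    rw [h, map_zero] at h1
    have h2 : x ^ q * y - x * y ^ q = 0 := by
      rcases mul_eq_zero.1 h1.symm with h | h
      · exact absurd h δ.ne_zero
      · exact h
    obtain ⟨c, hc⟩ := hfix (y / x) (by
      rw [div_pow, div_eq_div_iff (pow_ne_zero _ hx) hx]
      linear_combination -h2)
    exact ⟨c, by rw [hc]; field_simp⟩
  -- the subfield
  obtain ⟨φ, hφ⟩ : ∃ φ : Fˣ →* F2ˣ, φ = Units.map (algebraMap F F2).toMonoidHom := ⟨_, rfl⟩
  have hφv : ∀ c : Fˣ, ((φ c : F2ˣ) : F2) = algebraMap F F2 c := fun c => by rw [hφ]; rfl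
  have hφinj : Function.Injective φ := by
    intro a b h
    have := congrArg Units.val h
    rw [hφv, hφv] at this
    exact Units.ext (hinj this)
  obtain ⟨ν, hν⟩ : ∃ ν : Fˣ, φ ν = ω ^ (2 * m ^ 2) := by
    have hfx : ((ω ^ (2 * m ^ 2) : F2ˣ) : F2) ^ q = ((ω ^ (2 * m ^ 2) : F2ˣ) : F2) := by
      rw [← Units.val_pow_eq_pow_val, ← pow_mul]
      have : 2 * m ^ 2 * q = (q ^ 2 - 1) + 2 * m ^ 2 := by
        rw [hqq]
        obtain ⟨r, rfl⟩ : ∃ r, q = r + 1 := ⟨q - 1, by omega⟩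
        simp only [Nat.add_sub_cancel]; ring
      rw [this, pow_add, ← hord, pow_orderOf_eq_one, one_mul]
    obtain ⟨c, hc⟩ := hfix _ hfx
    have hc0 : c ≠ 0 := by
      rintro rfl
      rw [map_zero] at hc
      exact Units.ne_zero _ hc.symm
    refine ⟨Units.mk0 c hc0, Units.ext ?_⟩
    rw [hφv]; exact hc
  have hνgen : ∀ c : Fˣ, ∃ k : ℤ, c = ν ^ k := by
    intro c
    obtain ⟨n, hn⟩ := Subgroup.mem_zpowers_iff.1 (hω (φ c))
    have h1 : ω ^ (n * ((q - 1 : ℕ) : ℤ)) = 1 := by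
      rw [zpow_mul, hn, zpow_natCast, ← map_pow]
      have : c ^ (q - 1) = 1 := by
        rw [← hF, ← Fintype.card_units, pow_card_eq_one]
      rw [this, map_one]
    have h2 := orderOf_dvd_iff_zpow_eq_one.2 h1
    rw [hord, hqq, Nat.cast_mul] at h2
    have h3 : ((2 * m ^ 2 : ℕ) : ℤ) ∣ n :=
      Int.dvd_of_mul_dvd_mul_right (by have : 0 < q - 1 := by omega
                                       exact_mod_cast this.ne') h2
    obtain ⟨k, rfl⟩ := h3
    refine ⟨k, hφinj ?_⟩
    rw [map_zpow, hν, ← hn, zpow_mul, zpow_natCast]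
  have hsqr : ∀ c : Fˣ, IsSquare (c : F) → ∃ k : ℤ,
      algebraMap F F2 c = ((ω ^ (4 * (m : ℤ) ^ 2 * k) : F2ˣ) : F2) := by
    rintro c ⟨d, hd⟩
    have hd0 : d ≠ 0 := by
      rintro rfl
      exact c.ne_zero (by simpa using hd)
    obtain ⟨k, hk⟩ := hνgen (Units.mk0 d hd0)
    refine ⟨k, ?_⟩
    rw [← hφv]
    congr 1
    have : c = ν ^ k * ν ^ k := by
      rw [← hk]; exact Units.ext hd
    rw [this, map_mul, map_zpow, hν, ← zpow_natCast, ← zpow_mul, ← zpow_add]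
    congr 1; push_cast; ring
  have hnsqr : ∀ c : Fˣ, ¬ IsSquare (c : F) → ∃ k : ℤ,
      algebraMap F F2 c = ((ω ^ (2 * m ^ 2) : F2ˣ) : F2) * ((ω ^ (4 * (m : ℤ) ^ 2 * k) : F2ˣ) : F2) := by
    intro c hc
    obtain ⟨k, hk⟩ := hνgen c
    rcases Int.even_or_odd' k with ⟨j, rfl | rfl⟩
    · refine absurd ⟨((ν ^ j : Fˣ) : F), ?_⟩ hc
      rw [hk, ← Units.val_mul, ← zpow_add]
      congr 2; ring
    · refine ⟨j, ?_⟩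
      rw [← hφv, ← Units.val_mul]
      congr 1
      rw [hk, map_zpow, hν, ← zpow_natCast, ← zpow_mul, ← zpow_add]
      congr 1; push_cast; ring
  have hact13 := aux_act m ω X₁ X₃ h1a h2a h2c
  have hact24 := aux_act m ω X₂ X₄ h1b h2b h2d
  have hX0 : ∀ y : F2, y ∈ X₁ ∪ X₂ ∪ X₃ ∪ X₄ ↔ y ≠ 0 := by
    intro y; rw [hpart]; simp
  simp only [Finset.mem_union] at hX0
  have hz := (hX0 0).not.2 (by simp)
  push Not at hz
  obtain ⟨⟨⟨hz1, hz2⟩, hz3⟩, hz4⟩ := hz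
  -- representatives
  have hrep : ∀ i : Fin (2 * m ^ 2), ∃ v : F2ˣ, ((v : F2) ∈ X₁ ∨ (v : F2) ∈ X₂) ∧
      ∃ k : ℤ, v = φ (ν ^ k) * ω ^ (i : ℕ) := by
    intro i
    have h := (hX0 ((ω ^ (i : ℕ) : F2ˣ) : F2)).2 (Units.ne_zero _)
    have a13 := (hact13 0 ((ω ^ (i : ℕ) : F2ˣ) : F2)).2.1
    have a24 := (hact24 0 ((ω ^ (i : ℕ) : F2ˣ) : F2)).2.1
    simp only [mul_zero, zpow_zero, Units.val_one, one_mul] at a13 a24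
    rcases h with ((h | h) | h) | h
    · exact ⟨ω ^ (i : ℕ), Or.inl h, 0, by simp⟩
    · exact ⟨ω ^ (i : ℕ), Or.inr h, 0, by simp⟩
    · exact ⟨φ ν * ω ^ (i : ℕ), Or.inl (by rw [hν, Units.val_mul]; exact a13.2 h), 1, by simp⟩
    · exact ⟨φ ν * ω ^ (i : ℕ), Or.inr (by rw [hν, Units.val_mul]; exact a24.2 h), 1, by simp⟩
  choose v hvX k hvk using hrep
  have hbij : Function.Bijective fun p : Fin (2 * m ^ 2) × Fˣ => φ p.2 * v p.1 := by
    rw [Fintype.bijective_iff_surjective_and_card]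
    constructor
    · intro u
      obtain ⟨n, hn⟩ := Subgroup.mem_zpowers_iff.1 (hω u)
      have hpos : (0 : ℤ) < ((2 * m ^ 2 : ℕ) : ℤ) := by
        have : 0 < 2 * m ^ 2 := by omega
        exact_mod_cast this
      have hr0 := Int.emod_nonneg n hpos.ne'
      have hr1 := Int.emod_lt_of_pos n hpos
      obtain ⟨r, hr⟩ := Int.eq_ofNat_of_zero_le hr0
      have hdm := Int.emod_add_mul_ediv n ((2 * m ^ 2 : ℕ) : ℤ)
      rw [hr] at hr1 hdm
      have hr1' : r < 2 * m ^ 2 := by exact_mod_cast hr1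
      refine ⟨(⟨r, hr1'⟩, ν ^ (n / ((2 * m ^ 2 : ℕ) : ℤ)) * (ν ^ k ⟨r, hr1'⟩)⁻¹), ?_⟩
      simp only
      rw [hvk, ← mul_assoc, ← map_mul, inv_mul_cancel_right, map_zpow, hν, ← hn]
      conv_rhs => rw [← hdm]
      rw [zpow_add, zpow_mul, zpow_natCast, zpow_natCast, mul_comm]
    · rw [Fintype.card_prod, Fintype.card_fin, Fintype.card_units, Fintype.card_units, hF, hF2, hqq]
  rw [hφ] at hbij
  have hvinj : ∀ i j (c : F), (v j : F2) = algebraMap F F2 c * v i → i = j := by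
    intro i j c h
    have hc0 : c ≠ 0 := by
      rintro rfl
      rw [map_zero, zero_mul] at h
      exact Units.ne_zero _ h
    have : ((i, Units.mk0 c hc0) : Fin (2 * m ^ 2) × Fˣ) = (j, 1) := by
      apply hbij.1
      apply Units.ext
      simp [h]
    exact (Prod.mk.inj this).1
  have hBv : ∀ i j, i ≠ j → B (v i) (v j) ≠ 0 := by
    intro i j hij h
    obtain ⟨c, hc⟩ := hBker _ _ (Units.ne_zero _) h
    exact hij (hvinj i j c hc)
  have hT : ∀ i, (v i : F2) ∈ X₂ ↔ ¬ (v i : F2) ∈ X₁ := by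
    intro i
    constructor
    · intro h h'
      exact Finset.disjoint_left.1 hd12 h' h
    · intro h
      exact (hvX i).resolve_left h
  have hv3 : ∀ i, (v i : F2) ∉ X₃ := by
    intro i h
    rcases hvX i with h' | h'
    · exact Finset.disjoint_left.1 hd13 h' h
    · exact Finset.disjoint_left.1 hd23 h' h
  have hv4 : ∀ i, (v i : F2) ∉ X₄ := by
    intro i h
    rcases hvX i with h' | h'
    · exact Finset.disjoint_left.1 hd14 h' h
    · exact Finset.disjoint_left.1 hd24 h' h
  have hGne : G ≠ 0 := by rw [hG]; exact aux_gauss_ne F hchar ψ hψ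
  have s13 : ∀ i, ∑ y ∈ X₁, ψ (B (v i) y) - ∑ y ∈ X₃, ψ (B (v i) y) =
      ((∑ j, (if (v j : F2) ∈ X₁ then quadraticChar F (B (v i) (v j)) else 0) : ℤ) : ℂ) * G := by
    intro i
    rw [hG]
    refine aux_split hchar ψ v hbij X₁ X₃ hz1 hz3 hd13 hv3 ?_ ?_ (B (v i)) (hBmul _)
    · intro c hc y
      obtain ⟨k, hk⟩ := hsqr c hc
      rw [hk]; exact (hact13 k y).1
    · intro c hc y
      obtain ⟨k, hk⟩ := hnsqr c hc
      rw [hk, mul_assoc]; exact (hact13 k y).2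
  have s24 : ∀ i, ∑ y ∈ X₂, ψ (B (v i) y) - ∑ y ∈ X₄, ψ (B (v i) y) =
      ((∑ j, (if (v j : F2) ∈ X₂ then quadraticChar F (B (v i) (v j)) else 0) : ℤ) : ℂ) * G := by
    intro i
    rw [hG]
    refine aux_split hchar ψ v hbij X₂ X₄ hz2 hz4 hd24 hv4 ?_ ?_ (B (v i)) (hBmul _)
    · intro c hc y
      obtain ⟨k, hk⟩ := hsqr c hc
      rw [hk]; exact (hact24 k y).1
    · intro c hc y
      obtain ⟨k, hk⟩ := hnsqr c hc
      rw [hk, mul_assoc]; exact (hact24 k y).2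
  simp only [hT, ite_not] at s24
  have ha0 : ∀ i, (δ : F2) * (v i : F2) ^ q ≠ 0 := fun i =>
    mul_ne_zero δ.ne_zero (pow_ne_zero _ (Units.ne_zero _))
  have hmY1 : ∀ i, (v i : F2) ∈ X₁ → (δ : F2) * (v i : F2) ^ q ∈ Y₁ := by
    intro i hi
    rw [hY1]
    exact Finset.mem_image_of_mem _ (Finset.mem_image_of_mem _ hi)
  have hmY2 : ∀ i, ¬ (v i : F2) ∈ X₁ → (δ : F2) * (v i : F2) ^ q ∈ Y₂ := by
    intro i hi
    rw [hY2]
    exact Finset.mem_image_of_mem _ (Finset.mem_image_of_mem _ ((hT i).2 hi))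
  have hcanc : ∀ a b : ℤ, (a : ℂ) * G = (b : ℂ) * G → a = b := by
    intro a b h
    exact_mod_cast mul_right_cancel₀ hGne h
  refine aux_mat m (by simp) (fun i j => quadraticChar F (B (v i) (v j)))
    (fun i => (v i : F2) ∈ X₁) ?_ ?_ ?_ ?_ ?_ ?_ ?_ ?_
  · intro i j
    have : quadraticChar F (-1) = 1 :=
      (quadraticChar_one_iff_isSquare (neg_ne_zero.2 one_ne_zero)).2 hneg1
    rw [hBanti, map_mul, this, one_mul]
  · intro i
    have : B (v i) (v i) = 0 := by
      apply hinj
      rw [hBval, map_zero]; ring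
    simp [this]
  · intro i j hij
    exact quadraticChar_dichotomy (hBv i j hij)
  · intro i j hij
    refine aux_orth hchar (by rw [hF, hF2]) v hbij (B (v i)) (B (v j)) (hBmul _) (hBmul _) ?_
    intro y hy hy'
    obtain ⟨c, rfl⟩ := hBker _ _ (Units.ne_zero _) hy
    rw [hBmul] at hy'
    rcases mul_eq_zero.1 hy' with h | h
    · rw [h, map_zero, zero_mul]
    · exact absurd h (hBv j i (Ne.symm hij))
  · intro i hi
    obtain ⟨e1, e2, e3, e4⟩ := (h4 _ (ha0 i)).1 (hmY1 i hi)
    apply hcanc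
    have hs := s13 i
    simp only [hBdef] at hs ⊢
    rw [e1, e3] at hs
    refine Eq.trans ?_ (hs.symm.trans ?_)
    · congr!
    · push_cast; ring
  · intro i hi
    obtain ⟨e1, e2, e3, e4⟩ := (h4 _ (ha0 i)).1 (hmY1 i hi)
    apply hcanc
    have hs := s24 i
    simp only [hBdef] at hs ⊢
    rw [e2, e4] at hs
    refine Eq.trans ?_ (hs.symm.trans ?_)
    · congr!
    · push_cast; ring
  · intro i hi
    obtain ⟨e1, e2, e3, e4⟩ := (h4 _ (ha0 i)).2.1 (hmY2 i hi)
    apply hcanc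
    have hs := s13 i
    simp only [hBdef] at hs ⊢
    rw [e1, e3] at hs
    refine Eq.trans ?_ (hs.symm.trans ?_)
    · congr!
    · push_cast; ring
  · intro i hi
    obtain ⟨e1, e2, e3, e4⟩ := (h4 _ (ha0 i)).2.1 (hmY2 i hi)
    apply hcanc
    have hs := s24 i
    simp only [hBdef] at hs ⊢
    rw [e2, e4] at hs
    refine Eq.trans ?_ (hs.symm.trans ?_)
    · congr!
    · push_cast; ring
end
end

section
/- Let q be an odd prime power, e an even divisor of q²−1, and χ_e a multiplicative character of F_{q²} with χ_e(ω) = ζ_e := exp(2πi/e) whose restriction to F_q^× equals the quadratic character η of F_q. Let ℓ be an integer not divisible by q+1, and let H be a subset of {0,1,…,e−1} of size e/2 containing exactly one element of each residue class modulo e/2. Then, as an identity in ℂ, |D_{ℓ,H}| = q/2 + (χ_e(−1)·G_q(η)/(e·q)) · ∑_{i=0}^{e/2−1} A_{2i+1} · G_{q²}(χ_e^{2i+1}) · χ_e^{−(2i+1)}(ω^{qℓ}) · χ_e^{2i+1}(ω^{ℓq} − ω^{ℓ}), where A_i := ∑_{j∈H} ζ_e^{−ji}. -/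
noncomputable section

open Complex

open scoped Classical

/-- The `i`-th cyclotomic class `C_i^{(e,q²)} = ω^i ⟨ω^e⟩` of order `e`. -/
def cyc {F2 : Type*} [Field F2] (ω : F2ˣ) (e : ℕ) (i : ℤ) : Set F2 :=
  {x | ∃ k : ℤ, x = ((ω ^ (i + (e : ℤ) * k) : F2ˣ) : F2)}

lemma aux_gauss (F F2 : Type) [Field F] [Fintype F] [Field F2] [Fintype F2] [Algebra F F2]
    (hF2 : Fintype.card F2 = Fintype.card F ^ 2)
    (ψ : AddChar F ℂ) (hψ : ψ ≠ 1)
    (tr : F2 → F) (htr : ∀ x : F2, algebraMap F F2 (tr x) = x + x ^ (Fintype.card F))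
    (η : MulChar F ℂ) (hη1 : η ≠ 1) (hηq : η.IsQuadratic)
    (θ : MulChar F2 ℂ) (hθ : ∀ x, θ (algebraMap F F2 x) = η x)
    (w : F2) (hw : w ^ (Fintype.card F) - w ≠ 0) :
    ∑ x : F, θ (1 + algebraMap F F2 x * w) =
      θ (-1) * gaussSum η ψ / (Fintype.card F : ℂ) * ((∑ y : F2, θ y * ψ (tr y)) *
        θ ((w ^ (Fintype.card F))⁻¹) * θ (w ^ (Fintype.card F) - w)) := by
  set q := Fintype.card F with hq
  have hq0 : q ≠ 0 := Fintype.card_ne_zero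
  have hq0' : (q : ℂ) ≠ 0 := by exact_mod_cast hq0
  let φ := FiniteField.frobeniusAlgHom F F2
  have hφ : ∀ x, x ^ q = φ x := fun x => rfl
  have hinj := (algebraMap F F2).injective
  have hw0 : w ≠ 0 := by
    rintro rfl
    simp [hq0] at hw
  have hφφ : φ (φ w) = w := by
    rw [← hφ, ← hφ, ← pow_mul, ← sq, ← hF2, FiniteField.pow_card]
  rw [hφ] at *
  set W := φ w with hW
  set δ := W - w with hδ
  have hW0 : W ≠ 0 := by
    rw [hW]; simpa using hw0
  have hφδ : φ δ = -δ := by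
    rw [hδ, map_sub, hφφ]; ring
  set S := ∑ x : F, θ (1 + algebraMap F F2 x * w) with hS
  let b := W * δ
  have hb : b ≠ 0 := mul_ne_zero hW0 hw
  have hφb : φ b = - w * δ := by
    simp only [b, map_mul, hφδ, hφφ]; ring
  let d := tr b
  have hd : algebraMap F F2 d = δ ^ 2 := by
    simp only [d]
    rw [htr, hφ, hφb]; simp only [b, hδ]; ring
  have hd0 : d ≠ 0 := by
    intro h
    rw [h, map_zero] at hd
    exact pow_ne_zero 2 hw hd.symm
  have htr2 : ∀ u v : F, tr (b * (algebraMap F F2 u + algebraMap F F2 v * w)) = d * u := by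
    intro u v
    apply hinj
    rw [htr, hφ, map_mul φ, hφb, map_mul, hd, map_add, map_mul, AlgHom.commutes, AlgHom.commutes,
      ← hW]
    simp only [b, hδ]; ring
  have hbij : Function.Bijective (fun p : F × F => b * (algebraMap F F2 p.1 + algebraMap F F2 p.2 * w)) := by
    rw [Fintype.bijective_iff_injective_and_card]
    refine ⟨?_, by rw [Fintype.card_prod, hF2, sq]⟩
    rintro ⟨u, v⟩ ⟨u', v'⟩ h
    simp only at h
    have h := mul_left_cancel₀ hb h
    have h2 := congrArg φ h
    simp only [map_add, map_mul, AlgHom.commutes] at h2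
    rw [← hW] at h2
    have h3 : (algebraMap F F2 v - algebraMap F F2 v') * δ = 0 := by
      rw [hδ]; linear_combination h2 - h
    have h4 := (mul_eq_zero.1 h3).resolve_right hw
    have h5 : v = v' := hinj (sub_eq_zero.1 h4)
    subst h5
    have h6 : u = u' := hinj (add_right_cancel h)
    rw [h6]
  have hin : ∀ u : F, ∑ v : F, θ (algebraMap F F2 u + algebraMap F F2 v * w) = η u * S := by
    intro u
    by_cases hu : u = 0
    · subst hu
      simp only [map_zero, zero_add, map_mul, hθ]
      rw [← Finset.sum_mul, MulChar.sum_eq_zero_of_ne_one hη1, η.map_zero]; simp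
    · rw [hS, Finset.mul_sum]
      refine (Fintype.sum_bijective (fun x => u * x) (mulLeft_bijective₀ u hu) _ _ ?_).symm
      intro x
      rw [← hθ, ← map_mul θ, map_mul (algebraMap F F2)]
      congr 1; ring
  have hg : ∑ y : F2, θ y * ψ (tr y) = θ b * S * ∑ u, η u * ψ (d * u) := by
    rw [← Fintype.sum_bijective _ hbij (fun p : F × F => θ b * (θ (algebraMap F F2 p.1 + algebraMap F F2 p.2 * w) * ψ (d * p.1))) _ ?_]
    · rw [Fintype.sum_prod_type, Finset.mul_sum]
      refine Finset.sum_congr rfl fun u _ => ?_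
      simp only
      rw [← Finset.mul_sum, ← Finset.sum_mul, hin]; ring
    · rintro ⟨u, v⟩
      simp only
      rw [htr2, map_mul θ b]; ring
  have hG : ∑ u, η u * ψ (d * u) = η d * gaussSum η ψ := by
    have := gaussSum_mulShift η ψ (Units.mk0 d hd0)
    rw [← this, ← mul_assoc, Units.val_mk0]
    have : η d * η d = 1 := by
      rw [← map_mul, ← sq]
      rcases hηq d with h | h | h
      · exact absurd h (by
          have := (IsUnit.mk0 d hd0).map η
          exact this.ne_zero)
      · rw [map_pow, h]; norm_num
      · rw [map_pow, h]; norm_num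
    rw [this, one_mul]; rfl
  have hdd : η d * η d = 1 := by
    rcases hηq d with h | h | h
    · exact absurd h ((IsUnit.mk0 d hd0).map η).ne_zero
    · rw [h]; norm_num
    · rw [h]; norm_num
  have hmm : θ (-1) * η (-1) = 1 := by
    have h1 : θ (-1) = η (-1) := by rw [← hθ]; simp
    rw [h1, ← map_mul]; simp
  have hθδ : η d = θ δ * θ δ := by rw [← hθ, hd, sq, map_mul]
  have hWW : θ W * θ W⁻¹ = 1 := by rw [← map_mul, mul_inv_cancel₀ hW0]; simp
  have hsq := gaussSum_sq hη1 hηq (AddChar.IsPrimitive.of_ne_one hψ)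
  rw [hg, hG]
  simp only [b, map_mul]
  have : θ (-1) * gaussSum η ψ / (q : ℂ) * (θ W * θ δ * S * (η d * gaussSum η ψ) * θ W⁻¹ * θ δ)
    = θ (-1) * gaussSum η ψ ^ 2 / q * (θ W * θ W⁻¹) * (η d * (θ δ * θ δ)) * S := by ring
  rw [this, hWW, ← hθδ, hdd, hsq, ← hq, ← mul_assoc, hmm]
  field_simp

lemma aux_split_s5 (h : ℕ) (f : ℕ → ℂ) :
    ∑ m ∈ Finset.range (2 * h), f m =
      ∑ i ∈ Finset.range h, f (2 * i) + ∑ i ∈ Finset.range h, f (2 * i + 1) := by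
  induction h with
  | zero => simp
  | succ n ih =>
    rw [mul_add, mul_one, Finset.sum_range_succ, Finset.sum_range_succ, ih,
      Finset.sum_range_succ, Finset.sum_range_succ]
    ring

lemma aux_geom (e : ℕ) (z : ℂ) (hz : z ^ e = 1) (h1 : z ≠ 1) :
    ∑ m ∈ Finset.range e, z ^ m = 0 := by
  rw [geom_sum_eq h1, hz]; simp

lemma aux_A (h : ℕ) (hh : 0 < h) (ζ : ℂ) (hζ : IsPrimitiveRoot ζ (2 * h))
    (H : Finset ℕ)
    (hHres : ∀ r < h, ∃! j, j ∈ H ∧ j % h = r) (i : ℕ) (hi0 : i ≠ 0) (hi : i < h) :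
    ∑ j ∈ H, ζ ^ (-((j : ℤ) * ((2 * i : ℕ) : ℤ))) = 0 := by
  have hz0 : ζ ≠ 0 := hζ.ne_zero (by omega)
  set z : ℂ := ζ ^ (-((2 * i : ℕ) : ℤ)) with hz
  have hzh : z ^ h = 1 := by
    rw [hz, ← zpow_natCast, ← zpow_mul, hζ.zpow_eq_one_iff_dvd]
    exact ⟨-i, by push_cast; ring⟩
  have hz1 : z ≠ 1 := by
    rw [hz, Ne, hζ.zpow_eq_one_iff_dvd, dvd_neg, Int.natCast_dvd_natCast]
    intro hd
    have := Nat.le_of_dvd (by omega) hd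
    omega
  rw [← aux_geom h z hzh hz1]
  refine Finset.sum_bij (fun j _ => j % h) ?_ ?_ ?_ ?_
  · intro j _; exact Finset.mem_range.2 (Nat.mod_lt _ hh)
  · intro a ha b hb hab
    exact (hHres (b % h) (Nat.mod_lt _ hh)).unique ⟨ha, hab⟩ ⟨hb, rfl⟩
  · intro r hr
    obtain ⟨j, ⟨hj, hjr⟩, _⟩ := hHres r (Finset.mem_range.1 hr)
    exact ⟨j, hj, hjr⟩
  · intro j _
    have : ζ ^ (-((j : ℤ) * ((2 * i : ℕ) : ℤ))) = z ^ j := by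
      rw [hz, ← zpow_natCast, ← zpow_mul]; congr 1; ring
    rw [this]
    conv_lhs => rw [← Nat.mod_add_div j h, pow_add, pow_mul, hzh, one_pow, mul_one]

lemma aux_cyc {F2 : Type} [Field F2] (ω : F2ˣ) (hω : ∀ x : F2ˣ, x ∈ Subgroup.zpowers ω) (e : ℕ)
    (χ : MulChar F2 ℂ) (ζ : ℂ) (hζ : IsPrimitiveRoot ζ e) (he : e ≠ 0) (hχω : χ (ω : F2) = ζ)
    (x : F2) (hx : x ≠ 0) (j : ℤ) : x ∈ cyc ω e j ↔ χ x = ζ ^ j := by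
  have hz0 : ζ ≠ 0 := hζ.ne_zero he
  have hpow : ∀ k : ℤ, χ ((ω ^ k : F2ˣ) : F2) = ζ ^ k := by
    intro k
    rw [← hχω, ← MulChar.coe_toUnitHom, ← MulChar.coe_toUnitHom, map_zpow, Units.val_zpow_eq_zpow_val]
  constructor
  · rintro ⟨k, rfl⟩
    rw [hpow, zpow_add₀ hz0, zpow_mul, zpow_natCast, hζ.pow_eq_one, one_zpow, mul_one]
  · intro h
    obtain ⟨k, hk⟩ := hω (Units.mk0 x hx)
    have hk' : x = ((ω ^ k : F2ˣ) : F2) := by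
      simp only at hk
      rw [hk]; rfl
    rw [hk', hpow] at h
    have : ζ ^ (k - j) = 1 := by rw [zpow_sub₀ hz0, h, div_self (zpow_ne_zero _ hz0)]
    rw [hζ.zpow_eq_one_iff_dvd] at this
    obtain ⟨t, ht⟩ := this
    refine ⟨t, ?_⟩
    rw [hk']
    congr 2
    linarith

lemma aux_ind (e : ℕ) (he : e ≠ 0) (ζ : ℂ) (hζ : IsPrimitiveRoot ζ e) (H : Finset ℕ)
    (hH : H ⊆ Finset.range e) (c : ℂ) (hc : c ^ e = 1) :
    ∑ m ∈ Finset.range e, (∑ j ∈ H, ζ ^ (-((j : ℤ) * (m : ℤ)))) * c ^ m =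
      if ∃ j ∈ H, c = ζ ^ (j : ℤ) then (e : ℂ) else 0 := by
  have hz0 : ζ ≠ 0 := hζ.ne_zero he
  have h1 : ∀ j : ℕ, ∑ m ∈ Finset.range e, ζ ^ (-((j : ℤ) * (m : ℤ))) * c ^ m =
      if c = ζ ^ (j : ℤ) then (e : ℂ) else 0 := by
    intro j
    have h2 : ∀ m : ℕ, ζ ^ (-((j : ℤ) * (m : ℤ))) * c ^ m = (c / ζ ^ j) ^ m := by
      intro m
      rw [div_pow, zpow_neg, zpow_mul, zpow_natCast, zpow_natCast]; field_simp
    simp only [h2]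
    split_ifs with h
    · rw [h, zpow_natCast, div_self (pow_ne_zero _ hz0)]; simp
    · apply aux_geom
      · rw [div_pow, hc, ← pow_mul, mul_comm, pow_mul, hζ.pow_eq_one]; simp
      · intro h3
        apply h
        rw [zpow_natCast]
        exact (div_eq_one_iff_eq (pow_ne_zero _ hz0)).1 h3
  simp only [Finset.sum_mul]
  rw [Finset.sum_comm]
  simp only [h1]
  split_ifs with h
  · obtain ⟨j, hj, rfl⟩ := h
    rw [Finset.sum_eq_single_of_mem j hj]
    · simp
    · intro b hb hbj
      rw [if_neg]
      intro h
      rw [zpow_natCast, zpow_natCast] at h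
      exact hbj (hζ.pow_inj (Finset.mem_range.1 (hH hj)) (Finset.mem_range.1 (hH hb)) h).symm
  · refine Finset.sum_eq_zero fun j hj => if_neg fun h' => h ⟨j, hj, h'⟩


/-- the size of `D_{ℓ,H}` expressed via Gauss sums
(Proposition 3.3 of the paper). -/
theorem stmt_5 (q e : ℕ) (hq : IsPrimePow q) (hqodd : Odd q)
    (he : e ∣ q ^ 2 - 1) (heven : Even e)
    (F F2 : Type) [Field F] [Fintype F] [Field F2] [Fintype F2] [Algebra F F2]
    (hF : Fintype.card F = q) (hF2 : Fintype.card F2 = q ^ 2)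
    (ω : F2ˣ) (hω : ∀ x : F2ˣ, x ∈ Subgroup.zpowers ω)
    (ψ : AddChar F ℂ) (hψ : ∃ a, ψ a ≠ 1)
    (tr : F2 → F) (htr : ∀ x : F2, algebraMap F F2 (tr x) = x + x ^ q)
    (χ : MulChar F2 ℂ)
    (hχω : χ (ω : F2) = Complex.exp (2 * Real.pi * Complex.I / e))
    (hχη : ∀ x : F, x ≠ 0 → χ (algebraMap F F2 x) = quadChar F x)
    (ℓ : ℤ) (hℓ : ¬ ((q : ℤ) + 1 ∣ ℓ))
    (H : Finset ℕ) (hHsub : H ⊆ Finset.range e) (hHcard : H.card = e / 2)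
    (hHres : ∀ r < e / 2, ∃! j, j ∈ H ∧ j % (e / 2) = r)
    (A : ℕ → ℂ)
    (hA : ∀ i : ℕ, A i = ∑ j ∈ H, Complex.exp (2 * Real.pi * Complex.I / e) ^ (-((j : ℤ) * (i : ℤ))))
    (g : ℕ → ℂ) (hg : ∀ n : ℕ, g n = ∑ y : F2, (χ y) ^ n * ψ (tr y))
    (D : Set F)
    (hD : D = {x : F | ∃ i ∈ H, (1 + algebraMap F F2 x * ((ω ^ ℓ : F2ˣ) : F2)) ∈ cyc ω e (i : ℤ)}) :
    (D.ncard : ℂ) =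
      (q : ℂ) / 2 + (χ (-1) * (∑ x : F, quadChar F x * ψ x) / ((e : ℂ) * q)) *
        ∑ i ∈ Finset.range (e / 2),
          A (2 * i + 1) * g (2 * i + 1) *
            (χ ((((ω ^ ((q : ℤ) * ℓ) : F2ˣ) : F2))⁻¹)) ^ (2 * i + 1) *
            (χ (((ω ^ (ℓ * (q : ℤ)) : F2ˣ) : F2) - ((ω ^ ℓ : F2ˣ) : F2))) ^ (2 * i + 1) := by
  obtain ⟨h, hh⟩ := heven
  rw [← two_mul] at hh
  subst hF
  set q := Fintype.card F with hq'
  have hq1 : 1 < q := Fintype.one_lt_card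
  have he0 : e ≠ 0 := by
    rintro rfl
    have h1 := zero_dvd_iff.1 he
    have h2 : 1 < q ^ 2 := Nat.one_lt_pow two_ne_zero hq1
    omega
  have hh0 : 0 < h := by omega
  have heh : e / 2 = h := by omega
  rw [heh] at hHcard hHres ⊢
  have hζ := Complex.isPrimitiveRoot_exp e he0
  set ζ := Complex.exp (2 * Real.pi * Complex.I / e) with hζdef
  -- the quadratic character
  have hchar : ringChar F ≠ 2 := by
    intro h2
    have := FiniteField.even_card_of_char_two h2
    rw [Nat.odd_iff] at hqodd
    omega
  let η : MulChar F ℂ := (quadraticChar F).ringHomComp (Int.castRingHom ℂ)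
  have hηquad : η.IsQuadratic := (quadraticChar_isQuadratic F).comp _
  have hη1 : η ≠ 1 :=
    (MulChar.ringHomComp_ne_one_iff (Int.cast_injective)).2 (quadraticChar_ne_one hchar)
  have hηx : ∀ x, quadChar F x = η x := by
    intro x
    simp only [η, quadChar, MulChar.ringHomComp_apply, quadraticChar_apply, quadraticCharFun]
    split_ifs <;> simp
  have hχη' : ∀ x, χ (algebraMap F F2 x) = η x := by
    intro x
    by_cases hx : x = 0
    · subst hx
      rw [map_zero, MulChar.map_zero, MulChar.map_zero]
    · rw [hχη x hx, hηx]
  have hψ1 : ψ ≠ 1 := by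
    rintro rfl
    obtain ⟨a, ha⟩ := hψ
    exact ha rfl
  have hGs : ∑ x : F, quadChar F x * ψ x = gaussSum η ψ := by
    simp only [hηx]; rfl
  set w : F2 := ((ω ^ ℓ : F2ˣ) : F2) with hw
  have hwq : ((ω ^ ((q : ℤ) * ℓ) : F2ˣ) : F2) = w ^ q := by
    rw [hw, mul_comm, zpow_mul, zpow_natCast, Units.val_pow_eq_pow_val]
  have hwq2 : ((ω ^ (ℓ * (q : ℤ)) : F2ˣ) : F2) = w ^ q := by
    rw [← hwq, mul_comm]
  rw [hwq, hwq2, hGs]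
  have hδ : w ^ q - w ≠ 0 := by
    intro h0
    rw [sub_eq_zero, ← hwq, hw, Units.val_inj] at h0
    have h1 : ω ^ (((q : ℤ) - 1) * ℓ) = 1 := by
      rw [sub_mul, one_mul, zpow_sub, h0, mul_inv_cancel]
    rw [← orderOf_dvd_iff_zpow_eq_one, orderOf_eq_card_of_forall_mem_zpowers hω,
      Nat.card_eq_fintype_card, Fintype.card_units, hF2] at h1
    have h2 : ((q ^ 2 - 1 : ℕ) : ℤ) = ((q : ℤ) - 1) * (q + 1) := by
      rw [Nat.cast_sub (Nat.one_le_pow _ _ (by omega))]; push_cast; ring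
    rw [h2] at h1
    exact hℓ (Int.dvd_of_mul_dvd_mul_left (by omega) h1)
  have hne : ∀ x : F, 1 + algebraMap F F2 x * w ≠ 0 := by
    intro x h0
    have hx : algebraMap F F2 x ≠ 0 := by
      intro hx; rw [hx] at h0; simp at h0
    apply hδ
    have h1 := congrArg (FiniteField.frobeniusAlgHom F F2) h0
    rw [map_add, map_mul, map_one, AlgHom.commutes, map_zero] at h1
    have h2 : FiniteField.frobeniusAlgHom F F2 w = w ^ q := rfl
    rw [h2] at h1
    apply mul_left_cancel₀ hx
    linear_combination h1 - h0
  have hpe : ∀ z : F2, z ≠ 0 → χ z ^ e = 1 := by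
    intro z hz
    obtain ⟨k, hk⟩ := hω (Units.mk0 z hz)
    have h1 := (aux_cyc ω hω e χ ζ hζ he0 hχω z hz k).1 ⟨0, by
      simp only [mul_zero, add_zero] at hk ⊢
      rw [hk]; rfl⟩
    rw [h1, ← zpow_natCast, ← zpow_mul, mul_comm, zpow_mul, zpow_natCast, hζ.pow_eq_one, one_zpow]
  -- counting
  have hcount : (D.ncard : ℂ) * e = ∑ x : F, ∑ m ∈ Finset.range e,
      A m * χ (1 + algebraMap F F2 x * w) ^ m := by
    have h1 : ∀ x : F, ∑ m ∈ Finset.range e, A m * χ (1 + algebraMap F F2 x * w) ^ m =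
        if x ∈ D then (e : ℂ) else 0 := by
      intro x
      simp only [hA]
      rw [aux_ind e he0 ζ hζ H hHsub _ (hpe _ (hne x)), hD]
      simp only [Set.mem_ofPred_eq, aux_cyc ω hω e χ ζ hζ he0 hχω _ (hne x)]
    simp only [h1]
    rw [← Finset.sum_filter, Finset.sum_const, nsmul_eq_mul, Set.ncard_eq_toFinset_card']
    congr 3
    ext; simp
  have hA0 : A 0 = h := by
    rw [hA]; simp [hHcard]
  rw [Finset.sum_comm] at hcount
  simp only [← Finset.mul_sum] at hcount
  rw [hh, aux_split_s5, ← hh] at hcount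
  rw [Finset.sum_eq_single_of_mem 0 (Finset.mem_range.2 hh0)] at hcount
  swap
  · intro i hi hi0
    have hζ' := hζ
    rw [hh] at hζ'
    rw [hA, aux_A h hh0 ζ hζ' H hHres i hi0 (Finset.mem_range.1 hi), zero_mul]
  have hS : ∀ i : ℕ, ∑ x : F, χ (1 + algebraMap F F2 x * w) ^ (2 * i + 1) =
      χ (-1) * gaussSum η ψ / (q : ℂ) * (g (2 * i + 1) * χ ((w ^ q)⁻¹) ^ (2 * i + 1) *
        χ (w ^ q - w) ^ (2 * i + 1)) := by
    intro i
    have hodd : (2 * i + 1) ≠ 0 := by omega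
    have hpowη : ∀ x, η x ^ (2 * i + 1) = η x := by
      intro x
      rcases hηquad x with h | h | h <;> rw [h] <;> simp [pow_succ, pow_mul]
    have hm1 : χ (-1) = (χ ^ (2 * i + 1)) (-1) := by
      have h1 : χ (-1) = η (-1) := by rw [← hχη']; simp
      rw [MulChar.pow_apply' _ hodd, h1, hpowη]
    rw [hg, hm1]
    simp only [← MulChar.pow_apply' _ hodd]
    apply aux_gauss F F2 hF2 ψ hψ1 tr htr η hη1 hηquad (χ ^ (2 * i + 1)) _ w hδ
    intro x
    rw [MulChar.pow_apply' _ hodd, hχη', hpowη]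
  simp only [hS] at hcount
  have he0' : (e : ℂ) ≠ 0 := by exact_mod_cast he0
  have hq0' : (q : ℂ) ≠ 0 := by
    have : q ≠ 0 := by omega
    exact_mod_cast this
  have hh' : (e : ℂ) = 2 * h := by rw [hh]; push_cast; ring
  simp only [mul_zero, pow_zero, Finset.sum_const, Finset.card_univ, nsmul_eq_mul, mul_one, hA0]
    at hcount
  rw [← hq'] at hcount
  apply mul_right_cancel₀ he0'
  rw [hcount, add_mul]
  congr 1
  · rw [hh']; ring
  · rw [Finset.mul_sum, Finset.sum_mul]
    refine Finset.sum_congr rfl fun i _ => ?_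
    field_simp
end
end

section
/- Let q be an odd prime power, e an even divisor of q²−1, and χ_e a multiplicative character of F_{q²} with χ_e(ω) = ζ_e := exp(2πi/e) whose restriction to F_q^× equals the quadratic character η of F_q. Let ℓ be an integer not divisible by q+1, and let H be a subset of {0,1,…,e−1} of size e/2 containing exactly one element of each residue class modulo e/2. For s ∈ F_q let N_s := |D_{ℓ,H} ∩ (C_0^{(2,q)} + s)|. Then, as an identity in ℂ, N_s = (q−1)/4 − (1/(2e)) · ∑_{i=0}^{e/2−1} A_{2i+1} · (χ_e^{2i+1}(1 + ω^ℓ·s) + χ_e^{2i+1}(ω^ℓ)) + (G_q(η)/(2eq)) · ∑_{i=0}^{e/2−1} A_{2i+1} · G_{q²}(χ_e^{2i+1}) · χ_e^{2i+1}(ω^{ℓq} − ω^ℓ) · (χ_e^{−(2i+1)}(1 + ω^{qℓ}·s) + χ_e^{−(2i+1)}(−ω^{qℓ})), where A_i := ∑_{j∈H} ζ_e^{−ji}. -/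
noncomputable section

open Complex

open scoped Classical

def etaC (F : Type) [Field F] [Fintype F] : MulChar F ℂ :=
  (quadraticChar F).ringHomComp (Int.castRingHom ℂ)

lemma etaC_eq (F : Type) [Field F] [Fintype F] (x : F) : quadChar F x = etaC F x := by
  simp only [quadChar, etaC, MulChar.ringHomComp_apply, quadraticChar_apply, quadraticCharFun]
  split_ifs <;> simp

lemma ringChar_ne (F : Type) [Field F] [Fintype F] (h : Odd (Fintype.card F)) :
    ringChar F ≠ 2 := by
  intro h2
  have := FiniteField.even_card_of_char_two h2
  have := Nat.odd_iff.mp h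
  omega

lemma etaC_ne_one (F : Type) [Field F] [Fintype F] (h : Odd (Fintype.card F)) :
    etaC F ≠ 1 :=
  (MulChar.ringHomComp_ne_one_iff (RingHom.injective_int _)).mpr
    (quadraticChar_ne_one (ringChar_ne F h))

lemma etaC_quad (F : Type) [Field F] [Fintype F] : (etaC F).IsQuadratic :=
  (quadraticChar_isQuadratic F).comp _

lemma etaC_gauss (F : Type) [Field F] [Fintype F] (h : Odd (Fintype.card F)) (ψ : AddChar F ℂ)
    (t : F) : ∑ c : F, etaC F c * ψ (c * t) = etaC F t * gaussSum (etaC F) ψ := by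
  by_cases ht : t = 0
  · subst ht
    simp [MulChar.sum_eq_zero_of_ne_one (etaC_ne_one F h)]
    exact Or.inl (MulChar.map_zero _)
  · have := gaussSum_mulShift_eq (etaC F) ψ (Units.mk0 t ht)
    rw [(etaC_quad F).inv] at this
    simp only [gaussSum, AddChar.mulShift_apply, Units.val_mk0] at this
    simp only [gaussSum]
    rw [← this]
    simp [mul_comm]

section
variable (F F2 : Type) [Field F] [Fintype F] [Field F2] [Fintype F2] [Algebra F F2]

lemma pair_bij (hc : Fintype.card F2 = Fintype.card F ^ 2) (θ : F2)
    (hθ : ∀ c : F, algebraMap F F2 c ≠ θ) :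
    Function.Bijective (fun p : F × F => algebraMap F F2 p.1 + algebraMap F F2 p.2 * θ) := by
  rw [Fintype.bijective_iff_injective_and_card]
  refine ⟨?_, by rw [Fintype.card_prod, hc, sq]⟩
  rintro ⟨a, b⟩ ⟨c, d⟩ h
  simp only at h
  have hbd : b = d := by
    by_contra hne
    have hne' : algebraMap F F2 b - algebraMap F F2 d ≠ 0 := by
      rw [← map_sub]; simpa [sub_eq_zero] using hne
    apply hθ ((c - a) / (b - d))
    rw [map_div₀, map_sub, map_sub, div_eq_iff hne']
    linear_combination -h
  subst hbd
  have : a = c := (algebraMap F F2).injective (by linear_combination h)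
  rw [this]

lemma key (hodd : Odd (Fintype.card F)) (hc : Fintype.card F2 = Fintype.card F ^ 2) (θ : F2)
    (hθ : ∀ c : F, algebraMap F F2 c ≠ θ) (ψ : AddChar F ℂ) (X : MulChar F2 ℂ)
    (hX : ∀ c : F, X (algebraMap F F2 c) = etaC F c)
    (tr : F2 → F) (htr : ∀ x : F2, algebraMap F F2 (tr x) = x + x ^ (Fintype.card F))
    (a : F2) (t0 t1 : F) (h0 : tr a = t0) (h1 : tr (a * θ) = t1) (ha : a ≠ 0) :
    X a⁻¹ * ∑ y : F2, X y * ψ (tr y) = gaussSum (etaC F) ψ *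
      (∑ x : F, X (1 + algebraMap F F2 x * θ) * etaC F (t0 + x * t1) + X θ * etaC F t1) := by
  have hlin : ∀ c d : F, tr (a * (algebraMap F F2 c + algebraMap F F2 d * θ)) = c * t0 + d * t1 := by
    intro c d
    apply (algebraMap F F2).injective
    rw [htr, map_add, map_mul, map_mul, ← h0, ← h1, htr, htr]
    have e1 : (a * (algebraMap F F2 c + algebraMap F F2 d * θ)) ^ Fintype.card F
      = a ^ Fintype.card F * (algebraMap F F2 c + algebraMap F F2 d * θ ^ Fintype.card F) := by
      have := map_mul (FiniteField.frobeniusAlgHom F F2) a (algebraMap F F2 c + algebraMap F F2 d * θ)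
      rw [map_add, map_mul _ (algebraMap F F2 d), AlgHom.commutes, AlgHom.commutes] at this
      simpa [FiniteField.coe_frobeniusAlgHom] using this
    rw [e1, mul_pow]; ring
  have s1 : X a⁻¹ * ∑ y : F2, X y * ψ (tr y) = ∑ y : F2, X y * ψ (tr (a * y)) := by
    rw [← Equiv.sum_comp (Equiv.mulLeft₀ a ha), Finset.mul_sum]
    refine Finset.sum_congr rfl fun y _ => ?_
    simp only [Equiv.mulLeft₀_apply]
    rw [← mul_assoc, ← map_mul, inv_mul_cancel_left₀ ha]
  rw [s1, ← (pair_bij F F2 hc θ hθ).sum_comp, Fintype.sum_prod_type]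
  have s2 : ∀ c : F, ∑ d : F, X (algebraMap F F2 c + algebraMap F F2 d * θ) *
      ψ (tr (a * (algebraMap F F2 c + algebraMap F F2 d * θ))) =
      ∑ x : F, etaC F c * X (1 + algebraMap F F2 x * θ) * ψ (c * (t0 + x * t1)) +
      if c = 0 then ∑ d : F, etaC F d * X θ * ψ (d * t1) else 0 := by
    intro c
    by_cases hc0 : c = 0
    · subst hc0
      simp [hX, MulChar.map_zero]
      refine Finset.sum_congr rfl fun d _ => ?_
      have := hlin 0 d
      simp at this
      rw [this]
    · rw [if_neg hc0, add_zero, ← Equiv.sum_comp (Equiv.mulLeft₀ c hc0)]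
      refine Finset.sum_congr rfl fun x _ => ?_
      simp only [Equiv.mulLeft₀_apply]
      rw [hlin, ← hX, ← map_mul, map_mul (algebraMap F F2)]
      congr 2 <;> ring
  simp only [s2]
  rw [Finset.sum_add_distrib, Finset.sum_ite_eq' , if_pos (Finset.mem_univ _), Finset.sum_comm, mul_add,
    Finset.mul_sum]
  congr 1
  · refine Finset.sum_congr rfl fun x _ => ?_
    have := etaC_gauss F hodd ψ (t0 + x * t1)
    calc _ = X (1 + algebraMap F F2 x * θ) * ∑ c : F, etaC F c * ψ (c * (t0 + x * t1)) := by
          rw [Finset.mul_sum]; refine Finset.sum_congr rfl fun c _ => ?_; ring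
      _ = _ := by rw [this]; ring
  · have := etaC_gauss F hodd ψ t1
    calc _ = X θ * ∑ c : F, etaC F c * ψ (c * t1) := by
          rw [Finset.mul_sum]; refine Finset.sum_congr rfl fun c _ => ?_; ring
      _ = _ := by rw [this]; ring

lemma key2 (hodd : Odd (Fintype.card F)) (hc : Fintype.card F2 = Fintype.card F ^ 2) (θ : F2)
    (hθ : ∀ c : F, algebraMap F F2 c ≠ θ) (hθ2 : θ ^ Fintype.card F ≠ θ)
    (ψ : AddChar F ℂ) (hψ : ψ ≠ 1) (X : MulChar F2 ℂ)
    (hX : ∀ c : F, X (algebraMap F F2 c) = etaC F c)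
    (tr : F2 → F) (htr : ∀ x : F2, algebraMap F F2 (tr x) = x + x ^ (Fintype.card F)) (s : F) :
    ∑ x : F, X (1 + algebraMap F F2 x * θ) * (1 + etaC F (x - s)) =
      - X θ + gaussSum (etaC F) ψ / (Fintype.card F) * (∑ y : F2, X y * ψ (tr y)) *
        X (θ ^ Fintype.card F - θ) * (X (1 + θ ^ Fintype.card F * algebraMap F F2 s)⁻¹
          + X (- θ ^ Fintype.card F)⁻¹) := by
  set G := gaussSum (etaC F) ψ with hG
  set g := ∑ y : F2, X y * ψ (tr y) with hg
  set τ := θ ^ Fintype.card F with hτ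
  have hqq : τ ^ Fintype.card F = θ := by
    rw [hτ, ← pow_mul, ← sq, ← hc, FiniteField.pow_card]
  have hδ : θ - τ ≠ 0 := sub_ne_zero.mpr (Ne.symm hθ2)
  have hθ0 : θ ≠ 0 := by intro h; exact hθ 0 (by simp [h])
  have hτ0 : τ ≠ 0 := pow_ne_zero _ hθ0
  have frob_s : ∀ c : F, algebraMap F F2 c ^ Fintype.card F = algebraMap F F2 c := by
    intro c; rw [← map_pow, FiniteField.pow_card]
  have frob : ∀ x y : F2, (x + y) ^ Fintype.card F = x ^ Fintype.card F + y ^ Fintype.card F :=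
    fun x y => map_add (FiniteField.frobeniusAlgHom F F2) x y
  have frobs : ∀ x y : F2, (x - y) ^ Fintype.card F = x ^ Fintype.card F - y ^ Fintype.card F :=
    fun x y => map_sub (FiniteField.frobeniusAlgHom F F2) x y
  have hs0 : 1 + τ * algebraMap F F2 s ≠ 0 := by
    intro h
    have h' : (1 + τ * algebraMap F F2 s) ^ Fintype.card F = 0 := by
      rw [h]; exact zero_pow Fintype.card_ne_zero
    rw [frob, mul_pow, hqq, frob_s, one_pow] at h'
    by_cases hs : s = 0
    · simp [hs] at h'
    · apply hθ (-s⁻¹)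
      have : algebraMap F F2 s ≠ 0 := by simpa using hs
      rw [map_neg, map_inv₀]
      field_simp
      linear_combination -h'
  have hmτ : (-τ) ^ Fintype.card F = -θ := by
    have := map_neg (FiniteField.frobeniusAlgHom F F2) τ
    simp only [FiniteField.coe_frobeniusAlgHom] at this
    rw [this, hqq]
  have hδ' : τ - θ ≠ 0 := sub_ne_zero.mpr hθ2
  have k1 := key F F2 hodd hc θ hθ ψ X hX tr htr ((1 + τ * algebraMap F F2 s) / (θ - τ)) (-s) 1
    (by
      apply (algebraMap F F2).injective
      rw [htr, div_pow, frobs, frob, mul_pow, hqq, frob_s, one_pow, ← hτ, map_neg]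
      rw [← neg_sub θ τ, div_neg, ← sub_eq_add_neg, ← sub_div, div_eq_iff hδ]
      ring)
    (by
      apply (algebraMap F F2).injective
      rw [htr, mul_pow, div_pow, frobs, frob, mul_pow, hqq, frob_s, one_pow, ← hτ, map_one]
      rw [← neg_sub θ τ, div_neg]
      field_simp
      ring) (div_ne_zero hs0 hδ)
  have k2 := key F F2 hodd hc θ hθ ψ X hX tr htr ((-τ) / (θ - τ)) 1 0
    (by
      apply (algebraMap F F2).injective
      rw [htr, div_pow, frobs, hmτ, hqq, ← hτ, map_one]
      rw [← neg_sub θ τ, div_neg]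
      field_simp
      ring)
    (by
      apply (algebraMap F F2).injective
      rw [htr, mul_pow, div_pow, frobs, hmτ, hqq, ← hτ, map_zero]
      rw [← neg_sub θ τ, div_neg]
      field_simp
      ring) (div_ne_zero (neg_ne_zero.mpr hτ0) hδ)
  have hGsq : G ^ 2 = etaC F (-1) * Fintype.card F :=
    gaussSum_sq (etaC_ne_one F hodd) (etaC_quad F) (AddChar.IsPrimitive.of_ne_one hψ)
  have hq0 : (Fintype.card F : ℂ) ≠ 0 := by simp
  have hm1 : etaC F (-1) * etaC F (-1) = 1 := by rw [← map_mul]; simp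
  have hXδ : X (θ - τ) = etaC F (-1) * X (τ - θ) := by
    rw [← hX, ← map_mul]; congr 1; simp
  have i1 : X ((1 + τ * algebraMap F F2 s) / (θ - τ))⁻¹ =
      etaC F (-1) * X (τ - θ) * X (1 + τ * algebraMap F F2 s)⁻¹ := by
    rw [← hXδ, ← map_mul, inv_div, div_eq_mul_inv]
  have i2 : X ((-τ) / (θ - τ))⁻¹ =
      etaC F (-1) * X (τ - θ) * X (-τ)⁻¹ := by
    rw [← hXδ, ← map_mul, inv_div, div_eq_mul_inv]
  rw [i1, ← hg, ← hG] at k1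
  rw [i2, ← hg, ← hG] at k2
  have e1 : ∑ x : F, X (1 + algebraMap F F2 x * θ) * etaC F (-s + x * 1) =
      ∑ x : F, X (1 + algebraMap F F2 x * θ) * etaC F (x - s) := by
    refine Finset.sum_congr rfl fun x _ => ?_
    congr 2; ring
  rw [e1, map_one, mul_one] at k1
  simp only [mul_zero, add_zero, map_one, mul_one, MulChar.map_zero] at k2
  simp only [mul_add, mul_one, Finset.sum_add_distrib]
  set S1 := ∑ x : F, X (1 + algebraMap F F2 x * θ) * etaC F (x - s)
  set S2 := ∑ x : F, X (1 + algebraMap F F2 x * θ)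
  have hne : etaC F (-1) ≠ 0 := left_ne_zero_of_mul_eq_one hm1
  generalize X (1 + τ * algebraMap F F2 s)⁻¹ = u1 at *
  generalize X (-τ)⁻¹ = u2 at *
  field_simp
  have hsq' : etaC F (-1) * G ^ 2 = Fintype.card F := by
    rw [hGsq, ← mul_assoc, hm1, one_mul]
  rw [← hsq']
  linear_combination (-G * etaC F (-1)) * (k1 + k2) + G * g * X (τ - θ) * (u1 + u2) * hm1
end

lemma geo_odd (h : ℕ) (z : ℂ) (hz : z ^ (2 * h) = 1) :
    ∑ i ∈ Finset.range h, z ^ (2 * i + 1) = if z = 1 then (h : ℂ) else if z = -1 then -h else 0 := by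
  split_ifs with h1 h2
  · simp [h1]
  · subst h2
    simp [pow_succ, pow_mul]
  · have hne : z ^ 2 ≠ 1 := by
      intro h; rcases sq_eq_one_iff.mp h with h | h
      · exact h1 h
      · exact h2 h
    simp only [pow_succ z (2 * _), pow_mul]
    rw [← Finset.sum_mul, geom_sum_eq hne, ← pow_mul, hz]
    simp

lemma ind_sum (h : ℕ) (hh : 0 < h) (ζ : ℂ) (hζ : IsPrimitiveRoot ζ (2 * h)) (H : Finset ℕ)
    (hHsub : H ⊆ Finset.range (2 * h))
    (hHres : ∀ r < h, ∃! j, j ∈ H ∧ j % h = r) (m : ℤ) :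
    ∑ i ∈ Finset.range h, (∑ j ∈ H, ζ ^ (-((j : ℤ) * ((2 * i + 1 : ℕ) : ℤ)))) * (ζ ^ m) ^ (2 * i + 1)
      = if ∃ j ∈ H, ((2 : ℤ) * h) ∣ m - j then (h : ℂ) else -h := by
  have hζ0 : ζ ≠ 0 := hζ.ne_zero (by omega)
  have hhz : (0 : ℤ) < h := by exact_mod_cast hh
  have hone : ∀ n : ℤ, ζ ^ n = 1 ↔ (2 * h : ℤ) ∣ n := by
    intro n; rw [hζ.zpow_eq_one_iff_dvd]; simp
  have hzh : ζ ^ h = -1 := by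
    have h1 : (ζ ^ h) ^ 2 = 1 := by rw [← pow_mul, mul_comm, hζ.pow_eq_one]
    rcases sq_eq_one_iff.mp h1 with h2 | h2
    · have := hζ.dvd_of_pow_eq_one h h2
      have := Nat.le_of_dvd hh this
      omega
    · exact h2
  have hneg : ∀ n : ℤ, ζ ^ n = -1 ↔ (2 * h : ℤ) ∣ n - h := by
    intro n
    rw [← hone, zpow_sub₀ hζ0, zpow_natCast, hzh, div_neg, div_one, neg_eq_iff_eq_neg]
  have hsum : ∑ i ∈ Finset.range h, (∑ j ∈ H, ζ ^ (-((j : ℤ) * ((2 * i + 1 : ℕ) : ℤ)))) *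
      (ζ ^ m) ^ (2 * i + 1) = ∑ j ∈ H, ∑ i ∈ Finset.range h, (ζ ^ (m - j)) ^ (2 * i + 1) := by
    rw [Finset.sum_comm]
    refine Finset.sum_congr rfl fun i _ => ?_
    rw [Finset.sum_mul]
    refine Finset.sum_congr rfl fun j _ => ?_
    rw [← zpow_natCast, ← zpow_natCast, ← zpow_mul, ← zpow_mul, ← zpow_add₀ hζ0]
    congr 1; ring
  rw [hsum]
  have hgeo : ∀ j ∈ H, ∑ i ∈ Finset.range h, (ζ ^ (m - j)) ^ (2 * i + 1) =
      if (2 * h : ℤ) ∣ m - j then (h : ℂ) else if (2 * h : ℤ) ∣ m - j - h then -h else 0 := by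
    intro j _
    rw [geo_odd]
    · simp only [hone, hneg]
    · rw [← zpow_natCast, ← zpow_mul, hone]; simp
  rw [Finset.sum_congr rfl hgeo]
  obtain ⟨j0, ⟨hj0, hj0r⟩, huniq⟩ := hHres (m % h).toNat (by
    have := Int.emod_lt_of_pos m hhz
    have := Int.emod_nonneg m hhz.ne'
    omega)
  have hmod : ∀ j : ℕ, (h : ℤ) ∣ m - j ↔ j % h = (m % h).toNat := by
    intro j
    have := Int.emod_nonneg m hhz.ne'
    rw [← Int.emod_eq_emod_iff_emod_sub_eq_zero.trans (Int.dvd_iff_emod_eq_zero).symm]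
    zify
    rw [Int.toNat_of_nonneg this]
    exact eq_comm
  have hj0d : (h : ℤ) ∣ m - j0 := (hmod j0).mpr hj0r
  have hother : ∀ j ∈ H, j ≠ j0 → ¬ (h : ℤ) ∣ m - j := by
    intro j hj hne hd
    exact hne (huniq j ⟨hj, (hmod j).mp hd⟩)
  rw [Finset.sum_eq_single j0]
  · by_cases hd : (2 * h : ℤ) ∣ m - j0
    · rw [if_pos hd, if_pos ⟨j0, hj0, hd⟩]
    · have hd2 : (2 * h : ℤ) ∣ m - j0 - h := by
        obtain ⟨k, hk⟩ := hj0d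
        rcases Int.even_or_odd' k with ⟨c, hc | hc⟩
        · exact absurd ⟨c, by rw [hk, hc]; ring⟩ hd
        · exact ⟨c, by rw [hk, hc]; ring⟩
      rw [if_neg hd, if_pos hd2, if_neg]
      rintro ⟨j, hj, hjd⟩
      by_cases hjj : j = j0
      · exact hd (hjj ▸ hjd)
      · exact hother j hj hjj ((Dvd.intro_left 2 rfl).trans hjd)
  · intro j hj hne
    have := hother j hj hne
    rw [if_neg, if_neg]
    · intro hd
      apply this
      have := dvd_add ((Dvd.intro_left (2:ℤ) rfl).trans hd) (dvd_refl (h : ℤ))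
      simpa using this
    · intro hd; exact this ((Dvd.intro_left 2 rfl).trans hd)
  · intro h; exact absurd hj0 h

/-- the size of `D_{ℓ,H} ∩ (C_0^{(2,q)} + s)` expressed via Gauss sums
(Proposition 3.5 of the paper). -/
theorem stmt_7 (q e : ℕ) (hq : IsPrimePow q) (hqodd : Odd q)
    (he : e ∣ q ^ 2 - 1) (heven : Even e)
    (F F2 : Type) [Field F] [Fintype F] [Field F2] [Fintype F2] [Algebra F F2]
    (hF : Fintype.card F = q) (hF2 : Fintype.card F2 = q ^ 2)
    (ω : F2ˣ) (hω : ∀ x : F2ˣ, x ∈ Subgroup.zpowers ω)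
    (ψ : AddChar F ℂ) (hψ : ∃ a, ψ a ≠ 1)
    (tr : F2 → F) (htr : ∀ x : F2, algebraMap F F2 (tr x) = x + x ^ q)
    (χ : MulChar F2 ℂ)
    (hχω : χ (ω : F2) = Complex.exp (2 * Real.pi * Complex.I / e))
    (hχη : ∀ x : F, x ≠ 0 → χ (algebraMap F F2 x) = quadChar F x)
    (ℓ : ℤ) (hℓ : ¬ ((q : ℤ) + 1 ∣ ℓ))
    (H : Finset ℕ) (hHsub : H ⊆ Finset.range e) (hHcard : H.card = e / 2)
    (hHres : ∀ r < e / 2, ∃! j, j ∈ H ∧ j % (e / 2) = r)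
    (A : ℕ → ℂ)
    (hA : ∀ i : ℕ, A i = ∑ j ∈ H, Complex.exp (2 * Real.pi * Complex.I / e) ^ (-((j : ℤ) * (i : ℤ))))
    (g : ℕ → ℂ) (hg : ∀ n : ℕ, g n = ∑ y : F2, (χ y) ^ n * ψ (tr y))
    (C₀ : Set F) (hC₀ : C₀ = {x : F | x ≠ 0 ∧ IsSquare x})
    (D : Set F)
    (hD : D = {x : F | ∃ i ∈ H, (1 + algebraMap F F2 x * ((ω ^ ℓ : F2ˣ) : F2)) ∈ cyc ω e (i : ℤ)})
    (N : F → ℕ) (hN : ∀ s : F, N s = (D ∩ ((fun x => x + s) '' C₀)).ncard) :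
    ∀ s : F,
      (N s : ℂ) =
        ((q : ℂ) - 1) / 4 -
          (1 / (2 * (e : ℂ))) *
            ∑ i ∈ Finset.range (e / 2),
              A (2 * i + 1) *
                ((χ (1 + ((ω ^ ℓ : F2ˣ) : F2) * algebraMap F F2 s)) ^ (2 * i + 1) +
                  (χ ((ω ^ ℓ : F2ˣ) : F2)) ^ (2 * i + 1)) +
          ((∑ x : F, quadChar F x * ψ x) / (2 * (e : ℂ) * q)) *
            ∑ i ∈ Finset.range (e / 2),
              A (2 * i + 1) * g (2 * i + 1) *
                (χ (((ω ^ (ℓ * (q : ℤ)) : F2ˣ) : F2) - ((ω ^ ℓ : F2ˣ) : F2))) ^ (2 * i + 1) *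
                ((χ ((1 + ((ω ^ ((q : ℤ) * ℓ) : F2ˣ) : F2) * algebraMap F F2 s)⁻¹)) ^ (2 * i + 1) +
                  (χ ((-((ω ^ ((q : ℤ) * ℓ) : F2ˣ) : F2))⁻¹)) ^ (2 * i + 1)) := by
  intro s
  subst hF
  have hqpos : 1 < Fintype.card F := Fintype.one_lt_card
  have he0 : 0 < e := by
    rcases Nat.eq_zero_or_pos e with h | h
    · rw [h, zero_dvd_iff] at he
      have : 1 < Fintype.card F ^ 2 := Nat.one_lt_pow (by norm_num) hqpos
      omega
    · exact h
  obtain ⟨h, hh⟩ := heven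
  have heh : e = 2 * h := by omega
  have hh0 : 0 < h := by omega
  have hdiv : e / 2 = h := by omega
  have hord : orderOf ω = Fintype.card F ^ 2 - 1 := by
    rw [orderOf_eq_card_of_forall_mem_zpowers hω, Nat.card_units, Nat.card_eq_fintype_card, hF2]
  have hordz : (orderOf ω : ℤ) = (Fintype.card F : ℤ) ^ 2 - 1 := by
    rw [hord, Nat.cast_sub (Nat.one_le_pow _ _ (by omega))]; simp
  set ζ := Complex.exp (2 * Real.pi * Complex.I / e) with hζdef
  have hζ : IsPrimitiveRoot ζ e := Complex.isPrimitiveRoot_exp e he0.ne'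
  set θ : F2 := ((ω ^ ℓ : F2ˣ) : F2) with hθdef
  have hτ1 : ((ω ^ (ℓ * (Fintype.card F : ℤ)) : F2ˣ) : F2) = θ ^ Fintype.card F := by
    rw [zpow_mul, zpow_natCast, Units.val_pow_eq_pow_val]
  have hτ2 : ((ω ^ ((Fintype.card F : ℤ) * ℓ) : F2ˣ) : F2) = θ ^ Fintype.card F := by
    rw [mul_comm, hτ1]
  have hθ2 : θ ^ Fintype.card F ≠ θ := by
    intro hh
    rw [← hτ1, hθdef, Units.val_inj] at hh
    have h1 : ω ^ (ℓ * ((Fintype.card F : ℤ) - 1)) = 1 := by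
      rw [mul_sub, zpow_sub, hh, mul_one, mul_inv_cancel]
    rw [← orderOf_dvd_iff_zpow_eq_one, hordz] at h1
    apply hℓ
    have : ((Fintype.card F : ℤ) + 1) * ((Fintype.card F : ℤ) - 1) ∣ ℓ * ((Fintype.card F : ℤ) - 1) := by
      convert h1 using 1; ring
    exact Int.dvd_of_mul_dvd_mul_right (by omega) this
  have hθ : ∀ c : F, algebraMap F F2 c ≠ θ := by
    intro c hc
    apply hθ2
    rw [← hc, ← map_pow, FiniteField.pow_card]
  have hψ1 : ψ ≠ 1 := by
    obtain ⟨a, ha⟩ := hψ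
    intro h; apply ha; simp [h]
  have hx0 : ∀ x : F, 1 + algebraMap F F2 x * θ ≠ 0 := by
    intro x hx
    by_cases h0 : x = 0
    · simp [h0] at hx
    · apply hθ (-x⁻¹)
      have : algebraMap F F2 x ≠ 0 := by simpa using h0
      rw [map_neg, map_inv₀]
      field_simp
      linear_combination -hx
  have hX : ∀ i : ℕ, ∀ c : F, (χ ^ (2 * i + 1)) (algebraMap F F2 c) = etaC F c := by
    intro i c
    rw [MulChar.pow_apply' _ (by omega)]
    by_cases hc : c = 0
    · subst hc; rw [map_zero, MulChar.map_zero, MulChar.map_zero]; simp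
    · rw [hχη c hc, etaC_eq]
      rcases etaC_quad F c with h | h | h <;> rw [h]
      · simp
      · simp
      · rw [Odd.neg_one_pow ⟨i, rfl⟩]
  -- indicator of D
  have hDind : ∀ x : F, (if x ∈ D then (1 : ℂ) else 0) = 1 / 2 + 1 / e *
      ∑ i ∈ Finset.range h, A (2 * i + 1) * (χ ^ (2 * i + 1)) (1 + algebraMap F F2 x * θ) := by
    intro x
    obtain ⟨m, hm⟩ := Subgroup.mem_zpowers_iff.mp (hω (Units.mk0 _ (hx0 x)))
    have hm' : 1 + algebraMap F F2 x * θ = ((ω ^ m : F2ˣ) : F2) := by rw [hm]; rfl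
    have hmem : x ∈ D ↔ ∃ j ∈ H, (e : ℤ) ∣ m - j := by
      rw [hD, Set.mem_ofPred_eq, hm']
      refine exists_congr fun j => and_congr_right fun _ => ?_
      simp only [cyc, Set.mem_ofPred_eq, Units.val_inj]
      constructor
      · rintro ⟨k, hk⟩
        have h1 : ω ^ (m - (j + e * k)) = 1 := by rw [zpow_sub, hk, mul_inv_cancel]
        rw [← orderOf_dvd_iff_zpow_eq_one, hord] at h1
        have h2 : (e : ℤ) ∣ m - (j + e * k) := (Int.natCast_dvd_natCast.mpr he).trans h1
        have := dvd_add h2 (dvd_mul_right (e : ℤ) k)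
        rwa [show m - (j + e * k) + e * k = m - (j : ℤ) by ring] at this
      · rintro ⟨k, hk⟩
        exact ⟨k, by congr 1; linarith⟩
    have hχm : χ (1 + algebraMap F F2 x * θ) = ζ ^ m := by
      rw [hm', ← hχω, ← MulChar.coe_toUnitHom, map_zpow, Units.val_zpow_eq_zpow_val,
        MulChar.coe_toUnitHom]
    have hI := ind_sum h hh0 ζ (heh ▸ hζ) H (heh ▸ hHsub) (hdiv ▸ hHres) m
    have : ∑ i ∈ Finset.range h, A (2 * i + 1) * (χ ^ (2 * i + 1)) (1 + algebraMap F F2 x * θ) =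
      if x ∈ D then (h : ℂ) else -h := by
      rw [if_congr hmem rfl rfl, heh, Nat.cast_mul, Nat.cast_two, ← hI]
      refine Finset.sum_congr rfl fun i _ => ?_
      rw [MulChar.pow_apply' _ (by omega), hχm, hA]
    rw [this, heh]
    have : (h : ℂ) ≠ 0 := by exact_mod_cast hh0.ne'
    push_cast
    split_ifs <;> field_simp <;> norm_num
  have hCind : ∀ x : F, (if x ∈ ((fun x => x + s) '' C₀) then (1 : ℂ) else 0) =
      (1 + etaC F (x - s) - if x = s then 1 else 0) / 2 := by
    intro x
    have hmem : x ∈ ((fun x => x + s) '' C₀) ↔ x - s ≠ 0 ∧ IsSquare (x - s) := by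
      rw [hC₀]
      constructor
      · rintro ⟨y, hy, rfl⟩; simpa using hy
      · intro hy; exact ⟨x - s, hy, by simp⟩
    rw [if_congr hmem rfl rfl, ← etaC_eq, quadChar]
    by_cases h1 : x = s
    · simp [h1]
    · have h1' : x - s ≠ 0 := sub_ne_zero.mpr h1
      by_cases h2 : IsSquare (x - s) <;> simp [h1, h1', h2]
  have hNs : (N s : ℂ) = ∑ x : F, (if x ∈ D then (1 : ℂ) else 0) *
      (if x ∈ ((fun x => x + s) '' C₀) then (1 : ℂ) else 0) := by
    rw [hN, Set.ncard_eq_toFinset_card']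
    have : ∀ x : F, (if x ∈ D then (1 : ℂ) else 0) *
      (if x ∈ ((fun x => x + s) '' C₀) then (1 : ℂ) else 0) =
      if x ∈ D ∩ ((fun x => x + s) '' C₀) then 1 else 0 := by
      intro x
      by_cases h1 : x ∈ D <;> by_cases h2 : x ∈ ((fun x => x + s) '' C₀) <;>
        simp only [Set.mem_inter_iff, h1, h2] <;> simp
    simp only [this]
    rw [Finset.sum_boole]
    congr 2
    ext x
    simp only [Set.mem_toFinset, Finset.mem_filter, Finset.mem_univ, true_and]
  have hsumη : ∑ x : F, etaC F (x - s) = 0 := by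
    rw [← MulChar.sum_eq_zero_of_ne_one (etaC_ne_one F hqodd)]
    exact Equiv.sum_comp (Equiv.subRight s) (fun x => etaC F x)
  have hmain : ∀ i : ℕ, ∑ x : F, (χ ^ (2 * i + 1)) (1 + algebraMap F F2 x * θ) *
      (1 + etaC F (x - s) - if x = s then 1 else 0) =
      - (χ (1 + θ * algebraMap F F2 s) ^ (2 * i + 1) + χ θ ^ (2 * i + 1)) +
      gaussSum (etaC F) ψ / (Fintype.card F) * (g (2 * i + 1) *
        χ (θ ^ Fintype.card F - θ) ^ (2 * i + 1) *
        (χ (1 + θ ^ Fintype.card F * algebraMap F F2 s)⁻¹ ^ (2 * i + 1)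
          + χ (- θ ^ Fintype.card F)⁻¹ ^ (2 * i + 1))) := by
    intro i
    have k := key2 F F2 hqodd hF2 θ hθ hθ2 ψ hψ1 (χ ^ (2 * i + 1)) (hX i) tr htr s
    simp only [mul_sub, Finset.sum_sub_distrib, k]
    simp only [mul_ite, mul_one, mul_zero, Finset.sum_ite_eq', Finset.mem_univ, if_true]
    simp only [MulChar.pow_apply' χ (show 2 * i + 1 ≠ 0 by omega), hg]
    rw [mul_comm θ (algebraMap F F2 s)]
    ring
  have hGq : ∑ x : F, quadChar F x * ψ x = gaussSum (etaC F) ψ := by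
    simp only [etaC_eq, gaussSum]
  rw [hGq, hτ1, hτ2, hdiv, hNs]
  simp only [hDind, hCind]
  have step : ∑ x : F, (1 / 2 + 1 / (e : ℂ) * ∑ i ∈ Finset.range h, A (2 * i + 1) *
        (χ ^ (2 * i + 1)) (1 + algebraMap F F2 x * θ)) *
        ((1 + etaC F (x - s) - if x = s then 1 else 0) / 2) =
      1 / 4 * (∑ x : F, (1 + etaC F (x - s) - if x = s then 1 else 0)) +
      1 / (2 * (e : ℂ)) * ∑ i ∈ Finset.range h, A (2 * i + 1) *
        ∑ x : F, (χ ^ (2 * i + 1)) (1 + algebraMap F F2 x * θ) *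
          (1 + etaC F (x - s) - if x = s then 1 else 0) := by
    simp only [Finset.mul_sum]
    rw [Finset.sum_comm, ← Finset.sum_add_distrib]
    refine Finset.sum_congr rfl fun x _ => ?_
    rw [add_mul, Finset.sum_mul]
    congr 1
    · ring
    · refine Finset.sum_congr rfl fun i _ => ?_
      have : (e : ℂ) ≠ 0 := by exact_mod_cast he0.ne'
      field_simp
  rw [step]
  simp only [hmain]
  rw [Finset.sum_sub_distrib, Finset.sum_add_distrib, hsumη]
  simp only [Finset.sum_const, Finset.card_univ, nsmul_eq_mul, mul_one, add_zero,
    Finset.sum_ite_eq', Finset.mem_univ, if_true]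
  simp only [Finset.mul_sum]
  rw [sub_add, ← Finset.sum_sub_distrib, sub_eq_add_neg _ (Finset.sum _ _), ← Finset.sum_neg_distrib]
  congr 1
  · ring
  · refine Finset.sum_congr rfl fun i _ => ?_
    have : (e : ℂ) ≠ 0 := by exact_mod_cast he0.ne'
    have : (Fintype.card F : ℂ) ≠ 0 := by simp
    ring
end
end
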